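/- Every unital complex C*-algebra A, regarded as a real Banach space, has the Mazur–Ulam property: for every real normed space Y, every surjective isometry T from the unit sphere S_A onto the unit sphere S_Y extends to a surjective real linear isometry from A onto Y. -/

import Mathlib

/-- A real normed space `X` has the *Mazur–Ulam property* if for every real normed space `Y`,
every surjective isometry from the unit sphere of `X` onto the unit sphere of `Y` extends to
a surjective real linear isometry from `X` onto `Y`. -/
def HasMazurUlamProperty (X : Type*) [NormedAddCommGroup X] [NormedSpace ℝ X] : Prop :=
  ∀ (Y : Type*) [NormedAddCommGroup Y] [NormedSpace ℝ Y] (T : X → Y),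
    (∀ x ∈ Metric.sphere (0 : X) 1, ∀ y ∈ Metric.sphere (0 : X) 1,
      dist (T x) (T y) = dist x y) →
    T '' Metric.sphere (0 : X) 1 = Metric.sphere (0 : Y) 1 →
    ∃ g : X →ₗᵢ[ℝ] Y, Function.Surjective g ∧ ∀ x ∈ Metric.sphere (0 : X) 1, g x = T x

set_option linter.unusedSectionVars false

/-- A positively homogeneous map restricting to a surjective isometry between unit spheres. -/
structure IsSphereIso {X Y : Type*} [NormedAddCommGroup X] [NormedSpace ℝ X]
    [NormedAddCommGroup Y] [NormedSpace ℝ Y] (τ : X → Y) : Prop where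
  norm_map_unit : ∀ x, ‖x‖ = 1 → ‖τ x‖ = 1
  norm_sub_unit : ∀ x y, ‖x‖ = 1 → ‖y‖ = 1 → ‖τ x - τ y‖ = ‖x - y‖
  exists_unit : ∀ y, ‖y‖ = 1 → ∃ x, ‖x‖ = 1 ∧ τ x = y
  map_smul : ∀ (r : ℝ) (x), 0 ≤ r → τ (r • x) = r • τ x

section Support

variable {X : Type*} [NormedAddCommGroup X] [NormedSpace ℝ X]

theorem apply_le_norm_of_norm_le_one {f : X →L[ℝ] ℝ} (hf : ‖f‖ ≤ 1) (x : X) : f x ≤ ‖x‖ :=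
  (le_abs_self _).trans ((f.le_opNorm x).trans (mul_le_of_le_one_left (norm_nonneg x) hf))

theorem exists_support_functional (x : X) : ∃ f : X →L[ℝ] ℝ, ‖f‖ ≤ 1 ∧ f x = ‖x‖ := by
  obtain ⟨g, hg, hx⟩ := exists_dual_vector'' ℝ x
  exact ⟨g, hg, by simpa using hx⟩

theorem exists_support_functional_pair {x y : X} (hxy : ‖x + y‖ = ‖x‖ + ‖y‖) :
    ∃ f : X →L[ℝ] ℝ, ‖f‖ ≤ 1 ∧ f x = ‖x‖ ∧ f y = ‖y‖ := by
  obtain ⟨f, hf, h⟩ := exists_support_functional (x + y)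
  rw [map_add, hxy] at h
  have h1 := apply_le_norm_of_norm_le_one hf x
  have h2 := apply_le_norm_of_norm_le_one hf y
  exact ⟨f, hf, by linarith, by linarith⟩

theorem exists_support_functional_triple {x y z : X} (h : ‖x + y + z‖ = ‖x‖ + ‖y‖ + ‖z‖) :
    ∃ f : X →L[ℝ] ℝ, ‖f‖ ≤ 1 ∧ f x = ‖x‖ ∧ f y = ‖y‖ ∧ f z = ‖z‖ := by
  obtain ⟨f, hf, h'⟩ := exists_support_functional (x + y + z)
  rw [map_add, map_add, h] at h'
  have h1 := apply_le_norm_of_norm_le_one hf x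
  have h2 := apply_le_norm_of_norm_le_one hf y
  have h3 := apply_le_norm_of_norm_le_one hf z
  exact ⟨f, hf, by linarith, by linarith, by linarith⟩

end Support

namespace IsSphereIso

variable {X Y : Type*} [NormedAddCommGroup X] [NormedSpace ℝ X]
    [NormedAddCommGroup Y] [NormedSpace ℝ Y] {τ : X → Y}

theorem map_zero (h : IsSphereIso τ) : τ 0 = 0 := by
  simpa using h.map_smul 0 0 le_rfl

theorem norm_map (h : IsSphereIso τ) (x : X) : ‖τ x‖ = ‖x‖ := by
  rcases eq_or_ne x 0 with rfl | hx
  · simp [h.map_zero]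
  · have hx' : ‖x‖ ≠ 0 := norm_ne_zero_iff.2 hx
    have h1 : τ x = ‖x‖ • τ (‖x‖⁻¹ • x) := by
      rw [← h.map_smul _ _ (norm_nonneg x), smul_inv_smul₀ hx']
    rw [h1, norm_smul, h.norm_map_unit, norm_norm, mul_one]
    rw [norm_smul, norm_inv, norm_norm, inv_mul_cancel₀ hx']

theorem norm_sub (h : IsSphereIso τ) {x y : X} (hxy : ‖x‖ = ‖y‖) : ‖τ x - τ y‖ = ‖x - y‖ := by
  rcases eq_or_ne x 0 with rfl | hx
  · have : y = 0 := by simpa using hxy.symm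
    simp [this]
  · have hx' : ‖x‖ ≠ 0 := norm_ne_zero_iff.2 hx
    have h1 : τ x = ‖x‖ • τ (‖x‖⁻¹ • x) := by
      rw [← h.map_smul _ _ (norm_nonneg x), smul_inv_smul₀ hx']
    have h2 : τ y = ‖x‖ • τ (‖x‖⁻¹ • y) := by
      rw [← h.map_smul _ _ (norm_nonneg x), smul_inv_smul₀ hx']
    rw [h1, h2, ← smul_sub, norm_smul, h.norm_sub_unit, ← smul_sub, norm_smul]
    · rw [norm_inv, norm_norm, mul_inv_cancel_left₀ hx']
    · rw [norm_smul, norm_inv, norm_norm, inv_mul_cancel₀ hx']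
    · rw [norm_smul, norm_inv, norm_norm, hxy, inv_mul_cancel₀ (hxy ▸ hx')]

theorem injective (h : IsSphereIso τ) : Function.Injective τ := by
  intro x y hxy
  have h1 : ‖x‖ = ‖y‖ := by rw [← h.norm_map, hxy, h.norm_map]
  have := h.norm_sub h1
  rw [hxy, sub_self, norm_zero] at this
  exact sub_eq_zero.1 (norm_eq_zero.1 this.symm)

theorem surjective (h : IsSphereIso τ) : Function.Surjective τ := by
  intro y
  rcases eq_or_ne y 0 with rfl | hy
  · exact ⟨0, h.map_zero⟩
  · have hy' : ‖y‖ ≠ 0 := norm_ne_zero_iff.2 hy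
    obtain ⟨x, -, hx⟩ := h.exists_unit (‖y‖⁻¹ • y)
      (by rw [norm_smul, norm_inv, norm_norm, inv_mul_cancel₀ hy'])
    exact ⟨‖y‖ • x, by rw [h.map_smul _ _ (norm_nonneg y), hx, smul_inv_smul₀ hy']⟩

theorem exists_inverse (h : IsSphereIso τ) :
    ∃ σ : Y → X, IsSphereIso σ ∧ (∀ y, τ (σ y) = y) ∧ ∀ x, σ (τ x) = x := by
  let σ := Function.surjInv h.surjective
  have h1 : ∀ y, τ (σ y) = y := Function.surjInv_eq h.surjective
  have h2 : ∀ x, σ (τ x) = x := fun x => h.injective (h1 _)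
  have h3 : ∀ y, ‖σ y‖ = ‖y‖ := fun y => by rw [← h.norm_map, h1]
  refine ⟨σ, ⟨fun y hy => by rw [h3, hy], fun x y hx hy => ?_, fun x hx => ?_, fun r y hr => ?_⟩,
    h1, h2⟩
  · rw [← h.norm_sub (by rw [h3, h3, hx, hy]), h1, h1]
  · exact ⟨τ x, by rw [h.norm_map, hx], h2 x⟩
  · apply h.injective
    rw [h.map_smul _ _ hr, h1, h1]

theorem comp_isometryEquiv (h : IsSphereIso τ) (e : X ≃ₗᵢ[ℝ] X) : IsSphereIso (fun x => τ (e x)) where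
  norm_map_unit x hx := by rw [h.norm_map, e.norm_map, hx]
  norm_sub_unit x y hx hy := by
    rw [h.norm_sub (by rw [e.norm_map, e.norm_map, hx, hy]), ← map_sub, e.norm_map]
  exists_unit y hy := by
    obtain ⟨x, hx, hxy⟩ := h.exists_unit y hy
    exact ⟨e.symm x, by rw [e.symm.norm_map, hx], by simpa using hxy⟩
  map_smul r x hr := by rw [← h.map_smul _ _ hr, _root_.map_smul]

theorem neg_comp (h : IsSphereIso τ) : IsSphereIso (fun x => - τ x) where
  norm_map_unit x hx := by rw [norm_neg, h.norm_map, hx]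
  norm_sub_unit x y hx hy := by
    rw [neg_sub_neg, norm_sub_rev, h.norm_sub (hx.trans hy.symm)]
  exists_unit y hy := by
    obtain ⟨x, hx, hxy⟩ := h.exists_unit (-y) (by rwa [norm_neg])
    exact ⟨x, hx, by rw [hxy, neg_neg]⟩
  map_smul r x hr := by rw [h.map_smul _ _ hr, smul_neg]

theorem neg_map_neg (h : IsSphereIso τ) : IsSphereIso (fun x => - τ (-x)) :=
  (h.comp_isometryEquiv (LinearIsometryEquiv.neg ℝ)).neg_comp

theorem norm_sub_le (h : IsSphereIso τ) (x y : X) : ‖τ x - τ y‖ ≤ 3 * ‖x - y‖ := by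
  rcases eq_or_ne y 0 with rfl | hy
  · rw [h.map_zero, sub_zero, sub_zero, h.norm_map]
    linarith [norm_nonneg x]
  have hy' : ‖y‖ ≠ 0 := norm_ne_zero_iff.2 hy
  set z := (‖x‖ * ‖y‖⁻¹) • y with hz
  have hn : ‖z‖ = ‖x‖ := by
    rw [hz, norm_smul, norm_mul, norm_inv, norm_norm, norm_norm, mul_assoc, inv_mul_cancel₀ hy',
      mul_one]
  have h1 : z - y = ((‖x‖ - ‖y‖) * ‖y‖⁻¹) • y := by
    rw [hz, sub_mul, mul_inv_cancel₀ hy', sub_smul, one_smul]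
  have h2 : τ z - τ y = ((‖x‖ - ‖y‖) * ‖y‖⁻¹) • τ y := by
    rw [hz, h.map_smul _ _ (by positivity), sub_mul, mul_inv_cancel₀ hy', sub_smul, one_smul]
  have h3 : ‖z - y‖ ≤ ‖x - y‖ := by
    rw [h1, norm_smul, norm_mul, norm_inv, norm_norm, mul_assoc, inv_mul_cancel₀ hy', mul_one]
    exact abs_norm_sub_norm_le x y
  have h4 : ‖τ z - τ y‖ ≤ ‖x - y‖ := by
    rw [h2, norm_smul, h.norm_map, norm_mul, norm_inv, norm_norm, mul_assoc, inv_mul_cancel₀ hy',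
      mul_one]
    exact abs_norm_sub_norm_le x y
  calc ‖τ x - τ y‖ ≤ ‖τ x - τ z‖ + ‖τ z - τ y‖ := norm_sub_le_norm_sub_add_norm_sub _ _ _
    _ = ‖x - z‖ + ‖τ z - τ y‖ := by rw [h.norm_sub hn.symm]
    _ ≤ (‖x - y‖ + ‖y - z‖) + ‖τ z - τ y‖ := by
        gcongr; exact norm_sub_le_norm_sub_add_norm_sub _ _ _
    _ ≤ 3 * ‖x - y‖ := by rw [norm_sub_rev y z]; linarith

theorem continuous (h : IsSphereIso τ) : Continuous τ := by
  refine (LipschitzWith.of_dist_le_mul (K := 3) fun x y => ?_).continuous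
  rw [dist_eq_norm, dist_eq_norm]
  exact h.norm_sub_le x y

theorem norm_add_neg_map_neg (h : IsSphereIso τ) {x y : X} (hx : ‖x‖ = 1) (hy : ‖y‖ = 1) :
    ‖τ x + -τ (-y)‖ = ‖x + y‖ := by
  rw [← sub_eq_add_neg, h.norm_sub (by rw [norm_neg, hx, hy]), sub_neg_eq_add]

theorem norm_triple_neg_map_neg (h : IsSphereIso τ) {x₁ x₂ x₃ : X} (h₁ : ‖x₁‖ = 1)
    (h₂ : ‖x₂‖ = 1) (h₃ : ‖x₃‖ = 1) (hs : ‖x₁ + x₂ + x₃‖ = 3) :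
    ‖-τ (-x₁) + -τ (-x₂) + -τ (-x₃)‖ = 3 := by
  set b : X → Y := fun x => -τ (-x) with hb
  have hbn : ∀ x, ‖b x‖ = ‖x‖ := h.neg_map_neg.norm_map
  set x : X := (3⁻¹ : ℝ) • (x₁ + x₂ + x₃) with hx
  have hx1 : ‖x‖ = 1 := by rw [hx, norm_smul, hs]; norm_num
  -- Alignment with the mean passes to the components.
  have key : ∀ z : Y, ‖z‖ = 1 → ‖z + b x‖ = 2 →
      ‖z + b x₁‖ = 2 ∧ ‖z + b x₂‖ = 2 ∧ ‖z + b x₃‖ = 2 := by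
    intro z hz hzx
    obtain ⟨v, hv, rfl⟩ := h.exists_unit z hz
    rw [hb] at hzx ⊢
    simp only at hzx ⊢
    rw [h.norm_add_neg_map_neg hv hx1] at hzx
    rw [h.norm_add_neg_map_neg hv h₁, h.norm_add_neg_map_neg hv h₂, h.norm_add_neg_map_neg hv h₃]
    obtain ⟨f, hf, hfv, hfx⟩ := exists_support_functional_pair (x := v) (y := x)
      (by rw [hzx, hv, hx1]; norm_num)
    rw [hx, _root_.map_smul, map_add, map_add, ← hx, hx1, smul_eq_mul] at hfx
    have e1 := apply_le_norm_of_norm_le_one hf x₁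
    have e2 := apply_le_norm_of_norm_le_one hf x₂
    have e3 := apply_le_norm_of_norm_le_one hf x₃
    have e : ∀ w : X, ‖w‖ = 1 → f w = 1 → ‖v + w‖ = 2 := by
      intro w hw hfw
      have := apply_le_norm_of_norm_le_one hf (v + w)
      rw [map_add, hfv, hfw, hv] at this
      have := norm_add_le v w
      linarith
    exact ⟨e _ h₁ (by linarith), e _ h₂ (by linarith), e _ h₃ (by linarith)⟩
  have two : ∀ z w : Y, ‖z‖ = 1 → ‖w‖ = 1 → ∀ f : Y →L[ℝ] ℝ, ‖f‖ ≤ 1 → f z = 1 → f w = 1 →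
      ‖z + w‖ = 2 := by
    intro z w hz hw f hf hfz hfw
    have := apply_le_norm_of_norm_le_one hf (z + w)
    rw [map_add, hfz, hfw] at this
    have := norm_add_le z w
    linarith
  have bx : ‖b x‖ = 1 := by rw [hbn, hx1]
  have b1 : ‖b x₁‖ = 1 := by rw [hbn, h₁]
  have b2 : ‖b x₂‖ = 1 := by rw [hbn, h₂]
  have b3 : ‖b x₃‖ = 1 := by rw [hbn, h₃]
  have hz0 : ‖b x + b x‖ = 2 := by rw [← two_smul ℝ, norm_smul, bx]; norm_num
  have s1 := (key _ bx hz0).1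
  set z1 : Y := (2⁻¹ : ℝ) • (b x + b x₁) with hz1
  have nz1 : ‖z1‖ = 1 := by rw [hz1, norm_smul, s1]; norm_num
  obtain ⟨f, hf, f0, f1⟩ := exists_support_functional_pair (x := b x) (y := b x₁)
    (by rw [s1, bx, b1]; norm_num)
  have s2 := (key z1 nz1 (two _ _ nz1 bx f hf
    (by rw [hz1, _root_.map_smul, map_add, f0, f1, bx, b1]; norm_num) (by rw [f0, bx]))).2.1
  obtain ⟨f, hf, f0, f2⟩ := exists_support_functional_pair (x := z1) (y := b x₂)
    (by rw [s2, nz1, b2]; norm_num)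
  set z2 : Y := (2⁻¹ : ℝ) • (z1 + b x₂) with hz2
  have nz2 : ‖z2‖ = 1 := by rw [hz2, norm_smul, s2]; norm_num
  have fx : f (b x) = 1 := by
    have e0 := apply_le_norm_of_norm_le_one hf (b x)
    have e1 := apply_le_norm_of_norm_le_one hf (b x₁)
    rw [nz1, hz1, _root_.map_smul, map_add, smul_eq_mul] at f0
    linarith
  have s3 := (key z2 nz2 (two _ _ nz2 bx f hf
    (by rw [hz2, _root_.map_smul, map_add, f0, f2, nz1, b2]; norm_num) fx)).2.2
  obtain ⟨f, hf, f0, f3⟩ := exists_support_functional_pair (x := z2) (y := b x₃)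
    (by rw [s3, nz2, b3]; norm_num)
  have e0 := apply_le_norm_of_norm_le_one hf (b x)
  have e1 := apply_le_norm_of_norm_le_one hf (b x₁)
  have e2 := apply_le_norm_of_norm_le_one hf (b x₂)
  rw [nz2, hz2, hz1, _root_.map_smul, map_add, _root_.map_smul, map_add, smul_eq_mul,
    smul_eq_mul] at f0
  have e := apply_le_norm_of_norm_le_one hf (b x₁ + b x₂ + b x₃)
  rw [map_add, map_add] at e
  have e' := norm_add₃_le (a := b x₁) (b := b x₂) (c := b x₃)
  change ‖b x₁ + b x₂ + b x₃‖ = 3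
  linarith

theorem norm_triple (h : IsSphereIso τ) {x₁ x₂ x₃ : X} (h₁ : ‖x₁‖ = 1)
    (h₂ : ‖x₂‖ = 1) (h₃ : ‖x₃‖ = 1) (hs : ‖x₁ + x₂ + x₃‖ = 3) :
    ‖τ x₁ + τ x₂ + τ x₃‖ = 3 := by
  simpa using h.neg_map_neg.norm_triple_neg_map_neg h₁ h₂ h₃ hs

theorem norm_pair (h : IsSphereIso τ) {x y : X} (hx : ‖x‖ = 1) (hy : ‖y‖ = 1)
    (hs : ‖x + y‖ = 2) : ‖τ x + τ y‖ = 2 := by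
  obtain ⟨f, hf, fx, fy⟩ := exists_support_functional_pair (x := x) (y := y)
    (by rw [hs, hx, hy]; norm_num)
  have h3 : ‖x + x + y‖ = 3 := by
    have e := apply_le_norm_of_norm_le_one hf (x + x + y)
    rw [map_add, map_add] at e
    have e' := norm_add₃_le (a := x) (b := x) (c := y)
    linarith
  have := h.norm_triple hx hx hy h3
  have e1 := norm_add_le (τ x) (τ x + τ y)
  have e2 := norm_add_le (τ x) (τ y)
  rw [← add_assoc] at e1
  rw [h.norm_map] at e1 e2
  rw [h.norm_map] at e2
  linarith

theorem norm_pair_iff (h : IsSphereIso τ) {x y : X} (hx : ‖x‖ = 1) (hy : ‖y‖ = 1) :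
    ‖τ x + τ y‖ = 2 ↔ ‖x + y‖ = 2 := by
  refine ⟨fun hs => ?_, h.norm_pair hx hy⟩
  obtain ⟨σ, hσ, -, hl⟩ := h.exists_inverse
  simpa [hl] using hσ.norm_pair (by rw [h.norm_map, hx]) (by rw [h.norm_map, hy]) hs

/-- Midpoints of images come from points aligned with everything aligned to the end points. -/
theorem exists_midpoint (h : IsSphereIso τ) {a b : X} (ha : ‖a‖ = 1) (hb : ‖b‖ = 1)
    (hab : ‖a + b‖ = 2) : ∃ c, ‖c‖ = 1 ∧ τ c = (2⁻¹ : ℝ) • (τ a + τ b) ∧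
      ∀ w, ‖w‖ = 1 → ‖a + b + w‖ = 3 → ‖c + w‖ = 2 := by
  obtain ⟨c, hc, e⟩ := h.exists_unit ((2⁻¹ : ℝ) • (τ a + τ b))
    (by rw [norm_smul, h.norm_pair ha hb hab]; norm_num)
  refine ⟨c, hc, e, fun w hw h3 => ?_⟩
  rw [← h.norm_pair_iff hc hw, e]
  have h3' := h.norm_triple ha hb hw h3
  obtain ⟨f, hf, fa, fb, fw⟩ := exists_support_functional_triple (x := τ a) (y := τ b) (z := τ w)
    (by rw [h3', h.norm_map, h.norm_map, h.norm_map, ha, hb, hw]; norm_num)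
  rw [h.norm_map] at fa fb fw
  have e := apply_le_norm_of_norm_le_one hf ((2⁻¹ : ℝ) • (τ a + τ b) + τ w)
  rw [map_add, _root_.map_smul, map_add, smul_eq_mul] at e
  have e' := norm_add_le ((2⁻¹ : ℝ) • (τ a + τ b)) (τ w)
  rw [norm_smul, h.norm_pair ha hb hab, h.norm_map, Real.norm_of_nonneg (by norm_num)] at e'
  linarith

end IsSphereIso

section CStarBasics

theorem norm_one_le_one {A : Type*} [CStarAlgebra A] : ‖(1 : A)‖ ≤ 1 := by
  rcases subsingleton_or_nontrivial A with h | h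
  · rw [Subsingleton.elim (1 : A) 0, norm_zero]; exact zero_le_one
  · rw [CStarRing.norm_one]

variable {A : Type*} [CStarAlgebra A] [PartialOrder A] [StarOrderedRing A]

theorem norm_le_iff_star_mul_self_le {x : A} {r : ℝ} (hr : 0 ≤ r) :
    ‖x‖ ≤ r ↔ star x * x ≤ (r ^ 2) • (1 : A) := by
  rw [← Algebra.algebraMap_eq_smul_one,
    ← CStarAlgebra.norm_le_iff_le_algebraMap _ (by positivity) (star_mul_self_nonneg x),
    CStarRing.norm_star_mul_self, ← sq, sq_le_sq₀ (norm_nonneg _) hr]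

theorem star_mul_self_le_smul_one {x : A} {r : ℝ} (h : ‖x‖ ≤ r) :
    star x * x ≤ (r ^ 2) • (1 : A) :=
  (norm_le_iff_star_mul_self_le ((norm_nonneg x).trans h)).1 h

theorem norm_le_one_iff_star_mul_self_le {x : A} : ‖x‖ ≤ 1 ↔ star x * x ≤ 1 := by
  simpa using norm_le_iff_star_mul_self_le (x := x) zero_le_one

theorem norm_le_one_of_nonneg_of_le_one {x : A} (h0 : 0 ≤ x) (h1 : x ≤ 1) : ‖x‖ ≤ 1 :=
  (CStarAlgebra.norm_le_one_iff_of_nonneg x h0).2 h1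

/-- Two contractions glued along a square partition of unity give a contraction. -/
theorem norm_glue_le_one {s p x y : A} (hs : IsSelfAdjoint s) (hp : IsSelfAdjoint p)
    (hsp : Commute s p) (h1 : s * s + p * p = 1) (hx : ‖x‖ ≤ 1) (hy : ‖y‖ ≤ 1) :
    ‖s * x * s + p * y * p‖ ≤ 1 := by
  rw [norm_le_one_iff_star_mul_self_le] at *
  have e : star (s * x * s + p * y * p) * (s * x * s + p * y * p)
      + star (p * x * s - s * y * p) * (p * x * s - s * y * p)
      = star s * (star x * x) * s + star p * (star y * y) * p := by
    simp only [star_add, star_sub, star_mul, hs.star_eq, hp.star_eq]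
    have c : p * s = s * p := hsp.eq.symm
    have : s * (star x * x) * s + p * (star y * y) * p
        = s * star x * (s * s + p * p) * x * s + p * star y * (s * s + p * p) * y * p := by
      rw [h1]; noncomm_ring
    rw [this]
    have e1 : p * star y * p * (s * x * s) = p * star y * s * (p * x * s) := by
      have : p * star y * p * (s * x * s) = p * star y * (p * s) * (x * s) := by noncomm_ring
      rw [this, c]; noncomm_ring
    have e2 : s * star x * p * (s * y * p) = s * star x * s * (p * y * p) := by
      have : s * star x * p * (s * y * p) = s * star x * (p * s) * (y * p) := by noncomm_ring
      rw [this, c]; noncomm_ring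
    have := e1; have := e2
    calc _ = s * star x * (s * s + p * p) * x * s + p * star y * (s * s + p * p) * y * p
          + (p * star y * p * (s * x * s) - p * star y * s * (p * x * s))
          - (s * star x * p * (s * y * p) - s * star x * s * (p * y * p)) := by noncomm_ring
      _ = _ := by rw [e1, e2]; noncomm_ring
  calc _ ≤ _ := le_add_of_nonneg_right (star_mul_self_nonneg (p * x * s - s * y * p))
    _ = _ := e
    _ ≤ star s * 1 * s + star p * 1 * p :=
      add_le_add (star_left_conjugate_le_conjugate hx s) (star_left_conjugate_le_conjugate hy p)
    _ = 1 := by rw [mul_one, mul_one, hs.star_eq, hp.star_eq, h1]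

theorem nonpos_of_forall_le_mul {a K : ℝ} (h : ∀ t, 0 < t → t ≤ 1 → a ≤ t * K) : a ≤ 0 := by
  by_contra! ha
  have h1 := h 1 one_pos le_rfl
  have hK : 0 < K := by linarith
  have := h (a / (2 * K)) (by positivity) (by rw [div_le_one (by positivity)]; linarith)
  rw [div_mul_eq_mul_div, le_div_iff₀ (by positivity)] at this
  nlinarith

section State

variable {χ : A →L[ℝ] ℝ}

theorem state_nonneg (hχ : ‖χ‖ ≤ 1) (h1 : χ 1 = 1) {p : A} (hp : 0 ≤ p) : 0 ≤ χ p := by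
  rcases eq_or_ne p 0 with rfl | h0
  · simp
  have hn : 0 < ‖p‖ := norm_pos_iff.2 h0
  have hle : p ≤ ‖p‖ • (1 : A) := by
    rw [← Algebra.algebraMap_eq_smul_one]
    exact (IsSelfAdjoint.of_nonneg hp).le_algebraMap_norm_self
  have h2 : ‖‖p‖ • (1 : A) - p‖ ≤ ‖p‖ := by
    rw [CStarAlgebra.norm_le_iff_le_algebraMap _ hn.le (sub_nonneg.2 hle),
      Algebra.algebraMap_eq_smul_one]
    exact sub_le_self _ hp
  have h3 := apply_le_norm_of_norm_le_one hχ (‖p‖ • (1 : A) - p)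
  rw [map_sub, map_smul, h1, smul_eq_mul] at h3
  linarith

theorem state_mono (hχ : ‖χ‖ ≤ 1) (h1 : χ 1 = 1) {a b : A} (hab : a ≤ b) : χ a ≤ χ b := by
  have := state_nonneg hχ h1 (sub_nonneg.2 hab)
  rw [map_sub] at this
  linarith

theorem state_I_smul_nonpos (hχ : ‖χ‖ ≤ 1) (h1 : χ 1 = 1) {s : A} (hs : IsSelfAdjoint s) :
    χ (Complex.I • s) ≤ 0 := by
  refine nonpos_of_forall_le_mul (K := ‖s‖ ^ 2) fun t ht _ => ?_
  set x : A := 1 + t • Complex.I • s with hx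
  have e : star x * x = 1 + (t ^ 2) • (s * s) := by
    rw [hx, star_add, star_one, star_smul, star_smul, hs.star_eq]
    simp only [mul_add, add_mul, mul_one, one_mul, smul_mul_smul_comm, star_trivial]
    simp [sq]
  have h2 : ‖x‖ ^ 2 ≤ 1 + t ^ 2 * ‖s‖ ^ 2 := by
    rw [sq, ← CStarRing.norm_star_mul_self, e]
    refine (norm_add_le _ _).trans (add_le_add norm_one_le_one ?_)
    rw [norm_smul, Real.norm_of_nonneg (by positivity), sq ‖s‖]
    gcongr
    exact norm_mul_le _ _
  have h3 := apply_le_norm_of_norm_le_one hχ x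
  rw [hx, map_add, map_smul, h1, smul_eq_mul, ← hx] at h3
  by_contra! h4
  have h5 : 0 < χ (Complex.I • s) := lt_of_le_of_lt (by positivity) h4
  have h6 : (1 + t * χ (Complex.I • s)) ^ 2 ≤ ‖x‖ ^ 2 := by gcongr
  nlinarith [mul_pos ht h5, mul_pos ht ht, mul_pos ht (sub_pos.2 h4)]

theorem state_I_smul (hχ : ‖χ‖ ≤ 1) (h1 : χ 1 = 1) {s : A} (hs : IsSelfAdjoint s) :
    χ (Complex.I • s) = 0 := by
  refine le_antisymm (state_I_smul_nonpos hχ h1 hs) ?_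
  have := state_I_smul_nonpos hχ h1 hs.neg
  rw [smul_neg, map_neg] at this
  linarith

theorem state_star (hχ : ‖χ‖ ≤ 1) (h1 : χ 1 = 1) (x : A) : χ (star x) = χ x := by
  have hs : IsSelfAdjoint (Complex.I • (x - star x)) := by
    rw [IsSelfAdjoint, star_smul, star_sub, star_star, Complex.star_def, Complex.conj_I, neg_smul,
      ← smul_neg, neg_sub]
  have := state_I_smul hχ h1 hs
  rw [smul_smul, Complex.I_mul_I, neg_one_smul, neg_sub, map_sub] at this
  linarith

theorem state_mul_right_eq_zero (hχ : ‖χ‖ ≤ 1) (h1 : χ 1 = 1) {p : A} (hp : 0 ≤ p) (h0 : χ p = 0) (x : A) :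
    χ (p * x) = 0 := by
  have key : ∀ x : A, -χ (p * x) ≤ 0 := by
    intro x
    refine nonpos_of_forall_le_mul (K := χ (star x * p * x)) fun t ht _ => ?_
    have h2 := state_nonneg hχ h1 (star_left_conjugate_nonneg hp (1 + t • x))
    have e : star (1 + t • x) * p * (1 + t • x)
        = p + t • (p * x) + t • star (p * x) + (t ^ 2) • (star x * p * x) := by
      simp only [star_add, star_one, star_smul, star_trivial, star_mul,
        (IsSelfAdjoint.of_nonneg hp).star_eq, add_mul, mul_add, one_mul, mul_one, smul_mul_assoc,
        mul_smul_comm, smul_add, sq]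
      module
    rw [e, map_add, map_add, map_add, map_smul, map_smul, map_smul, state_star hχ h1, h0,
      smul_eq_mul, smul_eq_mul] at h2
    have h3 : 0 ≤ χ (star x * p * x) := state_nonneg hχ h1 (star_left_conjugate_nonneg hp x)
    by_contra! h4
    nlinarith [mul_pos ht (sub_pos.2 h4), mul_nonneg ht.le h3, mul_nonneg (mul_nonneg ht.le ht.le) h3]
  have h2 := key x
  have h3 := key (-x)
  rw [mul_neg, map_neg] at h3
  linarith

theorem state_mul_left_eq_zero (hχ : ‖χ‖ ≤ 1) (h1 : χ 1 = 1) {p : A} (hp : 0 ≤ p) (h0 : χ p = 0) (x : A) :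
    χ (x * p) = 0 := by
  rw [← state_star hχ h1, star_mul, (IsSelfAdjoint.of_nonneg hp).star_eq]
  exact state_mul_right_eq_zero hχ h1 hp h0 _

end State

theorem state_one_of_nonneg_of_le_one {χ : A →L[ℝ] ℝ} (hχ : ‖χ‖ ≤ 1) {w : A} (h0 : 0 ≤ w)
    (hw : w ≤ 1) (h : χ w = 1) : χ 1 = 1 := by
  have h2 := (apply_le_norm_of_norm_le_one hχ (1 : A)).trans norm_one_le_one
  have h3 : ‖(2 : ℝ) • w - 1‖ ≤ 1 := by
    have hc : w * w ≤ w := by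
      have := CStarAlgebra.pow_antitone h0 hw (show 1 ≤ 2 by norm_num)
      simpa [sq] using this
    rw [norm_le_one_iff_star_mul_self_le, star_sub, star_smul, star_one,
      (IsSelfAdjoint.of_nonneg h0).star_eq, star_trivial]
    have : ((2 : ℝ) • w - 1) * ((2 : ℝ) • w - 1) = 1 - (4 : ℝ) • (w - w * w) := by
      simp only [sub_mul, mul_sub, smul_mul_smul_comm, one_mul, mul_one, smul_sub]
      module
    rw [this]
    exact sub_le_self _ (smul_nonneg (by norm_num) (sub_nonneg.2 hc))
  have h4 := (apply_le_norm_of_norm_le_one hχ _).trans h3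
  rw [map_sub, map_smul, h, smul_eq_mul] at h4
  linarith

/-- The positive element `1 - Re y` dominates half of `(1-y)⋆(1-y)`. -/
theorem star_one_sub_mul_le {y : A} (hy : ‖y‖ ≤ 1) :
    star (1 - y) * (1 - y) ≤ (2 : ℝ) • (1 - (2⁻¹ : ℝ) • (y + star y)) := by
  have := norm_le_one_iff_star_mul_self_le.1 hy
  have e : star (1 - y) * (1 - y) = (1 - y - star y) + star y * y := by
    rw [star_sub, star_one]; noncomm_ring
  have e2 : (2 : ℝ) • (1 - (2⁻¹ : ℝ) • (y + star y)) = (1 - y - star y) + 1 := by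
    module
  rw [e, e2]
  gcongr

theorem one_sub_re_nonneg {y : A} (hy : ‖y‖ ≤ 1) : 0 ≤ 1 - (2⁻¹ : ℝ) • (y + star y) := by
  have h := (star_mul_self_nonneg _).trans (star_one_sub_mul_le hy)
  have := smul_nonneg (show (0 : ℝ) ≤ 2⁻¹ by norm_num) h
  rwa [inv_smul_smul₀ two_ne_zero] at this

theorem eq_zero_of_star_mul_self_nonpos {x : A} (h : star x * x ≤ 0) : x = 0 :=
  CStarRing.star_mul_self_eq_zero_iff x |>.1 (le_antisymm h (star_mul_self_nonneg x))

/-- A contraction aligned with every positive norm-one element of `hAh` acts as the identity on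
the support of `h`. -/
theorem fixes_of_aligned {y h : A} (hy : ‖y‖ ≤ 1) (h0 : 0 ≤ h) (h1 : h ≤ 1)
    (H : ∀ w, 0 ≤ w → ‖w‖ = 1 → (∃ D, w = h * D * h) → ‖y + w‖ = 2) :
    y * h = h ∧ h * y = h := by
  set D : A := 1 - (2⁻¹ : ℝ) • (y + star y) with hD
  have hsa : star h = h := (IsSelfAdjoint.of_nonneg h0).star_eq
  have hD0 : 0 ≤ D := one_sub_re_nonneg hy
  have hDsa : star D = D := (IsSelfAdjoint.of_nonneg hD0).star_eq
  have hhDh : 0 ≤ h * D * h := conjugate_nonneg_of_nonneg hD0 h0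
  have hh : h * h ≤ h := by
    have := CStarAlgebra.pow_antitone h0 h1 (show 1 ≤ 2 by norm_num)
    simpa [sq] using this
  have hz : h * D * h = 0 := by
    by_contra hne
    have hδ : 0 < ‖h * D * h‖ := norm_pos_iff.2 hne
    set δ := ‖h * D * h‖ with hδdef
    set w : A := δ⁻¹ • (h * D * h) with hw
    have hw0 : 0 ≤ w := smul_nonneg (by positivity) hhDh
    have hwn : ‖w‖ = 1 := by
      rw [hw, norm_smul, ← hδdef, norm_inv, Real.norm_of_nonneg hδ.le, inv_mul_cancel₀ hδ.ne']
    have hδw : h * D * h = δ • w := by rw [hw, smul_inv_smul₀ hδ.ne']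
    have hw1 : w ≤ 1 := (CStarAlgebra.norm_le_one_iff_of_nonneg w hw0).1 hwn.le
    have h2 := H w hw0 hwn ⟨δ⁻¹ • D, by rw [hw]; simp⟩
    obtain ⟨χ, hχ, e⟩ := exists_support_functional (y + w)
    rw [h2, map_add] at e
    have e1 := apply_le_norm_of_norm_le_one hχ y
    have e2 := apply_le_norm_of_norm_le_one hχ w
    have hy1 : χ y = 1 := by linarith
    have hw1' : χ w = 1 := by linarith
    have hχ1 := state_one_of_nonneg_of_le_one hχ hw0 hw1 hw1'
    have hχD : χ D = 0 := by
      rw [hD, map_sub, map_smul, map_add, state_star hχ hχ1, hχ1, hy1]; norm_num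
    have hχw : ∀ x, χ (w * x) = χ x := by
      intro x
      have := state_mul_right_eq_zero hχ hχ1 (sub_nonneg.2 hw1)
        (by rw [map_sub, hχ1, hw1', sub_self]) x
      rw [sub_mul, one_mul, map_sub] at this
      linarith
    have h3 : χ (h * D * h * (D * h)) = 0 := by
      rw [hδw, smul_mul_assoc, map_smul, hχw, state_mul_right_eq_zero hχ hχ1 hD0 hχD, smul_zero]
    have h4 : (h * D * h) * (h * D * h) ≤ h * D * h * (D * h) := by
      have := star_left_conjugate_le_conjugate hh (D * h)
      rw [star_mul, hsa, hDsa] at this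
      convert this using 1; noncomm_ring
    have h5 := state_mono hχ hχ1 h4
    rw [h3, hδw, smul_mul_smul_comm, map_smul, hχw, hw1', smul_eq_mul, mul_one] at h5
    nlinarith
  have key : ∀ y : A, ‖y‖ ≤ 1 → D = 1 - (2⁻¹ : ℝ) • (y + star y) → y * h = h := by
    intro y hy hDy
    have h2 := star_left_conjugate_le_conjugate (star_one_sub_mul_le hy) h
    rw [← hDy, mul_smul_comm, smul_mul_assoc, hsa, hz, smul_zero] at h2
    have h3 : star ((1 - y) * h) * ((1 - y) * h) ≤ 0 := by
      rw [star_mul, hsa]; convert h2 using 1; noncomm_ring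
    have h4 := eq_zero_of_star_mul_self_nonpos h3
    rw [sub_mul, one_mul, sub_eq_zero] at h4
    exact h4.symm
  refine ⟨key y hy hD, ?_⟩
  have := key (star y) (by rwa [norm_star]) (by rw [star_star, hD, add_comm])
  rw [← hsa, ← star_star y, ← star_mul, this]

end CStarBasics

section Faces

variable {A : Type*} [CStarAlgebra A] [PartialOrder A] [StarOrderedRing A]
variable {Y : Type*} [NormedAddCommGroup Y] [NormedSpace ℝ Y] {τ : A → Y}

theorem exists_state_of_nonneg {w : A} (hw : 0 ≤ w) (hn : ‖w‖ = 1) :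
    ∃ χ : A →L[ℝ] ℝ, ‖χ‖ ≤ 1 ∧ χ 1 = 1 ∧ χ w = 1 := by
  obtain ⟨χ, hχ, h⟩ := exists_support_functional w
  rw [hn] at h
  have hw1 : w ≤ 1 := (CStarAlgebra.norm_le_one_iff_of_nonneg w hw).1 hn.le
  exact ⟨χ, hχ, state_one_of_nonneg_of_le_one hχ hw hw1 h, h⟩

theorem state_mul_eq_of_apply_eq_one {χ : A →L[ℝ] ℝ} (hχ : ‖χ‖ ≤ 1) (h1 : χ 1 = 1) {w : A}
    (hw : w ≤ 1) (h : χ w = 1) (x : A) : χ (x * w) = χ x := by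
  have := state_mul_left_eq_zero hχ h1 (sub_nonneg.2 hw) (by rw [map_sub, h1, h, sub_self]) x
  rw [mul_sub, mul_one, map_sub] at this
  linarith

theorem norm_eq_one_of_apply_eq_one {X : Type*} [NormedAddCommGroup X] [NormedSpace ℝ X]
    {χ : X →L[ℝ] ℝ} (hχ : ‖χ‖ ≤ 1) {x : X} (hx : ‖x‖ ≤ 1)
    (h : χ x = 1) : ‖x‖ = 1 :=
  le_antisymm hx (h ▸ apply_le_norm_of_norm_le_one hχ x)

theorem norm_add_eq_two_of_apply_eq_one {X : Type*} [NormedAddCommGroup X] [NormedSpace ℝ X]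
    {χ : X →L[ℝ] ℝ} (hχ : ‖χ‖ ≤ 1) {x y : X} (hx : ‖x‖ ≤ 1)
    (hy : ‖y‖ ≤ 1) (h : χ x = 1) (h' : χ y = 1) : ‖x + y‖ = 2 := by
  have e := apply_le_norm_of_norm_le_one hχ (x + y)
  rw [map_add, h, h'] at e
  linarith [norm_add_le x y]

/-- Half of the pinning argument: replacing `p` and `q` by `1` on the support of `b`. -/
theorem exists_midpoint_fixing (hτ : IsSphereIso τ) {s q b p p' c : A} {t : ℝ}
    (hs : IsSelfAdjoint s) (hq : IsSelfAdjoint q) (hsq : Commute s q) (h1 : s * s + q * q = 1)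
    (hb0 : 0 ≤ b) (hb1 : b ≤ 1) (hqb : q * b = b) (hb : b ≠ 0)
    (ht : t ≤ 1)
    (hp : ‖p‖ = 1) (hpq : p * q = t • q) (hps : p * (1 - s) = t • (1 - s))
    (hsp : (1 - s) * p = t • (1 - s))
    (hp' : ‖p'‖ = 1) (hpq' : p' * q = t • q)
    (hps' : p' * (1 - s) = t • (1 - s)) (hsp' : (1 - s) * p' = t • (1 - s))
    (hpp : ‖p + p'‖ = 2) (hc : τ c = (2⁻¹ : ℝ) • (τ p + τ p')) :
    ∃ d : A, d * b = b ∧ ‖c - d‖ ≤ 1 - t := by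
  have hq1 : q * q ≤ 1 := by
    rw [← h1]
    have := star_mul_self_nonneg s
    rw [hs.star_eq] at this
    exact le_add_of_nonneg_left this
  have hqn : ‖q * q‖ ≤ 1 := by
    have := star_mul_self_nonneg q
    rw [hq.star_eq] at this
    exact norm_le_one_of_nonneg_of_le_one this hq1
  have hbsa := IsSelfAdjoint.of_nonneg hb0
  have hbq : b * q = b := by
    rw [← hbsa.star_eq, ← hq.star_eq, ← star_mul, hqb]
  -- the modified elements
  have glue : ∀ p : A, p * (1 - s) = t • (1 - s) → (1 - s) * p = t • (1 - s) →
      s * p * s + q * 1 * q = p + (1 - t) • (q * q) := by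
    intro p hps hsp
    have e1 : p * s = p - t • (1 - s) := by rw [← hps]; noncomm_ring
    have e2 : s * p = p - t • (1 - s) := by rw [← hsp]; noncomm_ring
    have e3 : q * q = 1 - s * s := by rw [← h1]; abel
    rw [mul_one, e2, sub_mul, e1, e3, smul_mul_assoc, sub_mul, one_mul]
    module
  have contr : ∀ p : A, ‖p‖ = 1 → p * (1 - s) = t • (1 - s) → (1 - s) * p = t • (1 - s) →
      ‖p + (1 - t) • (q * q)‖ ≤ 1 := by
    intro p hp hps hsp
    rw [← glue p hps hsp]
    exact norm_glue_le_one hs hq hsq h1 hp.le norm_one_le_one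
  have fixes : ∀ p : A, p * q = t • q → ∀ w, q * w = w → (p + (1 - t) • (q * q)) * w = w := by
    intro p hpq w hw
    have : p * w = t • w := by rw [← hw, ← mul_assoc, hpq, smul_mul_assoc]
    rw [add_mul, this, smul_mul_assoc, mul_assoc, hw, hw, ← add_smul]
    simp
  set P := p + (1 - t) • (q * q) with hP
  set P' := p' + (1 - t) • (q * q) with hP'
  have aligned : ∀ w, 0 ≤ w → ‖w‖ = 1 → (∃ D, w = b * D * b) →
      ‖P + P' + w‖ = 3 ∧ ‖P‖ = 1 ∧ ‖P'‖ = 1 ∧ ‖P + P'‖ = 2 := by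
    rintro w hw0 hw ⟨D, hD⟩
    obtain ⟨χ, hχ, hχ1, hχw⟩ := exists_state_of_nonneg hw0 hw
    have hqw : q * w = w := by rw [hD, ← mul_assoc, ← mul_assoc, hqb]
    have hw1 : w ≤ 1 := (CStarAlgebra.norm_le_one_iff_of_nonneg w hw0).1 hw.le
    have a1 : χ P = 1 := by
      rw [← state_mul_eq_of_apply_eq_one hχ hχ1 hw1 hχw, fixes p hpq w hqw, hχw]
    have a2 : χ P' = 1 := by
      rw [← state_mul_eq_of_apply_eq_one hχ hχ1 hw1 hχw, fixes p' hpq' w hqw, hχw]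
    have n1 := norm_eq_one_of_apply_eq_one hχ (contr p hp hps hsp) a1
    have n2 := norm_eq_one_of_apply_eq_one hχ (contr p' hp' hps' hsp') a2
    refine ⟨?_, n1, n2, norm_add_eq_two_of_apply_eq_one hχ n1.le n2.le a1 a2⟩
    have e := apply_le_norm_of_norm_le_one hχ (P + P' + w)
    rw [map_add, map_add, a1, a2, hχw] at e
    have := norm_add₃_le (a := P) (b := P') (c := w)
    linarith
  have hbb : ‖b * b‖ ≠ 0 := by
    have : star b * b ≠ 0 := fun h => hb ((CStarRing.star_mul_self_eq_zero_iff b).1 h)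
    rw [hbsa.star_eq] at this
    exact norm_ne_zero_iff.2 this
  have hbb0 : 0 ≤ b * b := by
    have := star_mul_self_nonneg b
    rwa [hbsa.star_eq] at this
  obtain ⟨-, n1, n2, n12⟩ := aligned (‖b * b‖⁻¹ • (b * b)) (smul_nonneg (by positivity) hbb0)
    (by rw [norm_smul, norm_inv, norm_norm, inv_mul_cancel₀ hbb]) ⟨‖b * b‖⁻¹ • 1, by simp⟩
  obtain ⟨d, hd, hd', hdw⟩ := hτ.exists_midpoint n1 n2 n12
  refine ⟨d, (fixes_of_aligned hd.le hb0 hb1 fun w hw0 hw hD =>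
    hdw w hw (aligned w hw0 hw hD).1).1, ?_⟩
  have hcn : ‖c‖ = 1 := by
    rw [← hτ.norm_map, hc, norm_smul, hτ.norm_pair hp hp' hpp]; norm_num
  have bound : ∀ p : A, ‖p - (p + (1 - t) • (q * q))‖ ≤ 1 - t := by
    intro p
    rw [sub_add_cancel_left, norm_neg, norm_smul, Real.norm_of_nonneg (by linarith)]
    exact mul_le_of_le_one_right (by linarith) hqn
  rw [← hτ.norm_sub (hcn.trans hd.symm), hc, hd', ← smul_sub, norm_smul, add_sub_add_comm,
    Real.norm_of_nonneg (by norm_num)]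
  have e := norm_add_le (τ p - τ P) (τ p' - τ P')
  rw [hτ.norm_sub (hp.trans n1.symm), hτ.norm_sub (hp'.trans n2.symm)] at e
  have := bound p
  have := bound p'
  linarith

theorem star_mul_le_of_norm_le {x b : A} {r : ℝ} (h : ‖x‖ ≤ r) (hb : IsSelfAdjoint b) :
    star (x * b) * (x * b) ≤ (r ^ 2) • (b * b) := by
  have := star_left_conjugate_le_conjugate (star_mul_self_le_smul_one h) b
  rw [hb.star_eq, mul_smul_comm, mul_one, smul_mul_assoc] at this
  rw [star_mul, hb.star_eq]
  convert this using 1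
  noncomm_ring

/-- Midpoints agree with the common scalar value of the end points on a plateau. -/
theorem midpoint_eq_on_plateau (hτ : IsSphereIso τ) {s q b p p' c : A} {t : ℝ}
    (hs : IsSelfAdjoint s) (hq : IsSelfAdjoint q) (hsq : Commute s q) (h1 : s * s + q * q = 1)
    (hb0 : 0 ≤ b) (hb1 : b ≤ 1) (hqb : q * b = b)
    (ht : t ≤ 1) (ht' : -1 ≤ t)
    (hp : ‖p‖ = 1) (hpq : p * q = t • q) (hps : p * (1 - s) = t • (1 - s))
    (hsp : (1 - s) * p = t • (1 - s))
    (hp' : ‖p'‖ = 1) (hpq' : p' * q = t • q)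
    (hps' : p' * (1 - s) = t • (1 - s)) (hsp' : (1 - s) * p' = t • (1 - s))
    (hpp : ‖p + p'‖ = 2) (hc : τ c = (2⁻¹ : ℝ) • (τ p + τ p')) :
    c * b = t • b := by
  rcases eq_or_ne b 0 with rfl | hb
  · simp
  have hbsa := IsSelfAdjoint.of_nonneg hb0
  obtain ⟨d, hd, hcd⟩ := exists_midpoint_fixing hτ hs hq hsq h1 hb0 hb1 hqb hb ht hp hpq
    hps hsp hp' hpq' hps' hsp' hpp hc
  obtain ⟨d', hd', hcd'⟩ := exists_midpoint_fixing (c := -c) (p := -p) (p' := -p') (t := -t)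
    hτ.neg_map_neg hs hq hsq h1 hb0 hb1
    hqb hb (by linarith) (by rwa [norm_neg]) (by rw [neg_mul, hpq, neg_smul])
    (by rw [neg_mul, hps, neg_smul])
    (by rw [mul_neg, hsp, neg_smul]) (by rwa [norm_neg]) (by rw [neg_mul, hpq', neg_smul])
    (by rw [neg_mul, hps', neg_smul])
    (by rw [mul_neg, hsp', neg_smul]) (by rwa [← neg_add, norm_neg])
    (by simp only [neg_neg]; rw [hc, ← smul_neg, neg_add])
  set δ : A := c * b - t • b with hδ
  have e1 := star_mul_le_of_norm_le hcd hbsa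
  have e2 := star_mul_le_of_norm_le hcd' hbsa
  have f1 : (c - d) * b = δ - (1 - t) • b := by
    rw [sub_mul, hd, hδ]; module
  have f2 : (-c - d') * b = -(δ + (1 + t) • b) := by
    rw [sub_mul, hd', hδ, neg_mul]; module
  rw [f1] at e1
  rw [f2, sub_neg_eq_add] at e2
  have g1 : star (δ - (1 - t) • b) * (δ - (1 - t) • b)
      = star δ * δ - (1 - t) • (star δ * b + b * δ) + ((1 - t) ^ 2) • (b * b) := by
    simp only [star_sub, star_smul, star_trivial, hbsa.star_eq, sub_mul, mul_sub, smul_mul_assoc,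
      mul_smul_comm]
    module
  have g2 : star (-(δ + (1 + t) • b)) * -(δ + (1 + t) • b)
      = star δ * δ + (1 + t) • (star δ * b + b * δ) + ((1 + t) ^ 2) • (b * b) := by
    simp only [star_add, star_neg, star_smul, star_trivial, hbsa.star_eq, add_mul, mul_add,
      smul_mul_assoc, mul_smul_comm, neg_mul_neg]
    module
  rw [g1, add_le_iff_nonpos_left] at e1
  rw [g2, add_le_iff_nonpos_left] at e2
  have k1 := smul_le_smul_of_nonneg_left e1 (show 0 ≤ 1 + t by linarith)
  have k2 := smul_le_smul_of_nonneg_left e2 (show 0 ≤ 1 - t by linarith)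
  have k := add_le_add k1 k2
  have k3 : (1 + t) • (star δ * δ - (1 - t) • (star δ * b + b * δ))
      + (1 - t) • (star δ * δ + (1 + t) • (star δ * b + b * δ)) = (2 : ℝ) • (star δ * δ) := by
    module
  rw [k3, smul_zero, smul_zero, add_zero] at k
  have k4 := smul_le_smul_of_nonneg_left k (show (0 : ℝ) ≤ 2⁻¹ by norm_num)
  rw [inv_smul_smul₀ two_ne_zero, smul_zero] at k4
  exact sub_eq_zero.1 (eq_zero_of_star_mul_self_nonpos k4)

/-- All sign changes of the perturbations in `l` keep `x` in the face supported by `χ`. -/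
def SignedInFace {X : Type*} [NormedAddCommGroup X] [NormedSpace ℝ X] (χ : X →L[ℝ] ℝ) :
    List (X × ℝ) → X → Prop
  | [], x => ‖x‖ ≤ 1 ∧ χ x = 1
  | e :: l, x => SignedInFace χ l (x + e.1) ∧ SignedInFace χ l (x - e.1)

theorem SignedInFace.add_sum {X : Type*} [NormedAddCommGroup X] [NormedSpace ℝ X]
    {χ : X →L[ℝ] ℝ} : ∀ {l : List (X × ℝ)} {x : X},
    SignedInFace χ l x →
    (‖x + (l.map Prod.fst).sum‖ ≤ 1 ∧ χ (x + (l.map Prod.fst).sum) = 1) ∧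
      (‖x - (l.map Prod.fst).sum‖ ≤ 1 ∧ χ (x - (l.map Prod.fst).sum) = 1)
  | [], x, h => by simpa [SignedInFace] using h
  | e :: l, x, h => by
    have h1 := (SignedInFace.add_sum h.1).1
    have h2 := (SignedInFace.add_sum h.2).2
    simp only [List.map_cons, List.sum_cons]
    rw [← add_assoc, ← sub_sub]
    exact ⟨h1, h2⟩

theorem midpoint_eq_on_support (hτ : IsSphereIso τ) {χ : A →L[ℝ] ℝ} (hχ : ‖χ‖ ≤ 1) {f : A}
    (hf : IsSelfAdjoint f) : ∀ (l : List (A × ℝ)) (x c : A),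
    (∀ e ∈ l, ‖e.1‖ ≤ e.2 ∧ star (e.1 * f) * (e.1 * f) = (e.2 ^ 2) • (f * f)) →
    SignedInFace χ l x →
    τ c = (2⁻¹ : ℝ) • (τ (x + (l.map Prod.fst).sum) + τ (x - (l.map Prod.fst).sum)) →
    c * f = x * f
  | [], x, c, _, _, hc => by
    have : τ c = τ x := by
      rw [hc]; simp only [List.map_nil, List.sum_nil, add_zero, sub_zero]; module
    rw [hτ.injective this]
  | e :: l, x, c, hl, hx, hc => by
    set v := (l.map Prod.fst).sum with hv
    obtain ⟨⟨p1, p1'⟩, ⟨p2, p2'⟩⟩ := hx.1.add_sum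
    obtain ⟨⟨m1, m1'⟩, ⟨m2, m2'⟩⟩ := hx.2.add_sum
    rw [← hv] at p1 p1' p2 p2' m1 m1' m2 m2'
    have np1 := norm_eq_one_of_apply_eq_one hχ p1 p1'
    have np2 := norm_eq_one_of_apply_eq_one hχ p2 p2'
    have nm1 := norm_eq_one_of_apply_eq_one hχ m1 m1'
    have nm2 := norm_eq_one_of_apply_eq_one hχ m2 m2'
    simp only [List.map_cons, List.sum_cons] at hc
    rw [← hv, ← add_assoc, ← sub_sub] at hc
    obtain ⟨d, hd⟩ := hτ.surjective ((2⁻¹ : ℝ) • (τ (x + e.1 + v) + τ (x + e.1 - v)))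
    obtain ⟨d', hd'⟩ := hτ.surjective ((2⁻¹ : ℝ) • (τ (x - e.1 + v) + τ (x - e.1 - v)))
    have hl' : ∀ e ∈ l, ‖e.1‖ ≤ e.2 ∧ star (e.1 * f) * (e.1 * f) = (e.2 ^ 2) • (f * f) :=
      fun e he => hl e (List.mem_cons_of_mem _ he)
    have i1 := midpoint_eq_on_support hτ hχ hf l (x + e.1) d hl' hx.1 hd
    have i2 := midpoint_eq_on_support hτ hχ hf l (x - e.1) d' hl' hx.2 hd'
    obtain ⟨he, hef⟩ := hl e List.mem_cons_self
    have unit : ∀ {a b c : A}, ‖a‖ = 1 → ‖b‖ = 1 → χ a = 1 → χ b = 1 →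
        τ c = (2⁻¹ : ℝ) • (τ a + τ b) → ‖c‖ = 1 := by
      intro a b c ha hb ha' hb' h
      rw [← hτ.norm_map, h, norm_smul, hτ.norm_pair ha hb
        (norm_add_eq_two_of_apply_eq_one hχ ha.le hb.le ha' hb')]
      norm_num
    have nc := unit np1 nm2 p1' m2' hc
    have nd := unit np1 np2 p1' p2' hd
    have nd' := unit nm1 nm2 m1' m2' hd'
    have half : ∀ a b : A, a - b = (2 : ℝ) • e.1 → ‖a‖ = 1 → ‖b‖ = 1 →
        ‖(2⁻¹ : ℝ) • (τ a - τ b)‖ ≤ e.2 := by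
      intro a b hab ha hb
      rw [norm_smul, hτ.norm_sub (ha.trans hb.symm), hab, norm_smul]
      norm_num
      linarith
    have b1 : ‖c - d‖ ≤ e.2 := by
      rw [← hτ.norm_sub (nc.trans nd.symm), hc, hd]
      have h := half (x + e.1 - v) (x - e.1 - v) (by module) np2 nm2
      rw [← norm_neg] at h
      refine le_of_eq_of_le (congrArg norm ?_) h
      module
    have b2 : ‖c - d'‖ ≤ e.2 := by
      rw [← hτ.norm_sub (nc.trans nd'.symm), hc, hd']
      refine le_of_eq_of_le (congrArg norm ?_)
        (half (x + e.1 + v) (x - e.1 + v) (by module) np1 nm1)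
      module
    have e1 := star_mul_le_of_norm_le b1 hf
    have e2 := star_mul_le_of_norm_le b2 hf
    set δ := c * f - x * f with hδ
    have f1 : (c - d) * f = δ - e.1 * f := by rw [sub_mul, i1, hδ, add_mul]; abel
    have f2 : (c - d') * f = δ + e.1 * f := by rw [sub_mul, i2, hδ, sub_mul]; abel
    rw [f1, ← hef] at e1
    rw [f2, ← hef] at e2
    have k := add_le_add e1 e2
    have k1 : star (δ - e.1 * f) * (δ - e.1 * f) + star (δ + e.1 * f) * (δ + e.1 * f)
        = (2 : ℝ) • (star δ * δ) + (star (e.1 * f) * (e.1 * f) + star (e.1 * f) * (e.1 * f)) := by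
      rw [star_sub, star_add, two_smul]; noncomm_ring
    rw [k1, add_le_iff_nonpos_left] at k
    have k4 := smul_le_smul_of_nonneg_left k (show (0 : ℝ) ≤ 2⁻¹ by norm_num)
    rw [inv_smul_smul₀ two_ne_zero, smul_zero] at k4
    exact sub_eq_zero.1 (eq_zero_of_star_mul_self_nonpos k4)

end Faces

section UnitInterval

variable {A : Type*} [CStarAlgebra A] [PartialOrder A] [StarOrderedRing A]

theorem spectrum_subset_Icc {K : A} (h0 : 0 ≤ K) (h1 : K ≤ 1) {u : ℝ} (hu : u ∈ spectrum ℝ K) :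
    u ∈ Set.Icc (0 : ℝ) 1 := by
  refine ⟨spectrum_nonneg_of_nonneg h0 hu, ?_⟩
  have : K ≤ algebraMap ℝ A 1 := by rwa [map_one]
  exact (le_algebraMap_iff_spectrum_le (IsSelfAdjoint.of_nonneg h0)).1 this u hu

theorem cfc_isSelfAdjoint (f : ℝ → ℝ) (a : A) : IsSelfAdjoint (cfc f a) := cfc_predicate f a

/-- Elements living at the top spectral point `1` of `K`. -/
def AtTop (K n : A) : Prop :=
  ∀ f : ℝ → ℝ, Continuous f → cfc f K * n = f 1 • n ∧ n * cfc f K = f 1 • n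

namespace AtTop

variable {K n m : A}

theorem add (hn : AtTop K n) (hm : AtTop K m) : AtTop K (n + m) := fun f hf => by
  rw [mul_add, add_mul, smul_add, (hn f hf).1, (hn f hf).2, (hm f hf).1, (hm f hf).2]
  exact ⟨rfl, rfl⟩

theorem smul (hn : AtTop K n) (z : ℂ) : AtTop K (z • n) := fun f hf => by
  rw [mul_smul_comm, smul_mul_assoc, (hn f hf).1, (hn f hf).2, smul_comm]
  exact ⟨rfl, rfl⟩

theorem real_smul (hn : AtTop K n) (r : ℝ) : AtTop K (r • n) := fun f hf => by
  rw [mul_smul_comm, smul_mul_assoc, (hn f hf).1, (hn f hf).2, smul_comm]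
  exact ⟨rfl, rfl⟩

theorem neg (hn : AtTop K n) : AtTop K (-n) := by simpa using hn.real_smul (-1)

theorem sub (hn : AtTop K n) (hm : AtTop K m) : AtTop K (n - m) := by
  rw [sub_eq_add_neg]; exact hn.add hm.neg

theorem star (hn : AtTop K n) : AtTop K (star n) := fun f hf => by
  have h := hn f hf
  constructor
  · rw [← star_star (cfc f K), ← star_mul, (cfc_isSelfAdjoint f K).star_eq, h.2, star_smul,
      star_trivial]
  · rw [← star_star (cfc f K), ← star_mul, (cfc_isSelfAdjoint f K).star_eq, h.1, star_smul,
      star_trivial]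

theorem commute_self (hn : AtTop K n) (hK : IsSelfAdjoint K) : Commute K n := by
  have := hn id continuous_id
  rw [cfc_id ℝ K] at this
  exact this.1.trans this.2.symm

end AtTop

/-- The element equal to `Z` where `q = 1` and to `1` where `q = 0`. -/
theorem glue_one_mem_face {χ : A →L[ℝ] ℝ} (hχ : ‖χ‖ ≤ 1) (hχ1 : χ 1 = 1) {K : A} (h0 : 0 ≤ K)
    (h1 : K ≤ 1) (hχK : χ K = 0) {q : ℝ → ℝ} (hq : Continuous q)
    (hq0 : ∀ u ∈ Set.Icc (0 : ℝ) 1, 0 ≤ q u) (hq1 : ∀ u ∈ Set.Icc (0 : ℝ) 1, q u ≤ 1)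
    (hq6 : ∀ u ∈ Set.Icc (0 : ℝ) 1, q u ≤ 6 * u) {Z : A} (hZ : ‖Z‖ ≤ 1) :
    ‖cfc (fun u => 1 - q u * q u) K + cfc q K * Z * cfc q K‖ ≤ 1 ∧
      χ (cfc (fun u => 1 - q u * q u) K + cfc q K * Z * cfc q K) = 1 := by
  have hKsa := IsSelfAdjoint.of_nonneg h0
  have hc : Continuous fun u => √(1 - q u * q u) := by fun_prop
  have e1 : cfc (fun u => 1 - q u * q u) K
      = cfc (fun u => √(1 - q u * q u)) K * 1 * cfc (fun u => √(1 - q u * q u)) K := by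
    rw [mul_one, ← cfc_mul _ _ K hc.continuousOn hc.continuousOn]
    refine cfc_congr fun u hu => ?_
    have hu' := spectrum_subset_Icc h0 h1 hu
    rw [Real.mul_self_sqrt]
    nlinarith [hq0 u hu', hq1 u hu']
  have e2 : cfc (fun u => 1 - q u * q u) K = 1 - cfc q K * cfc q K := by
    rw [cfc_sub (fun _ => 1) (fun u => q u * q u) K, cfc_const_one ℝ K,
      cfc_mul q q K hq.continuousOn hq.continuousOn]
  constructor
  · have := norm_glue_le_one (cfc_isSelfAdjoint _ K) (cfc_isSelfAdjoint q K)
      (cfc_commute_cfc (fun u => √(1 - q u * q u)) q K) (by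
        rw [mul_one] at e1
        rw [← e1, e2, sub_add_cancel])
        (norm_one_le_one (A := A)) hZ
    rwa [← e1] at this
  · have hqK : χ (cfc q K) = 0 := by
      refine le_antisymm ?_ ?_
      · have : cfc q K ≤ (6 : ℝ) • K := by
          rw [← cfc_const_mul_id (6 : ℝ) K]
          exact (cfc_le_iff _ _ K hq.continuousOn).2 fun u hu =>
            hq6 u (spectrum_subset_Icc h0 h1 hu)
        have := state_mono hχ hχ1 this
        rwa [map_smul, hχK, smul_zero] at this
      · exact state_nonneg hχ hχ1 (cfc_nonneg fun u hu => hq0 u (spectrum_subset_Icc h0 h1 hu))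
    have hqK0 : 0 ≤ cfc q K := cfc_nonneg fun u hu => hq0 u (spectrum_subset_Icc h0 h1 hu)
    rw [e2, map_add, map_sub, hχ1, mul_assoc, state_mul_right_eq_zero hχ hχ1 hqK0 hqK,
      state_mul_right_eq_zero hχ hχ1 hqK0 hqK]
    norm_num

theorem glue_one_eq {K n : A} (hn : AtTop K n) {q : ℝ → ℝ}
    (hq : Continuous q) (hq1 : q 1 = 1) (r : ℝ) :
    cfc (fun u => 1 - q u * q u) K + cfc q K * (r • (1 + n)) * cfc q K
      = cfc (fun u => 1 - (1 - r) * (q u * q u)) K + r • n := by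
  have e : cfc q K * (r • (1 + n)) * cfc q K = r • (cfc q K * cfc q K) + r • n := by
    rw [mul_smul_comm, smul_mul_assoc, mul_add, mul_one, (hn q hq).1, hq1, one_smul, add_mul,
      (hn q hq).2, hq1, one_smul, smul_add]
  rw [e, ← add_assoc, ← cfc_mul q q K hq.continuousOn hq.continuousOn,
    ← cfc_const_mul r _ K, ← cfc_add _ _ _]
  congr 2
  ext u
  ring

theorem signedInFace_map {χ : A →L[ℝ] ℝ} {C Q x : A} {ε t : ℝ}
    (H : ∀ Z : A, Commute C Z → ‖Z‖ ≤ ε → ‖x + Q * Z‖ ≤ 1 ∧ χ (x + Q * Z) = 1) :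
    ∀ (l : List A) (Z : A), Commute C Z → (∀ Z ∈ l, Commute C Z) → (∀ Z ∈ l, ‖Z‖ ≤ t) →
      ‖Z‖ + l.length * t ≤ ε → SignedInFace χ (l.map fun Z => (Q * Z, t)) (x + Q * Z)
  | [], Z, hZ, _, _, hε => H Z hZ (by simpa using hε)
  | e :: l, Z, hZ, hl, ht, hε => by
    have he := hl e List.mem_cons_self
    have het := ht e List.mem_cons_self
    have hl' : ∀ Z ∈ l, Commute C Z := fun Z h => hl Z (List.mem_cons_of_mem _ h)
    have ht' : ∀ Z ∈ l, ‖Z‖ ≤ t := fun Z h => ht Z (List.mem_cons_of_mem _ h)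
    rw [List.length_cons] at hε
    push_cast at hε
    constructor
    · simp only
      rw [add_assoc, ← mul_add]
      exact signedInFace_map H l _ (hZ.add_right he) hl' ht' (by linarith [norm_add_le Z e])
    · simp only
      rw [add_sub_assoc, ← mul_sub]
      exact signedInFace_map H l _ (hZ.sub_right he) hl' ht' (by linarith [norm_sub_le Z e])

/-- A self-adjoint element of norm at most `ρ` is the average of two commuting adjoint multiples
of unitaries. -/
theorem exists_smul_unitary_decomp {v K : A} {ρ : ℝ} (hv : IsSelfAdjoint v) (hρ : ‖v‖ ≤ ρ)
    (hK : Commute K v) : ∃ E : A, E + star E = (2 : ℝ) • v ∧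
      star E * E = (ρ ^ 2) • (1 : A) ∧ E * star E = (ρ ^ 2) • (1 : A) ∧ Commute K E ∧
      Commute K (star E) := by
  set R := cfc (fun x : ℝ => √(ρ ^ 2 - x ^ 2)) v with hR
  have hRsa : star R = R := (cfc_isSelfAdjoint _ v).star_eq
  have hRc : Commute R v := by
    have := cfc_commute_cfc (fun x : ℝ => √(ρ ^ 2 - x ^ 2)) id v
    rwa [cfc_id ℝ v] at this
  have hKR : Commute K R := (hK.symm.cfc_real _).symm
  have hRR : v * v + R * R = (ρ ^ 2) • (1 : A) := by
    have hc : Continuous fun x : ℝ => √(ρ ^ 2 - x ^ 2) := by fun_prop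
    rw [← Algebra.algebraMap_eq_smul_one, ← cfc_const (ρ ^ 2) v, hR,
      ← cfc_mul _ _ v hc.continuousOn hc.continuousOn]
    nth_rw 1 2 [← cfc_id' ℝ v]
    rw [← cfc_mul _ _ v, ← cfc_add _ _ _]
    refine cfc_congr fun x hx => ?_
    have hx' := (IsometricContinuousFunctionalCalculus.norm_spectrum_le v hx).trans hρ
    rw [Real.norm_eq_abs] at hx'
    rw [Real.mul_self_sqrt (by nlinarith [abs_nonneg x, sq_abs x])]
    ring
  have hst : star (v + Complex.I • R) = v - Complex.I • R := by
    rw [star_add, hv.star_eq, star_smul, hRsa, Complex.star_def, Complex.conj_I]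
    module
  have hI : ∀ z : A, Complex.I • Complex.I • z = -z := fun z => by
    rw [smul_smul, Complex.I_mul_I, neg_one_smul]
  have hKI : Commute K (Complex.I • R) := hKR.smul_right _
  refine ⟨v + Complex.I • R, ?_, ?_, ?_, hK.add_right hKI, ?_⟩
  · rw [hst]; module
  · rw [hst, ← hRR]
    simp only [sub_mul, mul_add, smul_mul_assoc, mul_smul_comm, hI, hRc.eq, smul_sub]
    abel
  · rw [hst, ← hRR]
    simp only [add_mul, mul_sub, smul_mul_assoc, mul_smul_comm, hI, hRc.eq, smul_add]
    abel
  · rw [hst]; exact hK.sub_right hKI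

end UnitInterval

section TopGlue

variable {A : Type*} [CStarAlgebra A] [PartialOrder A] [StarOrderedRing A]

/-- The element equal to `1` where `q = 0` and to `r • (1 + n)` where `q = 1`. -/
noncomputable def topGlue (K : A) (q : ℝ → ℝ) (r : ℝ) (n : A) : A :=
  cfc (fun u => 1 - (1 - r) * (q u * q u)) K + r • n

/-- Cut-off functions on the unit interval vanishing to first order at `0` and equal to `1`
at `1`. -/
structure IsCutoff (q : ℝ → ℝ) : Prop where
  continuous : Continuous q
  nonneg : ∀ u ∈ Set.Icc (0 : ℝ) 1, 0 ≤ q u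
  le_one : ∀ u ∈ Set.Icc (0 : ℝ) 1, q u ≤ 1
  le_six_mul : ∀ u ∈ Set.Icc (0 : ℝ) 1, q u ≤ 6 * u
  map_one : q 1 = 1

theorem topGlue_add_mem_face {χ : A →L[ℝ] ℝ} (hχ : ‖χ‖ ≤ 1) (hχ1 : χ 1 = 1) {K : A} (h0 : 0 ≤ K)
    (h1 : K ≤ 1) (hχK : χ K = 0) {q : ℝ → ℝ} (hq : IsCutoff q) {n : A} (hn : AtTop K n)
    (hn1 : ‖1 + n‖ ≤ 1) {r : ℝ} (hr : 0 ≤ r) {Z : A} (hKZ : Commute K Z) (hZ : ‖Z‖ ≤ 1 - r) :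
    ‖topGlue K q r n + cfc (fun u => q u * q u) K * Z‖ ≤ 1 ∧
      χ (topGlue K q r n + cfc (fun u => q u * q u) K * Z) = 1 := by
  have hq' := hq.continuous
  have key := glue_one_mem_face hχ hχ1 h0 h1 hχK hq' hq.nonneg hq.le_one hq.le_six_mul
    (Z := r • (1 + n) + Z) (by
      refine (norm_add_le _ _).trans ?_
      rw [norm_smul, Real.norm_of_nonneg hr]
      nlinarith)
  have hqZ : Commute (cfc q K) Z := hKZ.cfc_real q
  have e : cfc q K * (r • (1 + n) + Z) * cfc q K
      = cfc q K * (r • (1 + n)) * cfc q K + cfc (fun u => q u * q u) K * Z := by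
    rw [mul_add, add_mul, hqZ.eq, mul_assoc Z, ← cfc_mul q q K hq'.continuousOn hq'.continuousOn,
      (hKZ.cfc_real fun u => q u * q u).eq]
  rw [e, ← add_assoc, glue_one_eq hn hq' hq.map_one] at key
  exact key

theorem topGlue_mem_face {χ : A →L[ℝ] ℝ} (hχ : ‖χ‖ ≤ 1) (hχ1 : χ 1 = 1) {K : A} (h0 : 0 ≤ K)
    (h1 : K ≤ 1) (hχK : χ K = 0) {q : ℝ → ℝ} (hq : IsCutoff q) {n : A} (hn : AtTop K n)
    (hn1 : ‖1 + n‖ ≤ 1) {r : ℝ} (hr : 0 ≤ r) (hr1 : r ≤ 1) :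
    ‖topGlue K q r n‖ = 1 ∧ χ (topGlue K q r n) = 1 := by
  have := topGlue_add_mem_face hχ hχ1 h0 h1 hχK hq hn hn1 hr (Commute.zero_right K)
    (by rw [norm_zero]; linarith)
  rw [mul_zero, add_zero] at this
  exact ⟨norm_eq_one_of_apply_eq_one hχ this.1 this.2, this.2⟩

theorem norm_le_of_star_mul_self_eq {E : A} {ρ : ℝ} (hρ : 0 ≤ ρ)
    (h : star E * E = (ρ ^ 2) • (1 : A)) : ‖E‖ ≤ ρ := by
  have e : ‖E‖ * ‖E‖ ≤ ρ ^ 2 := by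
    rw [← CStarRing.norm_star_mul_self, h, norm_smul, Real.norm_of_nonneg (by positivity)]
    exact mul_le_of_le_one_right (by positivity) norm_one_le_one
  exact abs_le_of_sq_le_sq' (by nlinarith) hρ |>.2

theorem exists_list_decomp {v K : A} {ρ : ℝ} (hρ : ‖v‖ ≤ ρ) (hK : Commute K v)
    (hK' : Commute K (star v)) : ∃ l : List A, l.length = 4 ∧ l.sum = v ∧
      ∀ E ∈ l, star E * E = ((ρ / 2) ^ 2) • (1 : A) ∧ Commute K E := by
  have hI : ∀ z : A, Complex.I • Complex.I • z = -z := fun z => by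
    rw [smul_smul, Complex.I_mul_I, neg_one_smul]
  obtain ⟨E, h1, h2, h3, h4, h5⟩ := exists_smul_unitary_decomp (v := (2⁻¹ : ℝ) • (v + star v))
    (K := K) (ρ := ρ) (by
      rw [IsSelfAdjoint, star_smul, star_add, star_star, star_trivial, add_comm]) (by
      rw [norm_smul]
      have := norm_add_le v (star v)
      rw [norm_star] at this
      norm_num
      linarith) ((hK.add_right hK').smul_right _)
  obtain ⟨F, k1, k2, k3, k4, k5⟩ := exists_smul_unitary_decomp
    (v := Complex.I • (2⁻¹ : ℝ) • (star v - v)) (K := K) (ρ := ρ) (by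
      rw [IsSelfAdjoint, star_smul, Complex.star_def, Complex.conj_I, star_smul, star_trivial,
        star_sub, star_star]
      module) (by
      rw [norm_smul, norm_smul]
      have := norm_sub_le (star v) v
      rw [norm_star] at this
      norm_num
      linarith) (((hK'.sub_right hK).smul_right _).smul_right _)
  have half : ∀ z w : A, w * z = (ρ ^ 2) • (1 : A) →
      ((2⁻¹ : ℝ) • w) * ((2⁻¹ : ℝ) • z) = ((ρ / 2) ^ 2) • (1 : A) := by
    intro z w h
    rw [smul_mul_assoc, mul_smul_comm, h]
    module
  have half' : ∀ z w : A, w * z = (ρ ^ 2) • (1 : A) →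
      (Complex.I • (2⁻¹ : ℝ) • w) * (Complex.I • (2⁻¹ : ℝ) • -z) = ((ρ / 2) ^ 2) • (1 : A) := by
    intro z w h
    rw [smul_mul_assoc, mul_smul_comm, smul_neg, mul_neg, half z w h]
    simp only [smul_neg, hI, neg_neg]
  have stI : ∀ z : A, star (Complex.I • (2⁻¹ : ℝ) • z) = Complex.I • (2⁻¹ : ℝ) • -star z := by
    intro z
    rw [star_smul, Complex.star_def, Complex.conj_I, star_smul, star_trivial]
    module
  refine ⟨[(2⁻¹ : ℝ) • E, (2⁻¹ : ℝ) • star E, Complex.I • (2⁻¹ : ℝ) • F,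
    Complex.I • (2⁻¹ : ℝ) • star F], rfl, ?_, ?_⟩
  · have e : [(2⁻¹ : ℝ) • E, (2⁻¹ : ℝ) • star E, Complex.I • (2⁻¹ : ℝ) • F,
        Complex.I • (2⁻¹ : ℝ) • star F].sum
        = (2⁻¹ : ℝ) • (E + star E) + Complex.I • (2⁻¹ : ℝ) • (F + star F) := by
      simp only [List.sum_cons, List.sum_nil]; module
    rw [e, h1, k1, inv_smul_smul₀ two_ne_zero, inv_smul_smul₀ two_ne_zero, hI]
    module
  · intro Z hZ
    simp only [List.mem_cons, List.not_mem_nil, or_false] at hZ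
    rcases hZ with rfl | rfl | rfl | rfl
    · exact ⟨by rw [star_smul, star_trivial]; exact half _ _ h2, h4.smul_right _⟩
    · exact ⟨by rw [star_smul, star_trivial, star_star]; exact half _ _ h3, h5.smul_right _⟩
    · refine ⟨?_, (k4.smul_right _).smul_right _⟩
      rw [stI]
      simpa using half' F (star F) k2
    · refine ⟨?_, (k5.smul_right _).smul_right _⟩
      rw [stI, star_star]
      simpa using half' (star F) F k3

variable {Y : Type*} [NormedAddCommGroup Y] [NormedSpace ℝ Y] {τ : A → Y}

theorem midpoint_topGlue_eq_on_top (hτ : IsSphereIso τ) {χ : A →L[ℝ] ℝ} (hχ : ‖χ‖ ≤ 1)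
    (hχ1 : χ 1 = 1) {K : A} (h0 : 0 ≤ K) (h1 : K ≤ 1) (hχK : χ K = 0) {q f : ℝ → ℝ}
    (hq : IsCutoff q) (hf : Continuous f) (hqf : ∀ u ∈ Set.Icc (0 : ℝ) 1, q u * f u = f u)
    {n v : A} (hn : AtTop K n) (hv : AtTop K v) (hn1 : ‖1 + n‖ ≤ 1) {r : ℝ} (hr : 0 ≤ r)
    (hr1 : 2 * ‖v‖ ≤ 1 - r) {c : A}
    (hc : τ c = (2⁻¹ : ℝ) • (τ (topGlue K q r n + v) + τ (topGlue K q r n - v))) :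
    c * cfc f K = topGlue K q r n * cfc f K := by
  have hK := IsSelfAdjoint.of_nonneg h0
  have hqc := hq.continuous
  set Q := cfc (fun u => q u * q u) K with hQ
  obtain ⟨l, hl4, hlv, hl⟩ := exists_list_decomp le_rfl (hv.commute_self hK)
    (hv.star.commute_self hK)
  have hnorm : ∀ E ∈ l, ‖E‖ ≤ ‖v‖ / 2 := fun E hE =>
    norm_le_of_star_mul_self_eq (by positivity) (hl E hE).1
  have hQf : Q * cfc f K = cfc f K := by
    rw [hQ, ← cfc_mul _ _ K]
    refine cfc_congr fun u hu => ?_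
    have := hqf u (spectrum_subset_Icc h0 h1 hu)
    rw [mul_assoc, this, this]
  have hQ1 : ‖Q‖ ≤ 1 := norm_cfc_le zero_le_one fun u hu => by
    have hu' := spectrum_subset_Icc h0 h1 hu
    have a := hq.nonneg u hu'
    have b := hq.le_one u hu'
    rw [Real.norm_of_nonneg (by positivity)]
    nlinarith
  have hsum : ((l.map fun Z => (Q * Z, ‖v‖ / 2)).map Prod.fst).sum = v := by
    rw [List.map_map]
    have : (Prod.fst ∘ fun Z => (Q * Z, ‖v‖ / 2)) = fun Z => Q * Z := rfl
    rw [this, List.sum_map_mul_left, List.map_id', hlv, hQ,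
      (hv (fun u => q u * q u) (by fun_prop)).1]
    simp [hq.map_one]
  have face := signedInFace_map (χ := χ) (C := K) (Q := Q) (x := topGlue K q r n) (ε := 1 - r)
    (t := ‖v‖ / 2) (fun Z hKZ hZ => topGlue_add_mem_face hχ hχ1 h0 h1 hχK hq hn hn1 hr hKZ hZ)
    l 0 (Commute.zero_right _) (fun Z hZ => (hl Z hZ).2) hnorm (by
      rw [hl4, norm_zero]; push_cast; linarith)
  rw [mul_zero, add_zero] at face
  refine midpoint_eq_on_support hτ hχ (cfc_isSelfAdjoint f K) _ _ _ ?_ face (by rw [hsum, hc])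
  intro e he
  rw [List.mem_map] at he
  obtain ⟨Z, hZ, rfl⟩ := he
  constructor
  · refine (norm_mul_le _ _).trans ?_
    have := hnorm Z hZ
    nlinarith [norm_nonneg Z, norm_nonneg Q]
  · have e : Q * Z * cfc f K = Z * cfc f K := by
      rw [((hl Z hZ).2.cfc_real fun u => q u * q u).eq, mul_assoc, hQf]
    simp only
    rw [e, star_mul, (cfc_isSelfAdjoint f K).star_eq, mul_assoc, ← mul_assoc (star Z),
      (hl Z hZ).1, smul_mul_assoc, one_mul, mul_smul_comm]

end TopGlue

section Ramp

/-- The piecewise linear function equal to `0` on `[0, 1/3]` and to `1` on `[2/3, 1]`. -/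
noncomputable def ramp (u : ℝ) : ℝ := min 1 (max 0 (3 * u - 1))

@[fun_prop]
theorem continuous_ramp : Continuous ramp := by unfold ramp; fun_prop

theorem ramp_nonneg (u : ℝ) : 0 ≤ ramp u := le_min zero_le_one (le_max_left _ _)

theorem ramp_le_one (u : ℝ) : ramp u ≤ 1 := min_le_left _ _

theorem ramp_eq_one {u : ℝ} (h : 2 / 3 ≤ u) : ramp u = 1 :=
  min_eq_left (le_max_of_le_right (by linarith))

theorem abs_ramp_sub_le (u v : ℝ) : |ramp u - ramp v| ≤ 3 * |u - v| := by
  unfold ramp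
  refine (abs_min_sub_min_le_max _ _ _ _).trans ?_
  rw [sub_self, abs_zero]
  refine max_le (by positivity) ((abs_max_sub_max_le_max _ _ _ _).trans ?_)
  rw [sub_self, abs_zero]
  refine max_le (by positivity) (le_of_eq ?_)
  rw [show 3 * u - 1 - (3 * v - 1) = 3 * (u - v) by ring, abs_mul, abs_of_pos (by norm_num)]

theorem abs_ramp_sq_sub_le (u v : ℝ) :
    |ramp u * ramp u - ramp v * ramp v| ≤ 6 * |u - v| := by
  rw [mul_self_sub_mul_self, abs_mul]
  have h1 := abs_ramp_sub_le u v
  have h2 : |ramp u + ramp v| ≤ 2 := by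
    rw [abs_of_nonneg (add_nonneg (ramp_nonneg _) (ramp_nonneg _))]
    linarith [ramp_le_one u, ramp_le_one v]
  nlinarith [abs_nonneg (ramp u - ramp v), abs_nonneg (ramp u + ramp v), abs_nonneg (u - v)]

/-- The truncation of `u` to the interval `[-a, a]`. -/
noncomputable def trunc (a u : ℝ) : ℝ := max (-a) (min a u)

@[fun_prop]
theorem continuous_trunc (a : ℝ) : Continuous (trunc a) := by unfold trunc; fun_prop

theorem abs_trunc_le {a : ℝ} (ha : 0 ≤ a) (u : ℝ) : |trunc a u| ≤ a :=
  abs_le.2 ⟨le_max_left _ _, max_le (by linarith) (min_le_left _ _)⟩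

theorem trunc_eq_self {a u : ℝ} (h : |u| ≤ a) : trunc a u = u := by
  unfold trunc
  rw [min_eq_right (abs_le.1 h).2, max_eq_right (abs_le.1 h).1]

theorem isCutoff_ramp_sub_trunc {κ a : ℝ} (ha : 0 ≤ a) (ha' : a ≤ 1 / 3) :
    IsCutoff fun u => ramp (u - trunc a (u - κ)) where
  continuous := by fun_prop
  nonneg u _ := ramp_nonneg _
  le_one u _ := ramp_le_one _
  le_six_mul u hu := by
    have := abs_le.1 (abs_trunc_le ha (u - κ))
    refine (min_le_right _ _).trans (max_le (by linarith [hu.1]) ?_)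
    linarith [hu.1]
  map_one := by
    have := abs_le.1 (abs_trunc_le ha (1 - κ))
    exact ramp_eq_one (by linarith)

theorem isCutoff_ramp : IsCutoff ramp where
  continuous := continuous_ramp
  nonneg u _ := ramp_nonneg _
  le_one u _ := ramp_le_one _
  le_six_mul u hu := (min_le_right _ _).trans (max_le (by linarith [hu.1]) (by linarith [hu.1]))
  map_one := ramp_eq_one (by norm_num)

/-- The tent of slope `N` centred at `l / N`. -/
noncomputable def tent (N l u : ℝ) : ℝ := max 0 (1 - |N * u - l|)

@[fun_prop]
theorem continuous_tent (N l : ℝ) : Continuous (tent N l) := by unfold tent; fun_prop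

theorem tent_nonneg (N l u : ℝ) : 0 ≤ tent N l u := le_max_left _ _

theorem tent_le_one (N l u : ℝ) : tent N l u ≤ 1 :=
  max_le zero_le_one (by linarith [abs_nonneg (N * u - l)])

theorem abs_sub_lt_of_tent_ne_zero {N l u : ℝ} (h : tent N l u ≠ 0) : |N * u - l| < 1 := by
  by_contra! h'
  exact h (max_eq_left (by linarith))

theorem one_le_sum_tent {N : ℕ} {u : ℝ} (hu : u ∈ Set.Icc (0 : ℝ) 1) :
    1 ≤ 4 * ∑ l ∈ Finset.range (N + 1), tent N l u * tent N l u := by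
  have hNu : 0 ≤ N * u + 1 / 2 := by have := hu.1; positivity
  have h1 := Nat.floor_le hNu
  have h2 := Nat.lt_floor_add_one (N * u + 1 / 2)
  have hmem : ⌊N * u + 1 / 2⌋₊ ∈ Finset.range (N + 1) := by
    rw [Finset.mem_range, Nat.floor_lt hNu]
    push_cast
    nlinarith [hu.2, (Nat.cast_nonneg N : (0 : ℝ) ≤ N)]
  have h3 := Finset.single_le_sum (f := fun l : ℕ => tent N l u * tent N l u)
    (fun l _ => mul_self_nonneg _) hmem
  have h4 : 1 / 2 ≤ tent N ⌊N * u + 1 / 2⌋₊ u := by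
    refine le_max_of_le_right ?_
    have : |N * u - ⌊N * u + 1 / 2⌋₊| ≤ 1 / 2 := abs_le.2 ⟨by linarith, by linarith⟩
    linarith
  nlinarith

end Ramp

section Localization

variable {A : Type*} [CStarAlgebra A] [PartialOrder A] [StarOrderedRing A]
variable {Y : Type*} [NormedAddCommGroup Y] [NormedSpace ℝ Y] {τ : A → Y}

theorem norm_sq_le_sum_tent {K : A} (h0 : 0 ≤ K) (h1 : K ≤ 1) (z : A) (N : ℕ) :
    ‖z‖ ^ 2 ≤ 4 * ∑ l ∈ Finset.range (N + 1), ‖z * cfc (tent N l) K‖ ^ 2 := by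
  have hK := IsSelfAdjoint.of_nonneg h0
  set B : ℕ → A := fun l => cfc (tent N l) K
  have hB : ∀ l, star (B l) = B l := fun l => (cfc_isSelfAdjoint _ K).star_eq
  have k1 : (1 : A) ≤ (4 : ℝ) • ∑ l ∈ Finset.range (N + 1), B l * B l := by
    have : ∑ l ∈ Finset.range (N + 1), B l * B l
        = cfc (fun u => ∑ l ∈ Finset.range (N + 1), tent N l u * tent N l u) K := by
      have := cfc_sum (fun (l : ℕ) u => tent N l u * tent N l u) K (Finset.range (N + 1))
        (fun l _ => by fun_prop)
      rw [Finset.sum_fn] at this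
      rw [this]
      exact Finset.sum_congr rfl fun l _ => (cfc_mul _ _ K).symm
    rw [this, ← cfc_const_mul (4 : ℝ) _ K, ← cfc_const_one ℝ K]
    exact (cfc_le_iff _ _ K).2 fun u hu => one_le_sum_tent (spectrum_subset_Icc h0 h1 hu)
  have k2 := star_right_conjugate_le_conjugate k1 z
  rw [mul_one] at k2
  have e : z * ((4 : ℝ) • ∑ l ∈ Finset.range (N + 1), B l * B l) * star z
      = (4 : ℝ) • ∑ l ∈ Finset.range (N + 1), (z * B l) * star (z * B l) := by
    rw [mul_smul_comm, smul_mul_assoc, Finset.mul_sum, Finset.sum_mul]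
    congr 1
    refine Finset.sum_congr rfl fun l _ => ?_
    rw [star_mul, hB]
    noncomm_ring
  rw [e] at k2
  have k3 := CStarAlgebra.norm_le_norm_of_nonneg_of_le (mul_star_self_nonneg z) k2
  rw [CStarRing.norm_self_mul_star, norm_smul, Real.norm_of_nonneg (by norm_num)] at k3
  rw [sq]
  refine k3.trans (mul_le_mul_of_nonneg_left ?_ (by norm_num))
  refine (norm_sum_le _ _).trans (Finset.sum_le_sum fun l _ => ?_)
  rw [CStarRing.norm_self_mul_star, sq]

theorem cfc_mul_eq_smul {K : A} {φ θ : ℝ → ℝ} (hφ : Continuous φ)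
    (hθ : Continuous θ) {t : ℝ} (h : ∀ u, θ u ≠ 0 → φ u = t) :
    cfc φ K * cfc θ K = t • cfc θ K := by
  rw [← cfc_mul _ _ K, ← cfc_const_mul t θ K]
  refine cfc_congr fun u _ => ?_
  by_cases hu : θ u = 0
  · simp [hu]
  · rw [h u hu]

theorem norm_topGlue_sub_le {K : A} {r κ a : ℝ} (hr : 0 ≤ r) (hr1 : r ≤ 1)
    (ha : 0 ≤ a) (n : A) :
    ‖topGlue K ramp r n - topGlue K (fun u => ramp (u - trunc a (u - κ))) r n‖ ≤ 6 * a := by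
  rw [topGlue, topGlue, add_sub_add_right_eq_sub, ← cfc_sub _ _ K]
  refine norm_cfc_le (by positivity) fun u _ => ?_
  have k := abs_ramp_sq_sub_le u (u - trunc a (u - κ))
  rw [sub_sub_cancel] at k
  have k2 := abs_trunc_le ha (u - κ)
  set y := ramp (u - trunc a (u - κ))
  rw [Real.norm_eq_abs, show 1 - (1 - r) * (ramp u * ramp u) - (1 - (1 - r) * (y * y))
    = -((1 - r) * (ramp u * ramp u - y * y)) by ring, abs_neg, abs_mul,
    abs_of_nonneg (by linarith)]
  nlinarith [abs_nonneg (ramp u * ramp u - y * y)]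

theorem exists_midpoint_scalar_on_tent (hτ : IsSphereIso τ) {χ : A →L[ℝ] ℝ} (hχ : ‖χ‖ ≤ 1)
    (hχ1 : χ 1 = 1) {K : A} (h0 : 0 ≤ K) (h1 : K ≤ 1) (hχK : χ K = 0)
    {n₁ n₂ : A} (hn₁ : AtTop K n₁) (hn₂ : AtTop K n₂) (hn₁' : ‖1 + n₁‖ ≤ 1)
    (hn₂' : ‖1 + n₂‖ ≤ 1) {r : ℝ} (hr : 0 ≤ r) (hr1 : r ≤ 1) {N l : ℝ} (hN : 9 ≤ N)
    (hl : l + 3 ≤ N) {c : A}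
    (hc : τ c = (2⁻¹ : ℝ) • (τ (topGlue K ramp r n₁) + τ (topGlue K ramp r n₂))) :
    ∃ c', ‖c - c'‖ ≤ 18 / N ∧
      c' * cfc (tent N l) K = (1 - (1 - r) * (ramp (l / N) * ramp (l / N))) • cfc (tent N l) K := by
  have hK := IsSelfAdjoint.of_nonneg h0
  have hN0 : 0 < N := by linarith
  have ha : 0 ≤ 3 / N := by positivity
  have ha' : 3 / N ≤ 1 / 3 := by rw [div_le_div_iff₀ hN0 (by norm_num)]; linarith
  set q : ℝ → ℝ := fun u => ramp (u - trunc (3 / N) (u - l / N)) with hq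
  have hqc : IsCutoff q := isCutoff_ramp_sub_trunc ha ha'
  have hqcont := hqc.continuous
  set t : ℝ := 1 - (1 - r) * (ramp (l / N) * ramp (l / N)) with ht
  set θ : ℝ → ℝ := fun u => min 1 (max 0 (3 - |N * u - l|)) with hθ
  have hθc : Continuous θ := by fun_prop
  have hθ0 : ∀ u, 0 ≤ θ u := fun u => le_min zero_le_one (le_max_left _ _)
  have hθ1 : ∀ u, θ u ≤ 1 := fun u => min_le_left _ _
  have hθt : θ 1 = 0 := by
    have : 3 ≤ |N * 1 - l| := le_abs.2 (Or.inl (by linarith))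
    simp only [hθ]
    rw [max_eq_left (by linarith), min_eq_right zero_le_one]
  have hφ : ∀ u, θ u ≠ 0 → 1 - (1 - r) * (q u * q u) = t := by
    intro u hu
    have h3 : |N * u - l| < 3 := by
      by_contra! h'
      refine hu ?_
      simp only [hθ]
      rw [max_eq_left (by linarith), min_eq_right zero_le_one]
    have : |u - l / N| ≤ 3 / N := by
      rw [show u - l / N = (N * u - l) / N by field_simp, abs_div, abs_of_pos hN0]
      gcongr
    simp only [hq, ht]
    rw [trunc_eq_self this, sub_sub_cancel]
  have hsc : Continuous fun u => √(1 - θ u * θ u) := by fun_prop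
  set s := cfc (fun u => √(1 - θ u * θ u)) K with hs
  have h1s : 1 - s = cfc (fun u => 1 - √(1 - θ u * θ u)) K := by
    rw [cfc_sub (fun _ => 1) _ K, cfc_const_one ℝ K]
  have hss : s * s + cfc θ K * cfc θ K = 1 := by
    rw [hs, ← cfc_mul _ _ K, ← cfc_mul _ _ K, ← cfc_add _ _ _, ← cfc_const_one ℝ K]
    refine cfc_congr fun u _ => ?_
    rw [Real.mul_self_sqrt (by nlinarith [hθ0 u, hθ1 u])]
    ring
  have hsθ : ∀ u, 1 - √(1 - θ u * θ u) ≠ 0 → θ u ≠ 0 := by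
    intro u hu h
    exact hu (by simp [h])
  have htt : t ≤ 1 ∧ -1 ≤ t := by
    have := mul_le_one₀ (ramp_le_one (l / N)) (ramp_nonneg (l / N)) (ramp_le_one (l / N))
    have := mul_self_nonneg (ramp (l / N))
    constructor <;> nlinarith
  have hp : ∀ n, AtTop K n → ‖1 + n‖ ≤ 1 → ‖topGlue K q r n‖ = 1 ∧ χ (topGlue K q r n) = 1 :=
    fun n hn hn' => topGlue_mem_face hχ hχ1 h0 h1 hχK hqc hn hn' hr hr1
  have hpq : ∀ n, AtTop K n → topGlue K q r n * cfc θ K = t • cfc θ K := fun n hn => by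
    rw [topGlue, add_mul, cfc_mul_eq_smul (by fun_prop) hθc hφ, smul_mul_assoc, (hn θ hθc).2,
      hθt, zero_smul, smul_zero, add_zero]
  have hps : ∀ n, AtTop K n → topGlue K q r n * (1 - s) = t • (1 - s) := fun n hn => by
    rw [h1s, topGlue, add_mul, cfc_mul_eq_smul (by fun_prop) (by fun_prop)
      (fun u hu => hφ u (hsθ u hu)), smul_mul_assoc, (hn _ (by fun_prop)).2, hθt]
    simp
  have hsp : ∀ n, AtTop K n → (1 - s) * topGlue K q r n = t • (1 - s) := fun n hn => by
    rw [h1s, topGlue, mul_add, cfc_commute_cfc, cfc_mul_eq_smul (by fun_prop) (by fun_prop)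
      (fun u hu => hφ u (hsθ u hu)), mul_smul_comm, (hn _ (by fun_prop)).1, hθt]
    simp
  have hr' : ∀ n, AtTop K n → ‖1 + n‖ ≤ 1 →
      ‖topGlue K ramp r n‖ = 1 ∧ χ (topGlue K ramp r n) = 1 :=
    fun n hn hn' => topGlue_mem_face hχ hχ1 h0 h1 hχK isCutoff_ramp hn hn' hr hr1
  obtain ⟨a₁, b₁⟩ := hp n₁ hn₁ hn₁'
  obtain ⟨a₂, b₂⟩ := hp n₂ hn₂ hn₂'
  obtain ⟨e₁, f₁⟩ := hr' n₁ hn₁ hn₁'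
  obtain ⟨e₂, f₂⟩ := hr' n₂ hn₂ hn₂'
  have hpp := norm_add_eq_two_of_apply_eq_one hχ a₁.le a₂.le b₁ b₂
  have hrr := norm_add_eq_two_of_apply_eq_one hχ e₁.le e₂.le f₁ f₂
  obtain ⟨c', hc'⟩ := hτ.surjective ((2⁻¹ : ℝ) • (τ (topGlue K q r n₁) + τ (topGlue K q r n₂)))
  refine ⟨c', ?_, ?_⟩
  · have hcn : ‖c‖ = 1 := by
      rw [← hτ.norm_map, hc, norm_smul, hτ.norm_pair e₁ e₂ hrr]; norm_num
    have hcn' : ‖c'‖ = 1 := by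
      rw [← hτ.norm_map, hc', norm_smul, hτ.norm_pair a₁ a₂ hpp]; norm_num
    have bound := fun n => norm_topGlue_sub_le (K := K) (κ := l / N) hr hr1 ha n
    have k3 : 6 * (3 / N) = 18 / N := by ring
    rw [k3] at bound
    rw [← hτ.norm_sub (hcn.trans hcn'.symm), hc, hc', ← smul_sub, norm_smul, add_sub_add_comm,
      Real.norm_of_nonneg (by norm_num)]
    have e := norm_add_le (τ (topGlue K ramp r n₁) - τ (topGlue K q r n₁))
      (τ (topGlue K ramp r n₂) - τ (topGlue K q r n₂))
    rw [hτ.norm_sub (e₁.trans a₁.symm), hτ.norm_sub (e₂.trans a₂.symm)] at e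
    have := bound n₁
    have := bound n₂
    linarith
  · refine midpoint_eq_on_plateau hτ (cfc_isSelfAdjoint _ K) (cfc_isSelfAdjoint θ K)
      (cfc_commute_cfc _ θ K) hss (cfc_nonneg fun u _ => tent_nonneg _ _ _) ?_ ?_ htt.1 htt.2
      a₁ (hpq n₁ hn₁) (hps n₁ hn₁) (hsp n₁ hn₁) a₂ (hpq n₂ hn₂) (hps n₂ hn₂) (hsp n₂ hn₂) hpp hc'
    · rw [← cfc_const_one ℝ K]
      exact (cfc_le_iff _ _ K).2 fun u _ => tent_le_one _ _ _
    · rw [cfc_mul_eq_smul hθc (continuous_tent N l) (t := 1), one_smul]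
      intro u hu
      have := abs_sub_lt_of_tent_ne_zero hu
      exact min_eq_left (le_max_of_le_right (by linarith))

theorem norm_sub_mul_tent_le (hτ : IsSphereIso τ) {χ : A →L[ℝ] ℝ} (hχ : ‖χ‖ ≤ 1)
    (hχ1 : χ 1 = 1) {K : A} (h0 : 0 ≤ K) (h1 : K ≤ 1) (hχK : χ K = 0)
    {n₁ n₂ : A} (hn₁ : AtTop K n₁) (hn₂ : AtTop K n₂) (hn₁' : ‖1 + n₁‖ ≤ 1)
    (hn₂' : ‖1 + n₂‖ ≤ 1) {r : ℝ} (hr : 0 ≤ r) (hr1 : r ≤ 1) {N l : ℝ} (hN : 9 ≤ N)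
    (hl : l + 3 ≤ N) {c : A}
    (hc : τ c = (2⁻¹ : ℝ) • (τ (topGlue K ramp r n₁) + τ (topGlue K ramp r n₂))) :
    ‖(c - cfc (fun u => 1 - (1 - r) * (ramp u * ramp u)) K) * cfc (tent N l) K‖ ≤ 24 / N := by
  have hN0 : 0 < N := by linarith
  obtain ⟨c', hcc', hc'⟩ := exists_midpoint_scalar_on_tent hτ hχ hχ1 h0 h1 hχK hn₁ hn₂ hn₁' hn₂'
    hr hr1 hN hl hc
  have hT1 : ‖cfc (tent N l) K‖ ≤ 1 := norm_cfc_le zero_le_one fun u _ => by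
    rw [Real.norm_of_nonneg (tent_nonneg _ _ _)]; exact tent_le_one _ _ _
  have e : (c - cfc (fun u => 1 - (1 - r) * (ramp u * ramp u)) K) * cfc (tent N l) K
      = (c - c') * cfc (tent N l) K
        + cfc (fun u => (1 - r) * (ramp u * ramp u - ramp (l / N) * ramp (l / N)) * tent N l u)
          K := by
    rw [sub_mul, sub_mul, hc', ← cfc_mul _ _ K, ← cfc_const_mul _ _ K, sub_add_eq_add_sub,
      add_sub_assoc, ← cfc_sub _ _ K, sub_eq_add_neg, ← cfc_neg]
    congr 2
    ext u
    ring
  rw [e]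
  have k1 : ‖(c - c') * cfc (tent N l) K‖ ≤ 18 / N :=
    (norm_mul_le _ _).trans ((mul_le_of_le_one_right (norm_nonneg _) hT1).trans hcc')
  have k2 : ‖cfc (fun u => (1 - r) * (ramp u * ramp u - ramp (l / N) * ramp (l / N)) * tent N l u)
          K‖ ≤ 6 / N := by
    refine norm_cfc_le (by positivity) fun u _ => ?_
    by_cases hu : tent N l u = 0
    · rw [hu, mul_zero, norm_zero]; positivity
    have h3 := abs_sub_lt_of_tent_ne_zero hu
    have h4 : |u - l / N| ≤ 1 / N := by
      rw [show u - l / N = (N * u - l) / N by field_simp, abs_div, abs_of_pos hN0]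
      gcongr
    have h5 := abs_ramp_sq_sub_le u (l / N)
    have h6 : 6 / N = 6 * (1 / N) := by ring
    rw [norm_mul, norm_mul, Real.norm_of_nonneg (tent_nonneg _ _ _), Real.norm_eq_abs,
      Real.norm_eq_abs, abs_of_nonneg (by linarith : 0 ≤ 1 - r)]
    calc (1 - r) * |ramp u * ramp u - ramp (l / N) * ramp (l / N)| * tent N l u
        ≤ 1 * (6 / N) * 1 := by
          gcongr
          · exact tent_nonneg _ _ _
          · linarith
          · linarith
          · exact tent_le_one _ _ _
      _ = 6 / N := by ring
  have k3 : 24 / N = 18 / N + 6 / N := by ring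
  rw [k3]
  exact (norm_add_le _ _).trans (add_le_add k1 k2)

end Localization

section LocalMidpoint

variable {A : Type*} [CStarAlgebra A] [PartialOrder A] [StarOrderedRing A]
variable {Y : Type*} [NormedAddCommGroup Y] [NormedSpace ℝ Y] {τ : A → Y}

/-- The piecewise linear function equal to `0` on `[0, 2/3]` and to `1` on `[5/6, 1]`. -/
noncomputable def highRamp (u : ℝ) : ℝ := min 1 (max 0 (6 * u - 4))

@[fun_prop]
theorem continuous_highRamp : Continuous highRamp := by unfold highRamp; fun_prop

theorem highRamp_nonneg (u : ℝ) : 0 ≤ highRamp u := le_min zero_le_one (le_max_left _ _)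

theorem highRamp_le_one (u : ℝ) : highRamp u ≤ 1 := min_le_left _ _

theorem highRamp_eq_one {u : ℝ} (h : 5 / 6 ≤ u) : highRamp u = 1 :=
  min_eq_left (le_max_of_le_right (by linarith))

theorem ramp_mul_highRamp (u : ℝ) : ramp u * highRamp u = highRamp u := by
  rcases le_total (2 / 3) u with h | h
  · rw [ramp_eq_one h, one_mul]
  · have : highRamp u = 0 := by
      unfold highRamp
      rw [max_eq_left (by linarith), min_eq_right zero_le_one]
    rw [this, mul_zero]

theorem midpoint_topGlue_eq_on_bottom (hτ : IsSphereIso τ) {χ : A →L[ℝ] ℝ} (hχ : ‖χ‖ ≤ 1)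
    (hχ1 : χ 1 = 1) {K : A} (h0 : 0 ≤ K) (h1 : K ≤ 1) (hχK : χ K = 0)
    {n₁ n₂ : A} (hn₁ : AtTop K n₁) (hn₂ : AtTop K n₂) (hn₁' : ‖1 + n₁‖ ≤ 1)
    (hn₂' : ‖1 + n₂‖ ≤ 1) {r : ℝ} (hr : 0 ≤ r) (hr1 : r ≤ 1) {c : A}
    (hc : τ c = (2⁻¹ : ℝ) • (τ (topGlue K ramp r n₁) + τ (topGlue K ramp r n₂))) :
    c * cfc (fun u => 1 - highRamp u) K
      = cfc (fun u => 1 - (1 - r) * (ramp u * ramp u)) K * cfc (fun u => 1 - highRamp u) K := by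
  rw [← sub_eq_zero, ← sub_mul]
  set φ := cfc (fun u => 1 - (1 - r) * (ramp u * ramp u)) K
  set g := cfc (fun u => 1 - highRamp u) K with hg
  have hg1 : ‖g‖ ≤ 1 := norm_cfc_le zero_le_one fun u _ => by
    rw [Real.norm_of_nonneg (by linarith [highRamp_le_one u])]
    linarith [highRamp_nonneg u]
  have key : ∀ N : ℕ, 18 ≤ N → ‖(c - φ) * g‖ ^ 2 ≤ 4608 / N := by
    intro N hN
    have hN' : (18 : ℝ) ≤ N := by exact_mod_cast hN
    have hN0 : (0 : ℝ) < N := by linarith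
    have term : ∀ l ∈ Finset.range (N + 1), ‖(c - φ) * g * cfc (tent N l) K‖ ^ 2
        ≤ (24 / N) ^ 2 := by
      intro l _
      refine pow_le_pow_left₀ (norm_nonneg _) ?_ 2
      rcases le_or_gt ((l : ℝ) + 3) N with hl | hl
      · have e : g * cfc (tent N l) K = cfc (tent N l) K * g := cfc_commute_cfc _ _ K
        rw [mul_assoc, e, ← mul_assoc]
        refine (norm_mul_le _ _).trans ((mul_le_of_le_one_right (norm_nonneg _) hg1).trans ?_)
        exact norm_sub_mul_tent_le hτ hχ hχ1 h0 h1 hχK hn₁ hn₂ hn₁' hn₂' hr hr1 (by linarith) hl hc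
      · have e : g * cfc (tent N l) K = 0 := by
          rw [hg, ← cfc_mul _ _ K, ← cfc_const_zero ℝ K]
          refine cfc_congr fun u _ => ?_
          by_cases hu : tent N l u = 0
          · simp [hu]
          · have h3 := (abs_lt.1 (abs_sub_lt_of_tent_ne_zero hu)).1
            have hl' : (N : ℝ) ≤ l + 2 := by
              have : N < l + 3 := by exact_mod_cast hl
              exact_mod_cast Nat.lt_succ_iff.1 this
            have : 5 / 6 ≤ u := by
              by_contra! h
              have : N * u < N * (5 / 6) := by gcongr
              linarith
            rw [highRamp_eq_one this, sub_self, zero_mul]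
        rw [mul_assoc, e, mul_zero, norm_zero]
        positivity
    refine (norm_sq_le_sum_tent h0 h1 _ N).trans ?_
    have h4 := Finset.sum_le_sum term
    rw [Finset.sum_const, Finset.card_range, nsmul_eq_mul] at h4
    calc _ ≤ 4 * (((N + 1 : ℕ) : ℝ) * (24 / N) ^ 2) := by linarith
      _ ≤ 4 * ((2 * N : ℝ) * (24 / N) ^ 2) := by
        push_cast
        gcongr
        linarith
      _ = 4608 / N := by field_simp; norm_num
  have lim : Filter.Tendsto (fun N : ℕ => (4608 : ℝ) / N) Filter.atTop (nhds 0) :=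
    tendsto_const_div_atTop_nhds_zero_nat _
  have := ge_of_tendsto lim (Filter.eventually_atTop.2 ⟨18, key⟩)
  have : ‖(c - φ) * g‖ = 0 := by
    have := norm_nonneg ((c - φ) * g)
    nlinarith
  exact norm_eq_zero.1 this

theorem map_topGlue_eq_midpoint (hτ : IsSphereIso τ) {χ : A →L[ℝ] ℝ} (hχ : ‖χ‖ ≤ 1)
    (hχ1 : χ 1 = 1) {K : A} (h0 : 0 ≤ K) (h1 : K ≤ 1) (hχK : χ K = 0)
    {n w : A} (hn : AtTop K n) (hw : AtTop K w) (hn₁ : ‖1 + (n + w)‖ ≤ 1)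
    (hn₂ : ‖1 + (n - w)‖ ≤ 1) {r : ℝ} (hr : 0 ≤ r) (hr1 : r ≤ 1)
    (hrw : 2 * (r * ‖w‖) ≤ 1 - r) :
    τ (topGlue K ramp r n) = (2⁻¹ : ℝ) • (τ (topGlue K ramp r (n + w))
      + τ (topGlue K ramp r (n - w))) := by
  obtain ⟨c, hc⟩ := hτ.surjective ((2⁻¹ : ℝ) • (τ (topGlue K ramp r (n + w))
      + τ (topGlue K ramp r (n - w))))
  have hn' : ‖1 + n‖ ≤ 1 := by
    have e : 1 + n = (2⁻¹ : ℝ) • ((1 + (n + w)) + (1 + (n - w))) := by module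
    rw [e, norm_smul, Real.norm_of_nonneg (by norm_num)]
    have := norm_add_le (1 + (n + w)) (1 + (n - w))
    linarith
  have top : c * cfc highRamp K = topGlue K ramp r n * cfc highRamp K := by
    refine midpoint_topGlue_eq_on_top hτ hχ hχ1 h0 h1 hχK isCutoff_ramp continuous_highRamp
      (fun u _ => ramp_mul_highRamp u) hn (hw.real_smul r) hn' hr
      (by rwa [norm_smul, Real.norm_of_nonneg hr]) ?_
    rw [hc]
    congr 3
    · rw [topGlue, topGlue]; module
    · rw [topGlue, topGlue]; module
  have bot := midpoint_topGlue_eq_on_bottom hτ hχ hχ1 h0 h1 hχK (hn.add hw) (hn.sub hw) hn₁ hn₂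
    hr hr1 hc
  have hng : n * cfc (fun u => 1 - highRamp u) K = 0 := by
    rw [(hn _ (by fun_prop)).2, highRamp_eq_one (by norm_num), sub_self, zero_smul]
  have hsum : cfc highRamp K + cfc (fun u => 1 - highRamp u) K = 1 := by
    rw [cfc_sub (fun _ => 1) highRamp K continuousOn_const continuous_highRamp.continuousOn,
      cfc_const_one ℝ K, add_sub_cancel]
  have : c = topGlue K ramp r n := by
    have split : ∀ d : A, d = d * cfc highRamp K + d * cfc (fun u => 1 - highRamp u) K :=
      fun d => by rw [← mul_add, hsum, mul_one]
    refine (split c).trans (Eq.trans ?_ (split _).symm)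
    rw [top, bot, topGlue, add_mul _ _ (cfc (fun u => 1 - highRamp u) K), smul_mul_assoc, hng,
      smul_zero, add_zero]
  rw [← this, hc]

end LocalMidpoint

theorem eq_add_smul_of_second_difference {Y : Type*} [AddCommGroup Y] [Module ℝ Y] {g : ℕ → Y}
    {M : ℕ} (h : ∀ j, j + 2 ≤ M → g (j + 1) = (2⁻¹ : ℝ) • (g (j + 2) + g j)) :
    ∀ j, j + 1 ≤ M → g j = g 0 + (j : ℝ) • (g 1 - g 0) ∧
      g (j + 1) = g 0 + ((j + 1 : ℕ) : ℝ) • (g 1 - g 0)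
  | 0, _ => by constructor <;> simp
  | j + 1, hj => by
    obtain ⟨h1, h2⟩ := eq_add_smul_of_second_difference h j (by omega)
    refine ⟨h2, ?_⟩
    have h3 := h j hj
    have h4 : g (j + 2) = (2 : ℝ) • g (j + 1) - g j := by rw [h3]; module
    rw [h4, h2, h1]
    push_cast
    module

theorem map_lineMap_of_midpoint {Y : Type*} [NormedAddCommGroup Y] [NormedSpace ℝ Y] {g : ℝ → Y}
    (hg : Continuous g)
    (h : ∀ s ∈ Set.Icc (0 : ℝ) 1, ∀ t ∈ Set.Icc (0 : ℝ) 1,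
      g ((2⁻¹ : ℝ) * (s + t)) = (2⁻¹ : ℝ) • (g s + g t)) :
    ∀ t ∈ Set.Icc (0 : ℝ) 1, g t = (1 - t) • g 0 + t • g 1 := by
  set D : ℝ → Y := fun t => g t - ((1 - t) • g 0 + t • g 1) with hD
  have hDc : Continuous fun t => ‖D t‖ := by fun_prop
  have hD0 : D 0 = 0 := by simp [hD]
  have hD1 : D 1 = 0 := by simp [hD]
  have hm : ∀ s ∈ Set.Icc (0 : ℝ) 1, ∀ t ∈ Set.Icc (0 : ℝ) 1,
      D ((2⁻¹ : ℝ) * (s + t)) = (2⁻¹ : ℝ) • (D s + D t) := by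
    intro s hs t ht
    simp only [hD]
    rw [h s hs t ht]
    module
  obtain ⟨t₀, ht₀, hmax⟩ := isCompact_Icc.exists_isMaxOn (Set.nonempty_Icc.2 zero_le_one)
    hDc.continuousOn
  have hz : ‖D t₀‖ ≤ 0 := by
    rcases le_total t₀ 2⁻¹ with h' | h'
    · have hmem : 2 * t₀ ∈ Set.Icc (0 : ℝ) 1 := ⟨by linarith [ht₀.1], by linarith⟩
      have e := hm 0 (by simp) (2 * t₀) hmem
      rw [zero_add, inv_mul_cancel_left₀ two_ne_zero, hD0, zero_add] at e
      have e1 := hmax hmem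
      simp only [Set.mem_ofPred_eq] at e1
      have e2 := congrArg norm e
      rw [norm_smul, Real.norm_of_nonneg (by norm_num)] at e2
      linarith [norm_nonneg (D (2 * t₀))]
    · have hmem : 2 * t₀ - 1 ∈ Set.Icc (0 : ℝ) 1 := ⟨by linarith, by linarith [ht₀.2]⟩
      have e := hm 1 (by simp) (2 * t₀ - 1) hmem
      rw [add_sub_cancel, inv_mul_cancel_left₀ two_ne_zero, hD1, zero_add] at e
      have e1 := hmax hmem
      simp only [Set.mem_ofPred_eq] at e1
      have e2 := congrArg norm e
      rw [norm_smul, Real.norm_of_nonneg (by norm_num)] at e2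
      linarith [norm_nonneg (D (2 * t₀ - 1))]
  intro t ht
  have := (hmax ht).trans hz
  exact sub_eq_zero.1 (norm_le_zero_iff.1 this)

section StateFace

variable {A : Type*} [CStarAlgebra A] [PartialOrder A] [StarOrderedRing A]
variable {Y : Type*} [NormedAddCommGroup Y] [NormedSpace ℝ Y] {τ : A → Y}

theorem map_topGlue_midpoint (hτ : IsSphereIso τ) {χ : A →L[ℝ] ℝ} (hχ : ‖χ‖ ≤ 1)
    (hχ1 : χ 1 = 1) {K : A} (h0 : 0 ≤ K) (h1 : K ≤ 1) (hχK : χ K = 0)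
    {n m : A} (hn : AtTop K n) (hm : AtTop K m) (hn₁ : ‖1 + n‖ ≤ 1)
    (hm₁ : ‖1 + m‖ ≤ 1) {r : ℝ} (hr : 0 ≤ r) (hr1 : r < 1) :
    τ (topGlue K ramp r ((2⁻¹ : ℝ) • (n + m)))
      = (2⁻¹ : ℝ) • (τ (topGlue K ramp r n) + τ (topGlue K ramp r m)) := by
  obtain ⟨k, hk⟩ := exists_nat_gt (‖m - n‖ / (1 - r))
  have hr' : 0 < 1 - r := by linarith
  rw [div_lt_iff₀ hr'] at hk
  have hk0 : (0 : ℝ) < k := by nlinarith [norm_nonneg (m - n)]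
  have hconv : ∀ s ∈ Set.Icc (0 : ℝ) 1, ‖1 + (n + s • (m - n))‖ ≤ 1 := by
    intro s hs
    have e : 1 + (n + s • (m - n)) = (1 - s) • (1 + n) + s • (1 + m) := by module
    rw [e]
    refine (norm_add_le _ _).trans ?_
    rw [norm_smul, norm_smul, Real.norm_of_nonneg hs.1, Real.norm_of_nonneg (by linarith [hs.2])]
    nlinarith [hs.1, hs.2]
  have hat : ∀ s : ℝ, AtTop K (n + s • (m - n)) := fun s => hn.add ((hm.sub hn).real_smul s)
  set g : ℕ → Y := fun j => τ (topGlue K ramp r (n + ((j : ℝ) / (2 * k)) • (m - n))) with hg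
  have step : ∀ j, j + 2 ≤ 2 * k → g (j + 1) = (2⁻¹ : ℝ) • (g (j + 2) + g j) := by
    intro j hj
    have hj' : (j : ℝ) + 2 ≤ 2 * k := by exact_mod_cast hj
    have e1 : n + (((j + 2 : ℕ) : ℝ) / (2 * k)) • (m - n)
        = (n + (((j + 1 : ℕ) : ℝ) / (2 * k)) • (m - n)) + ((2 * k : ℝ)⁻¹) • (m - n) := by
      rw [add_assoc, ← add_smul]
      congr 2
      push_cast
      field_simp
      ring
    have e2 : n + ((j : ℝ) / (2 * k)) • (m - n)
        = (n + (((j + 1 : ℕ) : ℝ) / (2 * k)) • (m - n)) - ((2 * k : ℝ)⁻¹) • (m - n) := by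
      rw [add_sub_assoc, ← sub_smul]
      congr 2
      push_cast
      field_simp
      ring
    simp only [hg]
    rw [e1, e2]
    refine map_topGlue_eq_midpoint hτ hχ hχ1 h0 h1 hχK (hat _) ((hm.sub hn).real_smul _) ?_ ?_ hr
      hr1.le ?_
    · rw [← e1]
      refine hconv _ ⟨by positivity, ?_⟩
      rw [div_le_one (by positivity)]
      push_cast
      exact hj'
    · rw [← e2]
      refine hconv _ ⟨by positivity, ?_⟩
      rw [div_le_one (by positivity)]
      linarith
    · rw [norm_smul, Real.norm_of_nonneg (by positivity), mul_inv]
      have : (k : ℝ)⁻¹ * ‖m - n‖ ≤ 1 - r := by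
        rw [inv_mul_le_iff₀ hk0]; linarith
      nlinarith [mul_nonneg (inv_nonneg.2 hk0.le) (norm_nonneg (m - n))]
  have hk1 : 1 ≤ k := by exact_mod_cast hk0
  have f1 := (eq_add_smul_of_second_difference step k (by omega)).1
  have f2 := (eq_add_smul_of_second_difference step (2 * k - 1) (by omega)).2
  rw [Nat.sub_add_cancel (by omega)] at f2
  have v0 : g 0 = τ (topGlue K ramp r n) := by simp [hg]
  have v1 : g k = τ (topGlue K ramp r ((2⁻¹ : ℝ) • (n + m))) := by
    simp only [hg]
    congr 2
    rw [div_mul_cancel_right₀ hk0.ne']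
    module
  have v2 : g (2 * k) = τ (topGlue K ramp r m) := by
    simp only [hg]
    congr 2
    push_cast
    rw [div_self (by positivity)]
    module
  rw [← v0, ← v1, ← v2, f1, f2]
  push_cast
  module

theorem map_one_add_midpoint (hτ : IsSphereIso τ) {χ : A →L[ℝ] ℝ} (hχ : ‖χ‖ ≤ 1)
    (hχ1 : χ 1 = 1) {K : A} (h0 : 0 ≤ K) (h1 : K ≤ 1) (hχK : χ K = 0)
    {n m : A} (hn : AtTop K n) (hm : AtTop K m) (hn₁ : ‖1 + n‖ ≤ 1)
    (hm₁ : ‖1 + m‖ ≤ 1) :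
    τ (1 + (2⁻¹ : ℝ) • (n + m)) = (2⁻¹ : ℝ) • (τ (1 + n) + τ (1 + m)) := by
  set r : ℕ → ℝ := fun k => 1 - 1 / ((k : ℝ) + 1)
  have hr : Filter.Tendsto r Filter.atTop (nhds 1) := by
    have := (tendsto_const_nhds (x := (1 : ℝ))).sub
      (tendsto_one_div_add_atTop_nhds_zero_nat (𝕜 := ℝ))
    rwa [sub_zero] at this
  have lim : ∀ n : A, Filter.Tendsto (fun k => τ (topGlue K ramp (r k) n)) Filter.atTop
      (nhds (τ (1 + n))) := by
    intro n
    refine (hτ.continuous.tendsto _).comp ?_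
    have e : ∀ r : ℝ, topGlue K ramp r n
        = 1 - (1 - r) • cfc (fun u => ramp u * ramp u) K + r • n := by
      intro r
      rw [topGlue, cfc_sub (fun _ => 1) _ K, cfc_const_one ℝ K, cfc_const_mul _ _ K]
    simp only [e]
    have := (((tendsto_const_nhds (x := (1 : ℝ))).sub hr).smul_const
      (cfc (fun u => ramp u * ramp u) K)).const_sub (1 : A) |>.add (hr.smul_const n)
    simpa using this
  refine tendsto_nhds_unique (lim _) ?_
  have := ((lim n).add (lim m)).const_smul (2⁻¹ : ℝ)
  refine this.congr fun k => (map_topGlue_midpoint hτ hχ hχ1 h0 h1 hχK hn hm hn₁ hm₁ ?_ ?_).symm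
  · have : 1 / ((k : ℝ) + 1) ≤ 1 := by 
      rw [div_le_one (by positivity)]
      linarith [k.cast_nonneg (α := ℝ)]
    simp only [r]; linarith
  · have : 0 < 1 / ((k : ℝ) + 1) := by positivity
    simp only [r]; linarith

end StateFace

section StateFace

variable {A : Type*} [CStarAlgebra A] [PartialOrder A] [StarOrderedRing A]
variable {Y : Type*} [NormedAddCommGroup Y] [NormedSpace ℝ Y] {τ : A → Y}

theorem norm_one_sub_mul_cfc_le {a d : A} (ha : ‖a‖ ≤ 1) (hd : 0 ≤ d)
    (had : 1 - (2⁻¹ : ℝ) • (a + star a) ≤ (2 : ℝ) • d) {e : ℝ → ℝ} (he : Continuous e)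
    (he0 : ∀ u, 0 ≤ e u) (he1 : ∀ u, e u ≤ 1) {η : ℝ} (hη : 0 ≤ η)
    (hee : ∀ u, e u ≠ 0 → u ≤ 4 * η ^ 2) : ‖(1 - a) * cfc e d‖ ≤ 4 * η := by
  have hE : star (cfc e d) = cfc e d := (cfc_isSelfAdjoint e d).star_eq
  have k1 : star (1 - a) * (1 - a) ≤ (4 : ℝ) • d := by
    refine (star_one_sub_mul_le ha).trans ?_
    have := smul_le_smul_of_nonneg_left had (show (0 : ℝ) ≤ 2 by norm_num)
    rwa [smul_smul, show (2 : ℝ) * 2 = 4 by norm_num] at this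
  have k2 := star_left_conjugate_le_conjugate k1 (cfc e d)
  have k3 : star (cfc e d) * ((4 : ℝ) • d) * cfc e d = cfc (fun u => e u * (4 * u) * e u) d := by
    rw [hE, cfc_mul (fun u => e u * (4 * u)) e d, cfc_mul e (fun u => 4 * u) d,
      cfc_const_mul_id (4 : ℝ) d]
  rw [k3] at k2
  have k4 : star (cfc e d) * (star (1 - a) * (1 - a)) * cfc e d
      = star ((1 - a) * cfc e d) * ((1 - a) * cfc e d) := by
    rw [star_mul]; noncomm_ring
  rw [k4] at k2
  have k5 := CStarAlgebra.norm_le_norm_of_nonneg_of_le (star_mul_self_nonneg _) k2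
  have k6 : ‖cfc (fun u => e u * (4 * u) * e u) d‖ ≤ 16 * η ^ 2 := by
    refine norm_cfc_le (by positivity) fun u hu => ?_
    have hu0 := spectrum_nonneg_of_nonneg hd hu
    by_cases hu1 : e u = 0
    · rw [hu1, zero_mul, zero_mul, norm_zero]; positivity
    · have := hee u hu1
      have a1 := he0 u
      have a2 := he1 u
      rw [Real.norm_of_nonneg (by positivity)]
      have : e u * e u ≤ 1 := mul_le_one₀ a2 a1 a2
      nlinarith
  rw [CStarRing.norm_star_mul_self] at k5
  exact abs_le_of_sq_le_sq (by nlinarith) (by positivity) |> fun h => (le_abs_self _).trans h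

theorem exists_atTop_approx {d : A} (hd : 0 ≤ d) {η : ℝ} (hη : 0 < η) :
    ∃ (K : A) (n : A → A), 0 ≤ K ∧ K ≤ 1 ∧ K ≤ (2 / η ^ 2 : ℝ) • d ∧
      ∀ a, ‖a‖ ≤ 1 → 1 - (2⁻¹ : ℝ) • (a + star a) ≤ (2 : ℝ) • d →
        AtTop K (n a) ∧ ‖1 + n a‖ ≤ 1 ∧ ‖1 + n a - a‖ ≤ 8 * η := by
  have hη2 : 0 < η ^ 2 := by positivity
  have hdsa := IsSelfAdjoint.of_nonneg hd
  set k : ℝ → ℝ := fun u => min 1 (max 0 (2 * u / η ^ 2 - 1)) with hk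
  have hkc : Continuous k := by fun_prop
  set s : ℝ → ℝ := fun u => min 1 (max 0 (u / (2 * η ^ 2) - 1)) with hs
  have hsc : Continuous s := by fun_prop
  have hs0 : ∀ u, 0 ≤ s u := fun u => le_min zero_le_one (le_max_left _ _)
  have hs1 : ∀ u, s u ≤ 1 := fun u => min_le_left _ _
  have hsk : ∀ u, s u ≠ 0 → k u = 1 := by
    intro u hu
    have : 2 * η ^ 2 ≤ u := by
      by_contra! h
      refine hu ?_
      have : u / (2 * η ^ 2) < 1 := by rwa [div_lt_one (by positivity)]
      simp only [hs]
      rw [max_eq_left (by linarith), min_eq_right zero_le_one]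
    refine min_eq_left (le_max_of_le_right ?_)
    have : 2 ≤ 2 * u / η ^ 2 := by rw [le_div_iff₀ hη2]; linarith
    linarith
  have hes : ∀ u, 1 - s u ≠ 0 → u ≤ 4 * η ^ 2 := by
    intro u hu
    by_contra! h
    refine hu ?_
    have : 2 ≤ u / (2 * η ^ 2) := by rw [le_div_iff₀ (by positivity)]; linarith
    simp only [hs]
    rw [min_eq_left (le_max_of_le_right (by linarith)), sub_self]
  have hk0 : ∀ u, 0 ≤ k u := fun u => le_min zero_le_one (le_max_left _ _)
  have hk1 : ∀ u, k u ≤ 1 := fun u => min_le_left _ _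
  have hkd : ∀ u, 0 ≤ u → k u ≤ 2 / η ^ 2 * u := by
    intro u hu0
    have e : 2 * u / η ^ 2 = 2 / η ^ 2 * u := by ring
    refine (min_le_right _ _).trans (max_le (by positivity) ?_)
    rw [e]; linarith
  clear_value k s
  set S := cfc s d with hS
  have hSsa : star S = S := (cfc_isSelfAdjoint s d).star_eq
  refine ⟨cfc k d, fun a => -(S * (1 - a) * S), cfc_nonneg fun u _ => hk0 u,
    ?_, ?_, ?_⟩
  · rw [← cfc_const_one ℝ d]
    exact (cfc_le_iff _ _ d).2 fun u _ => hk1 u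
  · rw [← cfc_const_mul_id (2 / η ^ 2) d hdsa]
    exact (cfc_le_iff _ _ d).2 fun u hu => hkd u (spectrum_nonneg_of_nonneg hd hu)
  · intro a ha had
    have hS1 : ‖S‖ ≤ 1 := norm_cfc_le zero_le_one fun u _ => by
      rw [Real.norm_of_nonneg (hs0 u)]; exact hs1 u
    have h1S : 1 - S = cfc (fun u => 1 - s u) d := by
      rw [cfc_sub (fun _ => 1) s d continuousOn_const hsc.continuousOn, cfc_const_one ℝ d]
    refine ⟨fun f hf => ?_, ?_, ?_⟩
    · have e1 : cfc f (cfc k d) * S = f 1 • S := by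
        rw [← cfc_comp' f k d hf.continuousOn hkc.continuousOn hdsa]
        refine cfc_mul_eq_smul (by fun_prop) hsc fun u hu => ?_
        rw [hsk u hu]
      have e2 : S * cfc f (cfc k d) = f 1 • S := by
        rw [← star_star (S * _), star_mul, hSsa, (cfc_isSelfAdjoint f _).star_eq, e1, star_smul,
          hSsa, star_trivial]
      constructor
      · rw [mul_neg, ← mul_assoc, ← mul_assoc, e1, smul_mul_assoc, smul_mul_assoc, smul_neg]
      · rw [neg_mul, mul_assoc _ S, e2, mul_smul_comm, smul_neg]
    · have hpc : Continuous fun u => √(1 - s u * s u) := by fun_prop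
      have hp := norm_glue_le_one (cfc_isSelfAdjoint s d)
        (cfc_isSelfAdjoint (fun u => √(1 - s u * s u)) d) (cfc_commute_cfc s _ d) (by
          rw [← cfc_mul _ _ d, ← cfc_mul _ _ d, ← cfc_add _ _ _, ← cfc_const_one ℝ d]
          refine cfc_congr fun u _ => ?_
          rw [Real.mul_self_sqrt (by nlinarith [hs0 u, hs1 u])]
          ring) ha (norm_one_le_one (A := A))
      have e : cfc (fun u => √(1 - s u * s u)) d * cfc (fun u => √(1 - s u * s u)) d
          = 1 - S * S := by
        rw [hS, ← cfc_mul _ _ d, ← cfc_mul _ _ d, ← cfc_const_one ℝ d, ← cfc_sub _ _ d]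
        refine cfc_congr fun u _ => ?_
        rw [Real.mul_self_sqrt (by nlinarith [hs0 u, hs1 u])]
      rw [mul_one, e] at hp
      refine le_of_eq_of_le (congrArg norm ?_) hp
      noncomm_ring
    · have b1 := norm_one_sub_mul_cfc_le ha hd had (e := fun u => 1 - s u) (by fun_prop)
        (fun u => by linarith [hs1 u]) (fun u => by linarith [hs0 u]) hη.le hes
      have b2 := norm_one_sub_mul_cfc_le (a := star a) (by rwa [norm_star]) hd
        (by rwa [star_star, add_comm]) (e := fun u => 1 - s u) (by fun_prop)
        (fun u => by linarith [hs1 u]) (fun u => by linarith [hs0 u]) hη.le hes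
      rw [← h1S] at b1 b2
      rw [← norm_star, star_mul, star_sub, star_sub, star_star, star_one, hSsa] at b2
      have e : 1 + -(S * (1 - a) * S) - a = (1 - a) * (1 - S) + (1 - S) * (1 - a) * S := by
        noncomm_ring
      rw [e]
      have b3 : ‖(1 - S) * (1 - a) * S‖ ≤ 4 * η :=
        (norm_mul_le _ _).trans ((mul_le_of_le_one_right (norm_nonneg _) hS1).trans b2)
      linarith [norm_add_le ((1 - a) * (1 - S)) ((1 - S) * (1 - a) * S)]

theorem map_midpoint_of_state (hτ : IsSphereIso τ) {χ : A →L[ℝ] ℝ} (hχ : ‖χ‖ ≤ 1)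
    (hχ1 : χ 1 = 1) {a b : A} (ha : ‖a‖ ≤ 1) (hb : ‖b‖ ≤ 1) (hχa : χ a = 1) (hχb : χ b = 1) :
    τ ((2⁻¹ : ℝ) • (a + b)) = (2⁻¹ : ℝ) • (τ a + τ b) := by
  set d : A := (2⁻¹ : ℝ) • ((1 - (2⁻¹ : ℝ) • (a + star a)) + (1 - (2⁻¹ : ℝ) • (b + star b)))
    with hd
  have da := one_sub_re_nonneg ha
  have db := one_sub_re_nonneg hb
  have hd0 : 0 ≤ d := smul_nonneg (by norm_num) (add_nonneg da db)
  have h2d : (2 : ℝ) • d = (1 - (2⁻¹ : ℝ) • (a + star a)) + (1 - (2⁻¹ : ℝ) • (b + star b)) := by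
    rw [hd, smul_inv_smul₀ two_ne_zero]
  have hχd : χ d = 0 := by
    simp only [hd, map_smul, map_add, map_sub, state_star hχ hχ1, hχa, hχb, hχ1, smul_eq_mul]
    norm_num
  set η : ℕ → ℝ := fun k => 1 / ((k : ℝ) + 1)
  have hη0 : ∀ k, 0 < η k := fun k => by positivity
  choose K n hK0 hK1 hKd hn using fun k => exists_atTop_approx hd0 (hη0 k)
  have hna := fun k => hn k a ha (by rw [h2d]; exact le_add_of_nonneg_right db)
  have hnb := fun k => hn k b hb (by rw [h2d]; exact le_add_of_nonneg_left da)
  have hχK : ∀ k, χ (K k) = 0 := fun k => by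
    refine le_antisymm ?_ (state_nonneg hχ hχ1 (hK0 k))
    have := state_mono hχ hχ1 (hKd k)
    rwa [map_smul, hχd, smul_zero] at this
  have hη : Filter.Tendsto (fun k => 8 * η k) Filter.atTop (nhds 0) := by
    have := (tendsto_one_div_add_atTop_nhds_zero_nat (𝕜 := ℝ)).const_mul 8
    rwa [mul_zero] at this
  have la : Filter.Tendsto (fun k => 1 + n k a) Filter.atTop (nhds a) :=
    tendsto_iff_norm_sub_tendsto_zero.2
      (squeeze_zero (fun _ => norm_nonneg _) (fun k => (hna k).2.2) hη)
  have lb : Filter.Tendsto (fun k => 1 + n k b) Filter.atTop (nhds b) :=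
    tendsto_iff_norm_sub_tendsto_zero.2
      (squeeze_zero (fun _ => norm_nonneg _) (fun k => (hnb k).2.2) hη)
  have hc := hτ.continuous
  have l1 := (hc.tendsto _).comp ((la.add lb).const_smul (2⁻¹ : ℝ))
  have l2 := (((hc.tendsto _).comp la).add ((hc.tendsto _).comp lb)).const_smul (2⁻¹ : ℝ)
  refine tendsto_nhds_unique l1 (l2.congr fun k => ?_)
  have := map_one_add_midpoint hτ hχ hχ1 (hK0 k) (hK1 k) (hχK k) (hna k).1 (hnb k).1 (hna k).2.1
    (hnb k).2.1
  simp only [Function.comp_apply]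
  rw [← this]
  congr 1
  module

/-- Additivity on cones over faces of the unit ball containing `1`. -/
theorem map_add_of_norm_add (hτ : IsSphereIso τ) {a b : A} (h : ‖1 + a + b‖ = 1 + ‖a‖ + ‖b‖)
    (h1 : ‖(1 : A)‖ = 1) : τ (a + b) = τ a + τ b := by
  rcases eq_or_ne a 0 with rfl | ha
  · rw [zero_add, hτ.map_zero, zero_add]
  rcases eq_or_ne b 0 with rfl | hb
  · rw [add_zero, hτ.map_zero, add_zero]
  have ha' := norm_pos_iff.2 ha
  have hb' := norm_pos_iff.2 hb
  obtain ⟨χ, hχ, hχs⟩ := exists_support_functional (1 + a + b)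
  have hle := fun x => apply_le_norm_of_norm_le_one hχ (x := x)
  rw [map_add, map_add, h] at hχs
  have k1 := hle 1
  have k2 := hle a
  have k3 := hle b
  rw [h1] at k1
  have e1 : χ 1 = 1 := by linarith
  have e2 : χ a = ‖a‖ := by linarith
  have e3 : χ b = ‖b‖ := by linarith
  have unit : ∀ x : A, x ≠ 0 → ‖‖x‖⁻¹ • x‖ = 1 := fun x hx => by
    rw [norm_smul, norm_inv, norm_norm, inv_mul_cancel₀ (norm_ne_zero_iff.2 hx)]
  obtain ⟨a', ha1⟩ : ∃ a', a' = ‖a‖⁻¹ • a := ⟨_, rfl⟩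
  obtain ⟨b', hb1⟩ : ∃ b', b' = ‖b‖⁻¹ • b := ⟨_, rfl⟩
  have ea : χ a' = 1 := by rw [ha1, map_smul, e2, smul_eq_mul, inv_mul_cancel₀ ha'.ne']
  have eb : χ b' = 1 := by rw [hb1, map_smul, e3, smul_eq_mul, inv_mul_cancel₀ hb'.ne']
  have hconv : ∀ s ∈ Set.Icc (0 : ℝ) 1, ‖(1 - s) • a' + s • b'‖ ≤ 1 ∧
      χ ((1 - s) • a' + s • b') = 1 := by
    intro s hs
    constructor
    · refine (norm_add_le _ _).trans ?_
      rw [norm_smul, norm_smul, Real.norm_of_nonneg hs.1, Real.norm_of_nonneg (by linarith [hs.2]),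
        ha1, hb1, unit a ha, unit b hb]
      linarith
    · rw [map_add, map_smul, map_smul, ea, eb]; simp
  have hτc := hτ.continuous
  have key := map_lineMap_of_midpoint (g := fun s : ℝ => τ ((1 - s) • a' + s • b'))
    (by fun_prop) (by
      intro s hs t ht
      rw [← map_midpoint_of_state hτ hχ e1 (hconv s hs).1 (hconv t ht).1 (hconv s hs).2
        (hconv t ht).2]
      congr 1
      module)
  have hpos : 0 < ‖a‖ + ‖b‖ := by positivity
  have hmem : ‖b‖ / (‖a‖ + ‖b‖) ∈ Set.Icc (0 : ℝ) 1 :=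
    ⟨by positivity, by rw [div_le_one hpos]; linarith⟩
  have k := key _ hmem
  simp only [sub_zero, one_smul, zero_smul, add_zero, sub_self, zero_add] at k
  have k' := congrArg (fun y => (‖a‖ + ‖b‖) • y) k
  have f1 : (‖a‖ + ‖b‖) * (1 - ‖b‖ / (‖a‖ + ‖b‖)) = ‖a‖ := by field_simp; ring
  have f2 : (‖a‖ + ‖b‖) * (‖b‖ / (‖a‖ + ‖b‖)) = ‖b‖ := by field_simp
  rw [← hτ.map_smul _ _ hpos.le, smul_add, smul_add, smul_smul, smul_smul, smul_smul, smul_smul, f1,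
    f2, ← hτ.map_smul _ _ ha'.le, ← hτ.map_smul _ _ hb'.le, ha1, hb1, smul_inv_smul₀ ha'.ne',
    smul_inv_smul₀ hb'.ne'] at k'
  exact k'

end StateFace

section FaceAdditive

variable {Ω : Type*} [TopologicalSpace Ω] [CompactSpace Ω]
variable {Y : Type*} [NormedAddCommGroup Y] [NormedSpace ℝ Y]

/-- A positively homogeneous continuous map on `C(Ω, ℂ)` which is additive on pairs of functions
with additive norms, and odd on unimodular functions. -/
structure IsFaceAdditive (g : C(Ω, ℂ) → Y) : Prop where
  map_add_of_norm : ∀ φ ψ, ‖φ‖ + ‖ψ‖ ≤ ‖φ + ψ‖ → g (φ + ψ) = g φ + g ψ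
  map_smul : ∀ (r : ℝ) (φ), 0 ≤ r → g (r • φ) = r • g φ
  continuous : Continuous g
  map_neg_of_unimodular : ∀ φ : C(Ω, ℂ), (∀ x, ‖φ x‖ = 1) → g (-φ) = -g φ

/-- The complex function with given real and imaginary parts. -/
noncomputable def cplx (p q : C(Ω, ℝ)) : C(Ω, ℂ) :=
  ⟨fun x => p x + q x * Complex.I, by fun_prop⟩

theorem cplx_apply (p q : C(Ω, ℝ)) (x : Ω) : cplx p q x = p x + q x * Complex.I := rfl

theorem cplx_add (p q p' q' : C(Ω, ℝ)) : cplx p q + cplx p' q' = cplx (p + p') (q + q') := by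
  ext x
  simp only [ContinuousMap.add_apply, cplx_apply, Complex.ofReal_add]
  ring

theorem neg_cplx (p q : C(Ω, ℝ)) : -cplx p q = cplx (-p) (-q) := by
  ext x
  simp only [ContinuousMap.neg_apply, cplx_apply, Complex.ofReal_neg]
  ring

theorem smul_cplx (r : ℝ) (p q : C(Ω, ℝ)) : r • cplx p q = cplx (r • p) (r • q) := by
  ext x
  simp only [ContinuousMap.smul_apply, cplx_apply, Complex.real_smul, smul_eq_mul,
    Complex.ofReal_mul]
  ring

theorem norm_cplx_apply_sq (p q : C(Ω, ℝ)) (x : Ω) : ‖cplx p q x‖ ^ 2 = p x ^ 2 + q x ^ 2 := by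
  rw [cplx_apply, Complex.sq_norm, Complex.normSq_add_mul_I]

theorem norm_cplx_le {p q : C(Ω, ℝ)} {r : ℝ} (hr : 0 ≤ r) (h : ∀ x, p x ^ 2 + q x ^ 2 ≤ r ^ 2) :
    ‖cplx p q‖ ≤ r := by
  refine (ContinuousMap.norm_le _ hr).2 fun x => ?_
  have := h x
  rw [← norm_cplx_apply_sq] at this
  exact (sq_le_sq₀ (norm_nonneg _) hr).1 this

theorem le_norm_cplx {p q : C(Ω, ℝ)} {r : ℝ} (x : Ω) (h : r ^ 2 ≤ p x ^ 2 + q x ^ 2) :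
    r ≤ ‖cplx p q‖ := by
  rw [← norm_cplx_apply_sq] at h
  exact ((le_abs_self r).trans (abs_le_of_sq_le_sq h (norm_nonneg _))).trans
    (ContinuousMap.norm_coe_le_norm _ x)

/-- `√(1 - m²)` -/
noncomputable def cosqrt (m : C(Ω, ℝ)) : C(Ω, ℝ) := ⟨fun x => √(1 - m x ^ 2), by fun_prop⟩

theorem cosqrt_apply (m : C(Ω, ℝ)) (x : Ω) : cosqrt m x = √(1 - m x ^ 2) := rfl

theorem cosqrt_nonneg (m : C(Ω, ℝ)) (x : Ω) : 0 ≤ cosqrt m x := Real.sqrt_nonneg _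

theorem cosqrt_sq {m : C(Ω, ℝ)} {x : Ω} (h : |m x| ≤ 1) : cosqrt m x ^ 2 = 1 - m x ^ 2 := by
  rw [cosqrt_apply, Real.sq_sqrt]
  rw [sub_nonneg, sq_le_one_iff_abs_le_one]
  exact h

theorem cosqrt_of_eq_zero {m : C(Ω, ℝ)} {x : Ω} (h : m x = 0) : cosqrt m x = 1 := by
  simp [cosqrt_apply, h]

namespace IsFaceAdditive

variable {g : C(Ω, ℂ) → Y}

theorem map_cplx_add (hg : IsFaceAdditive g) {p q p' q' : C(Ω, ℝ)} {r s : ℝ} (hr : 0 ≤ r)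
    (hs : 0 ≤ s) (h : ∀ x, p x ^ 2 + q x ^ 2 ≤ r ^ 2) (h' : ∀ x, p' x ^ 2 + q' x ^ 2 ≤ s ^ 2) (x : Ω)
    (hx : (r + s) ^ 2 ≤ (p x + p' x) ^ 2 + (q x + q' x) ^ 2) :
    g (cplx (p + p') (q + q')) = g (cplx p q) + g (cplx p' q') := by
  rw [← cplx_add]
  refine hg.map_add_of_norm _ _ ?_
  rw [cplx_add]
  exact (add_le_add (norm_cplx_le hr h) (norm_cplx_le hs h')).trans (le_norm_cplx x hx)

theorem map_smul_cplx (hg : IsFaceAdditive g) {r : ℝ} (hr : 0 ≤ r) (p q : C(Ω, ℝ)) :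
    g (cplx (r • p) (r • q)) = r • g (cplx p q) := by
  rw [← smul_cplx, hg.map_smul r _ hr]

theorem map_zero (hg : IsFaceAdditive g) : g 0 = 0 := by
  have := hg.map_smul 0 0 le_rfl
  rwa [zero_smul, zero_smul] at this

theorem mul_left (hg : IsFaceAdditive g) {u : C(Ω, ℂ)} (hu : ∀ x, ‖u x‖ = 1) :
    IsFaceAdditive fun φ => g (u * φ) := by
  have hn : ∀ φ : C(Ω, ℂ), ‖u * φ‖ = ‖φ‖ := fun φ => by
    refine le_antisymm ((ContinuousMap.norm_le _ (norm_nonneg _)).2 fun x => ?_)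
      ((ContinuousMap.norm_le _ (norm_nonneg _)).2 fun x => ?_)
    · rw [ContinuousMap.mul_apply, norm_mul, hu, one_mul]
      exact ContinuousMap.norm_coe_le_norm _ x
    · have := ContinuousMap.norm_coe_le_norm (u * φ) x
      rwa [ContinuousMap.mul_apply, norm_mul, hu, one_mul] at this
  refine ⟨fun φ ψ h => ?_, fun r φ hr => ?_, hg.continuous.comp (by fun_prop), fun φ h => ?_⟩
  · rw [mul_add, hg.map_add_of_norm]
    rw [← mul_add, hn, hn, hn]
    exact h
  · rw [mul_smul_comm, hg.map_smul _ _ hr]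
  · rw [mul_neg, hg.map_neg_of_unimodular]
    intro x
    rw [ContinuousMap.mul_apply, norm_mul, hu, h, one_mul]

theorem neg_map_neg (hg : IsFaceAdditive g) : IsFaceAdditive fun φ => -g (-φ) := by
  refine ⟨fun φ ψ h => ?_, fun r φ hr => ?_, (hg.continuous.comp continuous_neg).neg, fun φ h => ?_⟩
  · rw [neg_add, hg.map_add_of_norm, neg_add]
    rwa [norm_neg, norm_neg, ← neg_add, norm_neg]
  · rw [← smul_neg, hg.map_smul _ _ hr, smul_neg]
  · rw [hg.map_neg_of_unimodular φ h, hg.map_neg_of_unimodular (-φ), hg.map_neg_of_unimodular φ h]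
    intro x
    rw [ContinuousMap.neg_apply, norm_neg, h]

theorem norm_cplx_cosqrt {m n : C(Ω, ℝ)} (hm : ∀ x, |m x| ≤ 1) (hn : ∀ x, n x ^ 2 = m x ^ 2)
    (x : Ω) : cosqrt m x ^ 2 + n x ^ 2 = 1 := by
  rw [cosqrt_sq (hm x), hn]; ring

theorem map_neg_cplx_cosqrt (hg : IsFaceAdditive g) {m n : C(Ω, ℝ)} (hm : ∀ x, |m x| ≤ 1)
    (hn : ∀ x, n x ^ 2 = m x ^ 2) :
    g (cplx (-cosqrt m) (-n)) = -g (cplx (cosqrt m) n) := by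
  rw [← neg_cplx, hg.map_neg_of_unimodular]
  intro x
  have := norm_cplx_apply_sq (cosqrt m) n x
  rw [norm_cplx_cosqrt hm hn] at this
  exact (pow_eq_one_iff_of_nonneg (norm_nonneg _) two_ne_zero).1 this

/-- Oddness on imaginary functions. -/
theorem two_smul_map_imag (hg : IsFaceAdditive g) {m : C(Ω, ℝ)} (hm : ∀ x, |m x| ≤ 1) {x : Ω}
    (hx : m x ^ 2 = 1) :
    (2 : ℝ) • g (cplx 0 m) = g (cplx (cosqrt m) m) - g (cplx (cosqrt m) (-m)) := by
  have h := hg.map_cplx_add (p := cosqrt m) (q := m) (p' := -cosqrt m) (q' := m) zero_le_one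
    zero_le_one (fun y => by rw [norm_cplx_cosqrt hm (fun _ => rfl)]; norm_num)
    (fun y => by
      rw [ContinuousMap.neg_apply, neg_sq, norm_cplx_cosqrt hm (fun _ => rfl)]; norm_num) x
    (by rw [ContinuousMap.neg_apply]; nlinarith)
  have h2 := hg.map_neg_cplx_cosqrt (n := -m) hm (fun y => by rw [ContinuousMap.neg_apply, neg_sq])
  rw [neg_neg] at h2
  rw [h2, add_neg_cancel, ← two_smul ℝ m, ← smul_zero (2 : ℝ),
    hg.map_smul_cplx (by norm_num)] at h
  rw [h, sub_eq_add_neg]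

theorem two_smul_map_real (hg : IsFaceAdditive g) {c s : C(Ω, ℝ)}
    (hcs : ∀ x, c x ^ 2 + s x ^ 2 = 1) {x : Ω} (hx : c x = 1) :
    (2 : ℝ) • g (cplx c 0) = g (cplx c s) + g (cplx c (-s)) := by
  have h := hg.map_cplx_add (p := c) (q := s) (p' := c) (q' := -s) zero_le_one
    zero_le_one (fun y => by rw [hcs]; norm_num)
    (fun y => by rw [ContinuousMap.neg_apply, neg_sq, hcs]; norm_num) x
    (by rw [ContinuousMap.neg_apply, hx]; nlinarith)
  have h2 := hg.map_smul_cplx zero_le_two c 0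
  rw [add_neg_cancel, ← two_smul ℝ c] at h
  rw [← h2, smul_zero, h]

theorem exists_normalized (k : C(Ω, ℝ)) (hk : k ≠ 0) :
    ∃ m : C(Ω, ℝ), k = ‖k‖ • m ∧ 0 < ‖k‖ ∧ (∀ x, |m x| ≤ 1) ∧ ∃ x, m x ^ 2 = 1 := by
  have hk' := norm_pos_iff.2 hk
  have hΩ : Nonempty Ω := by
    by_contra h
    rw [not_nonempty_iff] at h
    exact hk (ContinuousMap.ext fun x => h.elim x)
  refine ⟨‖k‖⁻¹ • k, (smul_inv_smul₀ hk'.ne' k).symm, hk', fun x => ?_, ?_⟩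
  · rw [ContinuousMap.smul_apply, smul_eq_mul, abs_mul, abs_inv, abs_norm]
    rw [inv_mul_le_one₀ hk']
    exact ContinuousMap.norm_coe_le_norm k x
  · obtain ⟨x, -, hx⟩ := (isCompact_univ (X := Ω)).exists_isMaxOn Set.univ_nonempty
      (f := fun x => ‖k x‖) (by fun_prop)
    refine ⟨x, ?_⟩
    have : ‖k x‖ = ‖k‖ := le_antisymm (ContinuousMap.norm_coe_le_norm k x)
      ((ContinuousMap.norm_le _ (norm_nonneg _)).2 fun y => hx (Set.mem_univ y))
    rw [ContinuousMap.smul_apply, smul_eq_mul, mul_pow, ← sq_abs (k x), ← Real.norm_eq_abs, this,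
      inv_pow, inv_mul_cancel₀ (by positivity)]

theorem map_neg_imag (hg : IsFaceAdditive g) (k : C(Ω, ℝ)) :
    g (cplx 0 (-k)) = -g (cplx 0 k) := by
  rcases eq_or_ne k 0 with rfl | hk
  · have : cplx (0 : C(Ω, ℝ)) 0 = 0 := by ext; simp [cplx_apply]
    rw [neg_zero, this, hg.map_zero, neg_zero]
  obtain ⟨m, hkm, hpos, hm, x, hx⟩ := exists_normalized k hk
  have h1 := hg.two_smul_map_imag hm hx
  have h2 := hg.two_smul_map_imag (m := -m) (fun y => by
    rw [ContinuousMap.neg_apply, abs_neg]; exact hm y) (x := x) (by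
    rw [ContinuousMap.neg_apply, neg_sq, hx])
  have h3 : cosqrt (-m) = cosqrt m := by ext y; simp [cosqrt_apply]
  rw [neg_neg, h3, ← neg_sub, ← h1, ← smul_neg] at h2
  have h4 := smul_right_injective Y (two_ne_zero (α := ℝ)) h2
  rw [hkm, ← smul_neg, ← smul_zero ‖k‖, hg.map_smul_cplx hpos.le, hg.map_smul_cplx hpos.le, h4,
    smul_neg]

theorem neg_I_mul_left (hg : IsFaceAdditive g) :
    IsFaceAdditive fun φ => g (ContinuousMap.const Ω (-Complex.I) * φ) :=
  hg.mul_left fun x => by simp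

theorem neg_I_mul_cplx (p q : C(Ω, ℝ)) :
    ContinuousMap.const Ω (-Complex.I) * cplx p q = cplx q (-p) := by
  ext x
  simp only [ContinuousMap.mul_apply, ContinuousMap.const_apply, cplx_apply,
    ContinuousMap.neg_apply, Complex.ofReal_neg]
  linear_combination -(q x : ℂ) * Complex.I_sq

theorem map_neg_real (hg : IsFaceAdditive g) (k : C(Ω, ℝ)) :
    g (cplx (-k) 0) = -g (cplx k 0) := by
  have := hg.neg_I_mul_left.map_neg_imag k
  simpa only [neg_I_mul_cplx, neg_zero] using this

/-- A unimodular function attaining `1` splits into its real and imaginary parts. -/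
theorem map_cplx_of_unimodular (hg : IsFaceAdditive g) {c k : C(Ω, ℝ)}
    (hck : ∀ x, c x ^ 2 + k x ^ 2 = 1) {x : Ω} (hcx : c x = 1) :
    g (cplx c k) = g (cplx c 0) + g (cplx 0 k) := by
  have hx : k x = 0 := by
    have := hck x
    rw [hcx] at this
    exact pow_eq_zero_iff two_ne_zero |>.1 (by linarith)
  have e0 : cplx (0 : C(Ω, ℝ)) 0 = 0 := by ext; simp [cplx_apply]
  rcases eq_or_ne k 0 with h0 | h0
  · rw [h0, e0, hg.map_zero, add_zero]
  obtain ⟨m, hkm, hpos, hm, y, hy⟩ := exists_normalized k h0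
  set r := ‖k‖ with hr
  have hmx : m x = 0 := by
    have := hx
    rw [hkm, ContinuousMap.smul_apply, smul_eq_mul] at this
    exact (mul_eq_zero.1 this).resolve_left hpos.ne'
  have sq : ∀ y, (r • cosqrt m) y ^ 2 + (r • m) y ^ 2 = r ^ 2 := fun y => by
    rw [ContinuousMap.smul_apply, ContinuousMap.smul_apply, smul_eq_mul, smul_eq_mul, mul_pow,
      mul_pow, cosqrt_sq (hm y)]
    ring
  have sq' : ∀ y, (r • cosqrt m) y ^ 2 + (r • -m) y ^ 2 = r ^ 2 := fun y => by
    rw [smul_neg, ContinuousMap.neg_apply, neg_sq, sq]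
  have h1 := hg.map_cplx_add (p := c) (q := k) (p' := r • cosqrt m) (q' := r • -m)
    zero_le_one hpos.le (fun y => by rw [hck]; norm_num)
    (fun y => (sq' y).le) x (by
      simp [cosqrt_of_eq_zero hmx, hcx, hmx, hx])
  have h2 := hg.map_cplx_add (p := c) (q := -k) (p' := r • cosqrt m) (q' := r • m)
    zero_le_one hpos.le (fun y => by rw [ContinuousMap.neg_apply, neg_sq, hck]; norm_num)
    (fun y => (sq y).le) x (by
      simp [cosqrt_of_eq_zero hmx, hcx, hmx, hx])
  rw [smul_neg, ← hkm, add_neg_cancel] at h1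
  rw [← hkm, neg_add_cancel] at h2
  rw [h1] at h2
  have h7 : g (cplx (r • cosqrt m) (-k)) = r • g (cplx (cosqrt m) (-m)) := by
    rw [← hg.map_smul_cplx hpos.le, smul_neg, ← hkm]
  have h3 : g (cplx (r • cosqrt m) k) = r • g (cplx (cosqrt m) m) := by
    rw [← hg.map_smul_cplx hpos.le, ← hkm]
  have h4 := hg.two_smul_map_imag hm hy
  have h5 := hg.two_smul_map_real hck hcx
  have h6 : g (cplx 0 k) = r • g (cplx 0 m) := by
    rw [← hg.map_smul_cplx hpos.le, ← hkm, smul_zero]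
  rw [h3, h7] at h2
  apply smul_right_injective Y (two_ne_zero (α := ℝ))
  simp only
  rw [smul_add, h5, h6, smul_comm, h4, smul_sub, two_smul ℝ (g (cplx (c) k)), add_assoc,
    ← add_sub_assoc, ← h2, add_sub_cancel_right]

theorem map_cplx_cosqrt (hg : IsFaceAdditive g) {k : C(Ω, ℝ)} (hk : ∀ x, |k x| ≤ 1) {x : Ω}
    (hx : k x = 0) : g (cplx (cosqrt k) k) = g (cplx (cosqrt k) 0) + g (cplx 0 k) :=
  hg.map_cplx_of_unimodular (norm_cplx_cosqrt hk fun _ => rfl) (cosqrt_of_eq_zero hx)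

end IsFaceAdditive

end FaceAdditive

section FaceAdditive

variable {Ω : Type*} [TopologicalSpace Ω] [CompactSpace Ω]
variable {Y : Type*} [NormedAddCommGroup Y] [NormedSpace ℝ Y]

theorem cplx_zero_zero : cplx (0 : C(Ω, ℝ)) 0 = 0 := by ext; simp [cplx_apply]

theorem continuous_cplx : Continuous fun z : C(Ω, ℝ) × C(Ω, ℝ) => cplx z.1 z.2 := by
  have h : ∀ z : C(Ω, ℝ) × C(Ω, ℝ), ‖cplx z.1 z.2‖ ≤ 2 * ‖z‖ := fun z => by
    refine norm_cplx_le (by positivity) fun x => ?_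
    have h1 := (ContinuousMap.norm_coe_le_norm z.1 x).trans (norm_fst_le z)
    have h2 := (ContinuousMap.norm_coe_le_norm z.2 x).trans (norm_snd_le z)
    rw [Real.norm_eq_abs] at h1 h2
    have h3 := sq_le_sq' (by linarith [abs_nonneg (z.1 x), norm_nonneg z]) h1
    have h4 := sq_le_sq' (by linarith [abs_nonneg (z.2 x), norm_nonneg z]) h2
    rw [sq_abs] at h3 h4
    nlinarith [norm_nonneg z]
  refine (LipschitzWith.of_dist_le_mul (K := 2) fun z w => ?_).continuous
  rw [dist_eq_norm, dist_eq_norm]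
  have : cplx z.1 z.2 - cplx w.1 w.2 = cplx (z - w).1 (z - w).2 := by
    rw [sub_eq_add_neg, neg_cplx, cplx_add, ← sub_eq_add_neg, ← sub_eq_add_neg]
    rfl
  rw [this]
  exact h (z - w)

/-- Soft thresholding. -/
theorem exists_threshold (k : C(Ω, ℝ)) {x : Ω} (hx : k x = 0) {ε : ℝ} (hε : 0 < ε) :
    ∃ m p : C(Ω, ℝ), dist k m ≤ ε ∧ p x = 1 ∧ m x = 0 ∧ (∀ y, 0 ≤ p y) ∧ (∀ y, p y ≤ 1) ∧
      (∀ y, p y * m y = 0) ∧ ∀ y, 0 ≤ k y → 0 ≤ m y ∧ m y ≤ k y := by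
  have ht : ∀ u, trunc ε u = max (-ε) (min ε u) := fun u => rfl
  have htc := continuous_trunc ε
  refine ⟨⟨fun y => k y - trunc ε (k y), by fun_prop⟩, ⟨fun y => max 0 (1 - |k y| / ε), by fun_prop⟩,
    ?_, ?_, ?_, fun y => le_max_left _ _, fun y => ?_, fun y => ?_, fun y hy => ?_⟩
  · refine (ContinuousMap.dist_le hε.le).2 fun y => ?_
    change dist (k y) (k y - trunc ε (k y)) ≤ ε
    rw [Real.dist_eq, sub_sub_cancel]
    exact abs_trunc_le hε.le _
  · simp [hx]
  · simp [hx, ht, hε.le]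
  · exact max_le zero_le_one (by have : 0 ≤ |k y| / ε := by positivity
                                 linarith)
  · simp only [ContinuousMap.coe_mk]
    rcases le_total |k y| ε with h | h
    · rw [trunc_eq_self h, sub_self, mul_zero]
    · rw [max_eq_left, zero_mul]
      rw [sub_nonpos, one_le_div hε]
      exact h
  · simp only [ContinuousMap.coe_mk, ht]
    rw [max_eq_right ((neg_nonpos.2 hε.le).trans (le_min hε.le hy))]
    constructor
    · linarith [min_le_right ε (k y)]
    · linarith [le_min hε.le hy]

namespace IsFaceAdditive

variable {g : C(Ω, ℂ) → Y}

theorem map_add_of_norm₃ (hg : IsFaceAdditive g) (a b c : C(Ω, ℂ))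
    (h : ‖a‖ + ‖b‖ + ‖c‖ ≤ ‖a + b + c‖) : g (a + b + c) = g a + g b + g c := by
  have h1 := norm_add_le (a + b) c
  have h2 := norm_add_le a b
  rw [hg.map_add_of_norm, hg.map_add_of_norm] <;> linarith

theorem map_one_eq_of_threshold (hg : IsFaceAdditive g) {n p : C(Ω, ℝ)} (hn : ∀ y, 0 ≤ n y)
    (hn2 : ∀ y, n y ≤ 2) (hp : ∀ y, 0 ≤ p y) (hp1 : ∀ y, p y ≤ 1) (hpn : ∀ y, p y * n y = 0) {x : Ω}
    (hpx : p x = 1) (hnx : n x = 0) : g (cplx 1 0) = g (cplx (1 - n) 0) + g (cplx n 0) := by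
  rcases eq_or_ne n 0 with rfl | h0
  · rw [cplx_zero_zero, hg.map_zero, sub_zero, add_zero]
  obtain ⟨m, hnm, hpos, hm, y, hy⟩ := exists_normalized n h0
  obtain ⟨r, hr⟩ : ∃ r, r = ‖n‖ := ⟨_, rfl⟩
  rw [← hr] at hnm hpos
  have hnm' : ∀ z, n z = r * m z := fun z => by
    conv_lhs => rw [hnm]
    rfl
  have hm0 : ∀ z, 0 ≤ m z := fun z => by
    have := hn z
    rw [hnm'] at this
    exact nonneg_of_mul_nonneg_right this hpos
  have hm1 : ∀ z, m z ≤ 1 := fun z => (le_abs_self _).trans (hm z)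
  have hpm : ∀ z, p z * m z = 0 := fun z => by
    have := hpn z
    rw [hnm', mul_left_comm] at this
    exact (mul_eq_zero.1 this).resolve_left hpos.ne'
  have hmx : m x = 0 := by
    have := hpm x
    rwa [hpx, one_mul] at this
  have A := hg.map_cplx_add (p := m + p) (q := 0) (p' := m - p) (q' := 0) zero_le_one zero_le_one
    (fun z => by
      simp only [ContinuousMap.add_apply, ContinuousMap.zero_apply]
      nlinarith [hpm z, hp z, hp1 z, hm0 z, hm1 z, mul_self_nonneg (m z + p z - 1)])
    (fun z => by
      simp only [ContinuousMap.sub_apply, ContinuousMap.zero_apply]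
      nlinarith [hpm z, hp z, hp1 z, hm0 z, hm1 z]) y
    (by simp only [ContinuousMap.add_apply, ContinuousMap.sub_apply, ContinuousMap.zero_apply]
        nlinarith)
  have B1 := hg.map_cplx_add (p := (2 : ℝ) • 1) (q := 0) (p' := r • (p - m)) (q' := 0) zero_le_two
    hpos.le (fun z => by simp) (fun z => by
      simp only [ContinuousMap.smul_apply, ContinuousMap.sub_apply, ContinuousMap.zero_apply,
        smul_eq_mul]
      have : (p z - m z) ^ 2 ≤ 1 := by nlinarith [hpm z, hp z, hp1 z, hm0 z, hm1 z]
      nlinarith [sq_nonneg r]) x (by simp [hpx, hmx])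
  have B2 := hg.map_cplx_add (p := (2 : ℝ) • (1 - n)) (q := 0) (p' := r • (p + m)) (q' := 0)
    zero_le_two hpos.le (fun z => by
      simp only [ContinuousMap.smul_apply, ContinuousMap.sub_apply, ContinuousMap.zero_apply,
        smul_eq_mul, ContinuousMap.one_apply]
      nlinarith [hn z, hn2 z]) (fun z => by
      simp only [ContinuousMap.smul_apply, ContinuousMap.add_apply, ContinuousMap.zero_apply,
        smul_eq_mul]
      have : (p z + m z) ^ 2 ≤ 1 := by nlinarith [hpm z, hp z, hp1 z, hm0 z, hm1 z]
      nlinarith [sq_nonneg r]) x (by simp [hpx, hmx, hnx])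
  have e1 : (2 : ℝ) • (1 : C(Ω, ℝ)) + r • (p - m) = (2 : ℝ) • (1 - n) + r • (p + m) := by
    rw [hnm]; module
  have hsm : ∀ (t : ℝ) (k : C(Ω, ℝ)), 0 ≤ t → g (cplx (t • k) 0) = t • g (cplx k 0) :=
    fun t k ht => by
      have := hg.map_smul_cplx ht k 0
      rwa [smul_zero] at this
  rw [e1, B2, hsm _ _ zero_le_two, hsm _ _ zero_le_two, hsm _ _ hpos.le,
    hsm _ _ hpos.le] at B1
  rw [add_zero, add_add_sub_cancel, ← two_smul ℝ m, hsm _ _ zero_le_two, ← neg_sub p m,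
    hg.map_neg_real] at A
  have e2 : g (cplx n 0) = r • g (cplx m 0) := by rw [← hsm _ _ hpos.le, ← hnm]
  apply smul_right_injective Y (two_ne_zero (α := ℝ))
  simp only
  rw [smul_add, e2, smul_comm, A, smul_add, smul_neg]
  rw [← add_assoc, add_comm m p, B1, add_neg_cancel_right]

theorem map_one_eq (hg : IsFaceAdditive g) {n : C(Ω, ℝ)} (hn : ∀ y, 0 ≤ n y)
    (hn2 : ∀ y, n y ≤ 2) {x : Ω} (hnx : n x = 0) :
    g (cplx 1 0) = g (cplx (1 - n) 0) + g (cplx n 0) := by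
  have hc : IsClosed {k : C(Ω, ℝ) | g (cplx 1 0) = g (cplx (1 - k) 0) + g (cplx k 0)} := by
    have := hg.continuous
    have := continuous_cplx (Ω := Ω)
    have h1 : Continuous fun k : C(Ω, ℝ) => cplx (1 - k) 0 :=
      this.comp (f := fun k => (1 - k, 0)) (by fun_prop)
    have h2 : Continuous fun k : C(Ω, ℝ) => cplx k 0 :=
      this.comp (f := fun k => (k, 0)) (by fun_prop)
    exact isClosed_eq continuous_const (by fun_prop)
  refine hc.closure_subset (Metric.mem_closure_iff.2 fun ε hε => ?_)
  obtain ⟨m, p, hd, hpx, hmx, hp, hp1, hpm, hm⟩ := exists_threshold n hnx (half_pos hε)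
  exact ⟨m, hg.map_one_eq_of_threshold (fun y => (hm y (hn y)).1)
    (fun y => (hm y (hn y)).2.trans (hn2 y)) hp hp1 hpm hpx hmx, by linarith⟩

theorem map_smul_cosqrt (hg : IsFaceAdditive g) {m : C(Ω, ℝ)} (hm : ∀ x, |m x| ≤ 1) {x : Ω}
    (hx : m x = 0) (b : ℝ) :
    g (cplx (|b| • cosqrt m) (b • m)) = |b| • g (cplx (cosqrt m) 0) + b • g (cplx 0 m) := by
  rcases le_total 0 b with hb | hb
  · rw [abs_of_nonneg hb, hg.map_smul_cplx hb, hg.map_cplx_cosqrt hm hx, smul_add]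
  · have h := hg.map_cplx_of_unimodular (c := cosqrt m) (k := -m) (norm_cplx_cosqrt hm fun y => by
      rw [ContinuousMap.neg_apply, neg_sq]) (cosqrt_of_eq_zero hx)
    rw [abs_of_nonpos hb, show b • m = (-b) • (-m) by rw [neg_smul_neg],
      hg.map_smul_cplx (neg_nonneg.2 hb), h, hg.map_neg_imag, smul_add, smul_neg, neg_smul b, neg_smul,
      neg_neg]

/-- Additivity on the real functions. -/
def IsRealAdditive (g : C(Ω, ℂ) → Y) : Prop :=
  ∀ p q : C(Ω, ℝ), g (cplx (p + q) 0) = g (cplx p 0) + g (cplx q 0)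

theorem map_smul_real (hg : IsFaceAdditive g) (t : ℝ) (k : C(Ω, ℝ)) :
    g (cplx (t • k) 0) = t • g (cplx k 0) := by
  have h : ∀ (t : ℝ) (k : C(Ω, ℝ)), 0 ≤ t → g (cplx (t • k) 0) = t • g (cplx k 0) :=
    fun t k ht => by
      have := hg.map_smul_cplx ht k 0
      rwa [smul_zero] at this
  rcases le_total 0 t with ht | ht
  · exact h t k ht
  · rw [← neg_smul_neg, h _ _ (neg_nonneg.2 ht), hg.map_neg_real, neg_smul_neg]

theorem map_smul_imag (hg : IsFaceAdditive g) (t : ℝ) (k : C(Ω, ℝ)) :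
    g (cplx 0 (t • k)) = t • g (cplx 0 k) := by
  have h : ∀ (t : ℝ) (k : C(Ω, ℝ)), 0 ≤ t → g (cplx 0 (t • k)) = t • g (cplx 0 k) :=
    fun t k ht => by
      have := hg.map_smul_cplx ht 0 k
      rwa [smul_zero] at this
  rcases le_total 0 t with ht | ht
  · exact h t k ht
  · rw [← neg_smul_neg, h _ _ (neg_nonneg.2 ht), hg.map_neg_imag, neg_smul_neg]

theorem map_add_smul_of_threshold (hg : IsFaceAdditive g) (hadd : IsRealAdditive g)
    {m p : C(Ω, ℝ)} (hm : ∀ y, |m y| ≤ 1) (hp : ∀ y, 0 ≤ p y) (hp1 : ∀ y, p y ≤ 1)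
    (hpm : ∀ y, p y * m y = 0) {x : Ω} (hpx : p x = 1) {α β : ℝ} (hαβ : α ^ 2 + β ^ 2 = 1) :
    g (cplx (p + α • m) (β • m)) = g (cplx p 0) + α • g (cplx m 0) + β • g (cplx 0 m) := by
  have hmx : m x = 0 := by
    have := hpm x
    rwa [hpx, one_mul] at this
  have hm2 : ∀ y, m y ^ 2 ≤ 1 := fun y => by rw [sq_le_one_iff_abs_le_one]; exact hm y
  have hpm2 : ∀ y, p y ^ 2 + m y ^ 2 ≤ 1 := fun y => by
    rcases mul_eq_zero.1 (hpm y) with h | h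
    · rw [h]; nlinarith [hm2 y]
    · rw [h]; nlinarith [hp y, hp1 y]
  have hα : ∀ y, (|α| * p y) ^ 2 + (α * m y) ^ 2 ≤ |α| ^ 2 := fun y => by
    rw [mul_pow, mul_pow, sq_abs]; nlinarith [hpm2 y, sq_nonneg α]
  have hβ : ∀ y, (|β| * cosqrt m y) ^ 2 + (β * m y) ^ 2 = |β| ^ 2 := fun y => by
    rw [mul_pow, mul_pow, sq_abs, cosqrt_sq (hm y)]; ring
  have h0 : ∀ y, |α| * p y * (α * m y) = 0 := fun y => by
    rw [mul_mul_mul_comm, hpm, mul_zero]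
  have b1 : ‖cplx ((2 : ℝ) • (p + α • m)) ((2 : ℝ) • β • m)‖ ≤ 2 :=
    norm_cplx_le zero_le_two fun y => by
      simp only [ContinuousMap.smul_apply, ContinuousMap.add_apply, smul_eq_mul]
      nlinarith [hpm2 y, hpm y, congrArg (fun t => t * m y ^ 2) hαβ]
  have b2 : ‖cplx (|α| • p - α • m) 0‖ ≤ |α| := norm_cplx_le (abs_nonneg _) fun y => by
    simp only [ContinuousMap.smul_apply, ContinuousMap.sub_apply, ContinuousMap.zero_apply,
      smul_eq_mul]
    nlinarith [hα y, h0 y]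
  have b3 : ‖cplx (|α| • p + α • m) 0‖ ≤ |α| := norm_cplx_le (abs_nonneg _) fun y => by
    simp only [ContinuousMap.smul_apply, ContinuousMap.add_apply, ContinuousMap.zero_apply,
      smul_eq_mul]
    nlinarith [hα y, h0 y]
  have b4 : ‖cplx (|β| • cosqrt m) (β • m)‖ ≤ |β| :=
    norm_cplx_le (abs_nonneg _) fun y => (hβ y).le
  have b5 : ‖cplx (|β| • cosqrt (-m)) (β • (-m))‖ ≤ |β| :=
    norm_cplx_le (abs_nonneg _) fun y => by
      simp only [ContinuousMap.smul_apply, ContinuousMap.neg_apply, smul_eq_mul, cosqrt_apply, neg_sq,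
        mul_neg]
      exact (hβ y).le
  have b6 : ‖cplx ((2 : ℝ) • p) 0‖ ≤ 2 := norm_cplx_le zero_le_two fun y => by
    simp only [ContinuousMap.smul_apply, ContinuousMap.zero_apply, smul_eq_mul]
    nlinarith [hp y, hp1 y]
  have hcos : cosqrt (-m) = cosqrt m := by ext y; simp [cosqrt_apply]
  have e : cplx ((2 : ℝ) • (p + α • m)) ((2 : ℝ) • β • m) + cplx (|α| • p - α • m) 0
      + cplx (|β| • cosqrt (-m)) (β • (-m)) = cplx ((2 : ℝ) • p) 0 + cplx (|α| • p + α • m) 0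
      + cplx (|β| • cosqrt m) (β • m) := by
    rw [hcos, cplx_add, cplx_add, cplx_add, cplx_add]
    congr 1 <;> module
  have hlow : 2 + |α| + |β| ≤ ‖cplx ((2 : ℝ) • p) 0 + cplx (|α| • p + α • m) 0
      + cplx (|β| • cosqrt m) (β • m)‖ := by
    rw [cplx_add, cplx_add]
    refine le_norm_cplx x ?_
    simp [hpx, hmx, cosqrt_of_eq_zero hmx]
  have k2 := hg.map_add_of_norm₃ _ _ _ (by linarith [b6, b3, b4] : _ ≤ ‖cplx ((2 : ℝ) • p) 0 +
    cplx (|α| • p + α • m) 0 + cplx (|β| • cosqrt m) (β • m)‖)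
  have k1 := hg.map_add_of_norm₃ _ _ _ (by rw [e]; linarith [b1, b2, b5] : _ ≤
    ‖cplx ((2 : ℝ) • (p + α • m)) ((2 : ℝ) • β • m) + cplx (|α| • p - α • m) 0
      + cplx (|β| • cosqrt (-m)) (β • (-m))‖)
  have hneg : ∀ y, |(-m) y| ≤ 1 := fun y => by rw [ContinuousMap.neg_apply, abs_neg]; exact hm y
  rw [e, k2, hg.map_smul_cosqrt hm hmx, hg.map_smul_cosqrt hneg (x := x) (by simp [hmx]),
    sub_eq_add_neg, hadd, hadd, hg.map_neg_real, hg.map_smul_real, hg.map_smul_real,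
    hg.map_smul_real, hg.map_smul_cplx zero_le_two, hg.map_neg_imag, hcos] at k1
  apply smul_right_injective Y (two_ne_zero (α := ℝ))
  simp only
  linear_combination (norm := module) -k1

theorem map_cplx_smul_of_threshold (hg : IsFaceAdditive g) (hadd : IsRealAdditive g)
    {m p : C(Ω, ℝ)} (hp : ∀ y, 0 ≤ p y) (hp1 : ∀ y, p y ≤ 1)
    (hpm : ∀ y, p y * m y = 0) {x : Ω} (hpx : p x = 1) {α β : ℝ} (hαβ : α ^ 2 + β ^ 2 = 1) :
    g (cplx (α • m) (β • m)) = α • g (cplx m 0) + β • g (cplx 0 m) := by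
  rcases eq_or_ne m 0 with rfl | h0
  · simp [cplx_zero_zero, hg.map_zero]
  obtain ⟨k, hmk, hpos, hk, y, hy⟩ := exists_normalized m h0
  obtain ⟨r, hr⟩ : ∃ r, r = ‖m‖ := ⟨_, rfl⟩
  rw [← hr] at hmk hpos
  have hpk : ∀ z, p z * k z = 0 := fun z => by
    have := hpm z
    rw [hmk, ContinuousMap.smul_apply, smul_eq_mul, mul_left_comm] at this
    exact (mul_eq_zero.1 this).resolve_left hpos.ne'
  have hadd' : IsRealAdditive fun φ => -g (-φ) := fun a b => by
    simp only [neg_cplx, neg_zero, neg_add]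
    rw [hadd, neg_add]
  have k1 := hg.map_add_smul_of_threshold hadd hk hp hp1 hpk hpx hαβ
  have k2 := hg.neg_map_neg.map_add_smul_of_threshold hadd' (m := -k)
    (fun z => by rw [ContinuousMap.neg_apply, abs_neg]; exact hk z) hp hp1
    (fun z => by rw [ContinuousMap.neg_apply, mul_neg, hpk, neg_zero]) hpx hαβ
  simp only [neg_cplx, neg_zero, neg_neg, smul_neg] at k2
  rw [hg.map_neg_real] at k2
  have hpy : p y = 0 := by
    have := hpk y
    have hky : k y ≠ 0 := by rintro h; rw [h] at hy; norm_num at hy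
    exact (mul_eq_zero.1 this).resolve_right hky
  have hk2 : ∀ z, p z ^ 2 + k z ^ 2 ≤ 1 := fun z => by
    have : k z ^ 2 ≤ 1 := by rw [sq_le_one_iff_abs_le_one]; exact hk z
    rcases mul_eq_zero.1 (hpk z) with h | h
    · rw [h]; nlinarith
    · rw [h]; nlinarith [hp z, hp1 z]
  have h1 := hg.map_cplx_add (p := p + α • k) (q := β • k) (p' := -(p + -(α • k))) (q' := β • k)
    zero_le_one zero_le_one (fun z => by
      simp only [ContinuousMap.smul_apply, ContinuousMap.add_apply, smul_eq_mul]
      nlinarith [hk2 z, hpk z, congrArg (fun t => t * k z ^ 2) hαβ]) (fun z => by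
      simp only [ContinuousMap.smul_apply, ContinuousMap.add_apply, smul_eq_mul,
        ContinuousMap.neg_apply]
      nlinarith [hk2 z, hpk z, congrArg (fun t => t * k z ^ 2) hαβ]) y (by
      simp only [ContinuousMap.smul_apply, ContinuousMap.add_apply, smul_eq_mul,
        ContinuousMap.neg_apply, hpy]
      nlinarith [congrArg (fun t => t * k y ^ 2) hαβ])
  have e1 : p + α • k + -(p + -(α • k)) = (2 : ℝ) • α • k := by module
  rw [e1, ← two_smul ℝ (β • k), hg.map_smul_cplx zero_le_two, k1] at h1
  have e2 : g (cplx (α • k) (β • k)) = α • g (cplx k 0) + β • g (cplx 0 k) := by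
    apply smul_right_injective Y (two_ne_zero (α := ℝ))
    simp only
    rw [h1]
    linear_combination (norm := module) -k2
  rw [hmk, smul_comm α r, smul_comm β r, hg.map_smul_cplx hpos.le, e2, hg.map_smul_real,
    hg.map_smul_imag]
  module

/-- A real function with a zero, multiplied by a unimodular constant, splits. -/
theorem map_cplx_smul (hg : IsFaceAdditive g) (hadd : IsRealAdditive g)
    (k : C(Ω, ℝ)) {x : Ω} (hx : k x = 0) {α β : ℝ} (hαβ : α ^ 2 + β ^ 2 = 1) :
    g (cplx (α • k) (β • k)) = α • g (cplx k 0) + β • g (cplx 0 k) := by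
  have hc : IsClosed {k : C(Ω, ℝ) |
      g (cplx (α • k) (β • k)) = α • g (cplx k 0) + β • g (cplx 0 k)} := by
    have := hg.continuous
    have := continuous_cplx (Ω := Ω)
    have h1 : Continuous fun k : C(Ω, ℝ) => cplx (α • k) (β • k) :=
      this.comp (f := fun k => (α • k, β • k)) (by fun_prop)
    have h2 : Continuous fun k : C(Ω, ℝ) => cplx k 0 :=
      this.comp (f := fun k => (k, 0)) (by fun_prop)
    have h3 : Continuous fun k : C(Ω, ℝ) => cplx 0 k :=
      this.comp (f := fun k => (0, k)) (by fun_prop)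
    exact isClosed_eq (by fun_prop) (by fun_prop)
  refine hc.closure_subset (Metric.mem_closure_iff.2 fun ε hε => ?_)
  obtain ⟨m, p, hd, hpx, hmx, hp, hp1, hpm, -⟩ := exists_threshold k hx (half_pos hε)
  exact ⟨m, hg.map_cplx_smul_of_threshold hadd hp hp1 hpm hpx hαβ, by linarith⟩

end IsFaceAdditive

end FaceAdditive

section Rotation

variable {A : Type*} [CStarAlgebra A]
variable {Y : Type*} [NormedAddCommGroup Y] [NormedSpace ℝ Y] {τ : A → Y}

theorem IsSphereIso.mul_left (hτ : IsSphereIso τ) {u : A} (hu : u ∈ unitary A) :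
    IsSphereIso fun x => τ (u * x) :=
  hτ.comp_isometryEquiv (Unitary.mulLeft ℝ A ⟨u, hu⟩)

theorem algebraMap_mem_unitary {z : ℂ} (hz : ‖z‖ = 1) : algebraMap ℂ A z ∈ unitary A := by
  have h : star z * z = 1 := by
    rw [Complex.star_def, Complex.conj_mul', hz]; norm_num
  rw [Unitary.mem_iff, ← algebraMap_star_comm, ← map_mul, ← map_mul, mul_comm z, h, map_one]
  exact ⟨rfl, rfl⟩

theorem IsSphereIso.smul_left (hτ : IsSphereIso τ) {z : ℂ} (hz : ‖z‖ = 1) :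
    IsSphereIso fun x => τ (z • x) := by
  simpa only [← Algebra.smul_def] using hτ.mul_left (algebraMap_mem_unitary (A := A) hz)

theorem norm_eq_one_of_mem_unitary [Nontrivial A] {u : A} (hu : u ∈ unitary A) : ‖u‖ = 1 :=
  CStarRing.norm_of_mem_unitary hu

end Rotation

section Normal

variable {A : Type*} [CStarAlgebra A] [PartialOrder A] [StarOrderedRing A] [Nontrivial A]
variable {Y : Type*} [NormedAddCommGroup Y] [NormedSpace ℝ Y] {τ : A → Y}

theorem map_add_of_isStarNormal (hτ : IsSphereIso τ) {a b : A} (hn : IsStarNormal (a + b))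
    (h : ‖a‖ + ‖b‖ ≤ ‖a + b‖) : τ (a + b) = τ a + τ b := by
  obtain ⟨⟨z, hz, hzn⟩, -⟩ := IsometricContinuousFunctionalCalculus.isGreatest_norm_spectrum
    (𝕜 := ℂ) (a + b) hn
  simp only at hzn
  rcases eq_or_ne z 0 with rfl | h0
  · rw [norm_zero] at hzn
    have ha : a = 0 := norm_eq_zero.1 (by linarith [norm_nonneg a, norm_nonneg b])
    have hb : b = 0 := norm_eq_zero.1 (by linarith [norm_nonneg a, norm_nonneg b])
    rw [ha, hb, add_zero, hτ.map_zero, add_zero]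
  have hzpos : 0 < ‖z‖ := norm_pos_iff.2 h0
  obtain ⟨w, hw⟩ : ∃ w : ℂ, w = z / ‖z‖ := ⟨_, rfl⟩
  have hw1 : ‖w‖ = 1 := by rw [hw, norm_div, Complex.norm_real, norm_norm, div_self hzpos.ne']
  have hw0 : w ≠ 0 := by rintro rfl; rw [norm_zero] at hw1; exact zero_ne_one hw1
  have hwi : ‖w⁻¹‖ = 1 := by rw [norm_inv, hw1, inv_one]
  have hzw : w⁻¹ * z = ‖z‖ := by
    rw [hw, inv_div, div_mul_cancel₀ _ h0]
  have hmem : (1 + ‖z‖ : ℂ) ∈ spectrum ℂ (1 + w⁻¹ • (a + b)) := by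
    have h1 : w⁻¹ * z ∈ spectrum ℂ (w⁻¹ • (a + b)) := by
      have := (spectrum.smul_mem_smul_iff (r := Units.mk0 w⁻¹ (inv_ne_zero hw0))).2 hz
      simpa [Units.smul_def] using this
    rw [hzw] at h1
    have := spectrum.add_mem_add_iff (s := 1) |>.2 h1
    simpa [add_comm] using this
  have hge := spectrum.norm_le_norm_of_mem hmem
  rw [← Complex.ofReal_one, ← Complex.ofReal_add, Complex.norm_real, Real.norm_of_nonneg
    (by positivity), hzn] at hge
  have ha : ‖w⁻¹ • a‖ = ‖a‖ := by rw [norm_smul, hwi, one_mul]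
  have hb : ‖w⁻¹ • b‖ = ‖b‖ := by rw [norm_smul, hwi, one_mul]
  have key := map_add_of_norm_add (hτ.smul_left hw1) (a := w⁻¹ • a) (b := w⁻¹ • b) ?_ norm_one
  · simpa only [← smul_add, smul_inv_smul₀ hw0] using key
  · refine le_antisymm (norm_add₃_le.trans (by rw [norm_one])) ?_
    rw [ha, hb, add_assoc 1 (w⁻¹ • a), ← smul_add]
    linarith

theorem map_neg_one (hτ : IsSphereIso τ) : τ (-1) = -τ 1 := by
  obtain ⟨y, hy, hyτ⟩ := hτ.exists_unit (-τ (-1)) (by rw [norm_neg, hτ.norm_map, norm_neg, norm_one])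
  have := fixes_of_aligned (y := y) (h := 1) hy.le zero_le_one le_rfl fun w _ hw _ => by
    rw [← hτ.norm_pair_iff hy hw, hyτ, add_comm, hτ.norm_add_neg_map_neg hw norm_one]
    have hw1 : 0 ≤ w := by assumption
    have := exists_state_of_nonneg hw1 hw
    obtain ⟨χ, hχ, hχ1, hχw⟩ := this
    exact norm_add_eq_two_of_apply_eq_one hχ hw.le norm_one.le hχw hχ1
  rw [mul_one] at this
  rw [this.1] at hyτ
  rw [hyτ, neg_neg]

theorem map_neg_of_mem_unitary (hτ : IsSphereIso τ) {u : A} (hu : u ∈ unitary A) :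
    τ (-u) = -τ u := by
  simpa using map_neg_one (hτ.mul_left hu)

theorem cfcHom_mem_unitary {a : A} (ha : IsStarNormal a) {φ : C(spectrum ℂ a, ℂ)}
    (h : ∀ x, ‖φ x‖ = 1) : cfcHom ha φ ∈ unitary A := by
  have : star φ * φ = 1 := by
    ext x
    rw [ContinuousMap.mul_apply, ContinuousMap.star_apply, Complex.star_def, Complex.conj_mul', h]
    norm_num
  rw [Unitary.mem_iff, ← map_star, ← map_mul, ← map_mul, mul_comm φ, this, map_one]
  exact ⟨rfl, rfl⟩

theorem norm_cfcHom_complex {a : A} (ha : IsStarNormal a) (φ : C(spectrum ℂ a, ℂ)) :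
    ‖cfcHom ha φ‖ = ‖φ‖ :=
  norm_cfcHom a φ ha

theorem isFaceAdditive_cfcHom (hτ : IsSphereIso τ) {a : A} (ha : IsStarNormal a) :
    IsFaceAdditive fun φ : C(spectrum ℂ a, ℂ) => τ (cfcHom ha φ) where
  map_add_of_norm φ ψ h := by
    rw [map_add]
    refine map_add_of_isStarNormal hτ ?_ ?_
    · rw [← map_add]
      exact ⟨by rw [commute_iff_eq, ← map_star, ← map_mul, ← map_mul, mul_comm]⟩
    · rwa [← map_add, norm_cfcHom_complex, norm_cfcHom_complex,
        norm_cfcHom_complex]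
  map_smul r φ hr := by
    rw [← hτ.map_smul r _ hr]
    congr 1
    exact map_real_smul (cfcHom ha) (cfcHom_continuous ha) r φ
  continuous := hτ.continuous.comp (cfcHom_continuous ha)
  map_neg_of_unimodular φ h := by
    rw [map_neg, map_neg_of_mem_unitary hτ (cfcHom_mem_unitary ha h)]

theorem cfcHom_cplx {a : A} (ha : IsStarNormal a) (p q : C(spectrum ℂ a, ℝ)) :
    cfcHom ha (cplx p q) = cfcHom ha (cplx p 0) + Complex.I • cfcHom ha (cplx q 0) := by
  rw [← map_smul, ← map_add]
  congr 1
  ext x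
  simp [cplx_apply, mul_comm]

theorem cfcHom_cplx_zero_left {a : A} (ha : IsStarNormal a) (q : C(spectrum ℂ a, ℝ)) :
    cfcHom ha (cplx 0 q) = Complex.I • cfcHom ha (cplx q 0) := by
  rw [cfcHom_cplx, cplx_zero_zero, map_zero, zero_add]

theorem isSelfAdjoint_cfcHom_cplx {a : A} (ha : IsStarNormal a) (p : C(spectrum ℂ a, ℝ)) :
    IsSelfAdjoint (cfcHom ha (cplx p 0)) := by
  rw [isSelfAdjoint_iff, ← map_star]
  congr 1
  ext x
  simp [cplx_apply]

/-- The real part of the identity function on the spectrum. -/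
def spectrumRe (a : A) : C(spectrum ℂ a, ℝ) := ⟨fun x => (x : ℂ).re, by fun_prop⟩

/-- The imaginary part of the identity function on the spectrum. -/
def spectrumIm (a : A) : C(spectrum ℂ a, ℝ) := ⟨fun x => (x : ℂ).im, by fun_prop⟩

theorem cfcHom_cplx_spectrum {a : A} (ha : IsStarNormal a) :
    cfcHom ha (cplx (spectrumRe a) (spectrumIm a)) = a := by
  refine Eq.trans ?_ (cfcHom_id (R := ℂ) ha)
  congr 1
  ext x
  exact Complex.re_add_im _

theorem spectrumIm_eq_zero {a : A} (ha : IsSelfAdjoint a) : spectrumIm a = 0 := by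
  ext x
  exact ha.im_eq_zero_of_mem_spectrum x.2

theorem cfcHom_cplx_spectrumRe {a : A} (ha : IsSelfAdjoint a) :
    cfcHom ha.isStarNormal (cplx (spectrumRe a) 0) = a := by
  rw [← spectrumIm_eq_zero ha, cfcHom_cplx_spectrum]

theorem cfcHom_cplx_one {a : A} (ha : IsStarNormal a) : cfcHom ha (cplx 1 0) = 1 := by
  rw [show cplx (1 : C(spectrum ℂ a, ℝ)) 0 = 1 by ext; simp [cplx_apply], map_one]

theorem cfcHom_cplx_smul {a : A} (ha : IsStarNormal a) (r : ℝ) (p : C(spectrum ℂ a, ℝ)) :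
    cfcHom ha (cplx (r • p) 0) = r • cfcHom ha (cplx p 0) := by
  rw [← map_real_smul (cfcHom ha) (cfcHom_continuous ha), smul_cplx, smul_zero]

theorem cfcHom_cplx_add {a : A} (ha : IsStarNormal a) (p q : C(spectrum ℂ a, ℝ)) :
    cfcHom ha (cplx (p + q) 0) = cfcHom ha (cplx p 0) + cfcHom ha (cplx q 0) := by
  rw [← map_add, cplx_add, add_zero]

theorem cfcHom_cplx_sub {a : A} (ha : IsStarNormal a) (p q : C(spectrum ℂ a, ℝ)) :
    cfcHom ha (cplx (p - q) 0) = cfcHom ha (cplx p 0) - cfcHom ha (cplx q 0) := by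
  rw [eq_sub_iff_add_eq, ← cfcHom_cplx_add, sub_add_cancel]

end Normal

section SelfAdjoint

variable {A : Type*} [CStarAlgebra A] [PartialOrder A] [StarOrderedRing A] [Nontrivial A]
variable {Y : Type*} [NormedAddCommGroup Y] [NormedSpace ℝ Y] {τ : A → Y}

theorem map_real_smul_of_isSelfAdjoint (hτ : IsSphereIso τ) {h : A} (hh : IsSelfAdjoint h) (r : ℝ) :
    τ (r • h) = r • τ h := by
  have := (isFaceAdditive_cfcHom hτ hh.isStarNormal).map_smul_real r (spectrumRe h)
  rwa [cfcHom_cplx_smul, cfcHom_cplx_spectrumRe hh] at this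

theorem map_I_real_smul_of_isSelfAdjoint (hτ : IsSphereIso τ) {h : A} (hh : IsSelfAdjoint h)
    (r : ℝ) : τ (Complex.I • r • h) = r • τ (Complex.I • h) :=
  map_real_smul_of_isSelfAdjoint (hτ.smul_left Complex.norm_I) hh r

theorem abs_spectrumRe_le {h : A} (x : spectrum ℂ h) : |spectrumRe h x| ≤ ‖h‖ :=
  (Complex.abs_re_le_norm _).trans (spectrum.norm_le_norm_of_mem x.2)

theorem exists_unitary_tangent (hτ : IsSphereIso τ) {h : A} (hh : IsSelfAdjoint h)
    (h0 : (0 : ℂ) ∈ spectrum ℂ h) {t : ℝ} (ht : 0 ≤ t) (hth : t * ‖h‖ ≤ 1) :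
    ∃ v ∈ unitary A, ‖v - 1 - t • Complex.I • h‖ ≤ t ^ 2 * ‖h‖ ^ 2 ∧
      ‖τ v - τ 1 - t • τ (Complex.I • h)‖ ≤ 3 * (t ^ 2 * ‖h‖ ^ 2) := by
  have hn := hh.isStarNormal
  obtain ⟨k, hk⟩ : ∃ k, k = t • spectrumRe h := ⟨_, rfl⟩
  have hkx : ∀ x, |k x| ≤ t * ‖h‖ := fun x => by
    rw [hk, ContinuousMap.smul_apply, smul_eq_mul, abs_mul, abs_of_nonneg ht]
    exact mul_le_mul_of_nonneg_left (abs_spectrumRe_le x) ht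
  have hk1 : ∀ x, |k x| ≤ 1 := fun x => (hkx x).trans hth
  have hg := isFaceAdditive_cfcHom hτ hn
  have hik : cfcHom hn (cplx 0 k) = t • Complex.I • h := by
    rw [cfcHom_cplx_zero_left, hk, cfcHom_cplx_smul, cfcHom_cplx_spectrumRe hh, smul_comm]
  have hcos : ‖cfcHom hn (cplx (cosqrt k) 0) - 1‖ ≤ t ^ 2 * ‖h‖ ^ 2 := by
    rw [← cfcHom_cplx_one hn, ← cfcHom_cplx_sub, norm_cfcHom_complex]
    refine norm_cplx_le (by positivity) fun x => ?_
    have e1 := cosqrt_sq (hk1 x)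
    have e2 := cosqrt_nonneg k x
    have e3 := sq_le_sq' (by linarith [abs_nonneg (k x), hkx x]) (hkx x)
    rw [sq_abs] at e3
    simp only [ContinuousMap.sub_apply, ContinuousMap.one_apply, ContinuousMap.zero_apply]
    have e4 : 0 ≤ 1 - cosqrt k x := by nlinarith [sq_nonneg (k x)]
    have e5 : 1 - cosqrt k x ≤ k x ^ 2 := by nlinarith
    nlinarith
  have hx0 : k ⟨0, h0⟩ = 0 := by
    rw [hk, ContinuousMap.smul_apply]
    change t • (0 : ℂ).re = 0
    simp
  refine ⟨cfcHom hn (cplx (cosqrt k) k), cfcHom_mem_unitary hn fun x => ?_, ?_, ?_⟩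
  · have := norm_cplx_apply_sq (cosqrt k) k x
    rw [cosqrt_sq (hk1 x), sub_add_cancel] at this
    exact (pow_eq_one_iff_of_nonneg (norm_nonneg _) two_ne_zero).1 this
  · rw [cfcHom_cplx, ← cfcHom_cplx_zero_left, hik]
    convert hcos using 2
    abel
  · have hsplit : τ (cfcHom hn (cplx (cosqrt k) k))
        = τ (cfcHom hn (cplx (cosqrt k) 0)) + τ (cfcHom hn (cplx 0 k)) :=
      hg.map_cplx_cosqrt hk1 hx0
    rw [hsplit, hik, hτ.map_smul _ _ ht]
    have := (hτ.norm_sub_le (cfcHom hn (cplx (cosqrt k) 0)) 1).trans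
      (mul_le_mul_of_nonneg_left hcos (by norm_num))
    rwa [add_sub_right_comm, add_sub_cancel_right]

/-- There are unitaries tangent at `1` to the direction `I • H` with images tangent to `s`. -/
def HasTangent (τ : A → Y) (H : A) (s : Y) : Prop :=
  ∃ K δ : ℝ, 0 ≤ K ∧ 0 < δ ∧ ∀ t, 0 < t → t ≤ δ → ∃ g ∈ unitary A,
    ‖g - 1 - t • Complex.I • H‖ ≤ K * t ^ 2 ∧ ‖τ g - τ 1 - t • s‖ ≤ K * t ^ 2

theorem hasTangent_zero (τ : A → Y) : HasTangent τ 0 0 :=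
  ⟨0, 1, le_rfl, one_pos, fun t _ _ => ⟨1, one_mem _, by simp, by simp⟩⟩

theorem HasTangent.add (hτ : IsSphereIso τ) {H : A} {s : Y} (hQ : HasTangent τ H s) {h : A}
    (hh : IsSelfAdjoint h) (h0 : (0 : ℂ) ∈ spectrum ℂ h) :
    HasTangent τ (H + h) (s + τ (Complex.I • h)) := by
  obtain ⟨K, δ, hK, hδ, hQ⟩ := hQ
  refine ⟨3 * ‖h‖ ^ 2 + K + 3 * ((‖H‖ + K) * ‖h‖), min δ (min 1 (‖h‖ + 1)⁻¹), by positivity,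
    by positivity, fun t ht htδ => ?_⟩
  obtain ⟨ht1, ht2, ht3⟩ : t ≤ δ ∧ t ≤ 1 ∧ t ≤ (‖h‖ + 1)⁻¹ := by simpa using htδ
  have hth : t * ‖h‖ ≤ 1 := by
    have := mul_le_mul_of_nonneg_right ht3 (by positivity : 0 ≤ ‖h‖ + 1)
    rw [inv_mul_cancel₀ (by positivity)] at this
    linarith
  obtain ⟨g, hg, hg1, hg2⟩ := hQ t ht ht1
  obtain ⟨v, hv, hv1, hv2⟩ := exists_unitary_tangent (hτ.mul_left hg) hh h0 ht.le hth
  have hgn : ‖g‖ = 1 := norm_eq_one_of_mem_unitary hg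
  have hnI : ∀ x : A, ‖Complex.I • x‖ = ‖x‖ := fun x => by
    rw [norm_smul, Complex.norm_I, one_mul]
  have hgd : ‖g - 1‖ ≤ t * (‖H‖ + K) := by
    calc ‖g - 1‖ = ‖(g - 1 - t • Complex.I • H) + t • Complex.I • H‖ := by rw [sub_add_cancel]
      _ ≤ K * t ^ 2 + t * ‖H‖ := by
        refine norm_add_le_of_le hg1 ?_
        rw [norm_smul, hnI, Real.norm_of_nonneg ht.le]
      _ ≤ t * (‖H‖ + K) := by nlinarith [mul_nonneg hK ht.le]
  have hgh : ‖(g - 1) * Complex.I • h‖ ≤ t * (‖H‖ + K) * ‖h‖ := by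
    refine (norm_mul_le _ _).trans ?_
    rw [hnI]
    exact mul_le_mul_of_nonneg_right hgd (norm_nonneg _)
  refine ⟨g * v, mul_mem hg hv, ?_, ?_⟩
  · have e : g * v - 1 - t • Complex.I • (H + h) = g * (v - 1 - t • Complex.I • h)
        + (g - 1 - t • Complex.I • H) + t • ((g - 1) * Complex.I • h) := by
      simp only [mul_sub, sub_mul, mul_smul_comm, smul_add, smul_sub, one_mul, mul_one]
      abel
    rw [e]
    have e1 : ‖g * (v - 1 - t • Complex.I • h)‖ ≤ t ^ 2 * ‖h‖ ^ 2 := by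
      refine (norm_mul_le _ _).trans ?_
      rwa [hgn, one_mul]
    have e2 : ‖t • ((g - 1) * Complex.I • h)‖ ≤ t * (t * (‖H‖ + K) * ‖h‖) := by
      rw [norm_smul, Real.norm_of_nonneg ht.le]
      exact mul_le_mul_of_nonneg_left hgh ht.le
    refine (norm_add_le_of_le (norm_add_le_of_le e1 hg1) e2).trans ?_
    have : 0 ≤ t ^ 2 * ((‖H‖ + K) * ‖h‖) := by positivity
    have : 0 ≤ t ^ 2 * ‖h‖ ^ 2 := by positivity
    nlinarith
  · simp only [mul_one] at hv2
    have e : τ (g * v) - τ 1 - t • (s + τ (Complex.I • h)) =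
        (τ (g * v) - τ g - t • τ (g * Complex.I • h)) + (τ g - τ 1 - t • s)
          + t • (τ (g * Complex.I • h) - τ (Complex.I • h)) := by module
    rw [e]
    have e2 : ‖t • (τ (g * Complex.I • h) - τ (Complex.I • h))‖
        ≤ t * (3 * (t * (‖H‖ + K) * ‖h‖)) := by
      rw [norm_smul, Real.norm_of_nonneg ht.le]
      refine mul_le_mul_of_nonneg_left ((hτ.norm_sub_le _ _).trans ?_) ht.le
      rw [← sub_one_mul]
      exact mul_le_mul_of_nonneg_left hgh (by norm_num)
    refine (norm_add_le_of_le (norm_add_le_of_le hv2 hg2) e2).trans (le_of_eq (by ring))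

theorem HasTangent.eq_zero (hτ : IsSphereIso τ) {s : Y} (hQ : HasTangent τ 0 s) : s = 0 := by
  obtain ⟨K, δ, hK, hδ, hQ⟩ := hQ
  have key : ∀ t, 0 < t → t ≤ δ → ‖s‖ ≤ 4 * K * t := fun t ht htδ => by
    obtain ⟨g, -, hg1, hg2⟩ := hQ t ht htδ
    rw [smul_zero, smul_zero, sub_zero] at hg1
    have h1 := (hτ.norm_sub_le g 1).trans (mul_le_mul_of_nonneg_left hg1 (by norm_num))
    have h2 : ‖t • s‖ ≤ 3 * (K * t ^ 2) + K * t ^ 2 := by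
      rw [show t • s = (τ g - τ 1) - (τ g - τ 1 - t • s) by abel]
      exact (norm_sub_le _ _).trans (add_le_add h1 hg2)
    rw [norm_smul, Real.norm_of_nonneg ht.le] at h2
    have h3 : t * ‖s‖ ≤ t * (4 * K * t) := by linarith
    exact le_of_mul_le_mul_left h3 ht
  have hlim : Filter.Tendsto (fun t : ℝ => 4 * K * t) (nhdsWithin 0 (Set.Ioi 0)) (nhds 0) := by
    have : Continuous fun t : ℝ => 4 * K * t := by fun_prop
    have := this.tendsto 0
    rw [mul_zero] at this
    exact this.mono_left nhdsWithin_le_nhds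
  have : ‖s‖ ≤ 0 := ge_of_tendsto hlim (by
    filter_upwards [Ioc_mem_nhdsGT hδ] with t ht using key t ht.1 ht.2)
  exact norm_le_zero_iff.1 this

end SelfAdjoint

section Splitting

variable {A : Type*} [CStarAlgebra A] [PartialOrder A] [StarOrderedRing A] [Nontrivial A]
variable {Y : Type*} [NormedAddCommGroup Y] [NormedSpace ℝ Y] {τ : A → Y}

/-- A positive contraction with `0` and `1` in its spectrum. -/
structure IsSplitting (f : A) : Prop where
  isSelfAdjoint : IsSelfAdjoint f
  zero_mem : (0 : ℂ) ∈ spectrum ℂ f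
  one_mem : (1 : ℂ) ∈ spectrum ℂ f
  re_nonneg : ∀ z ∈ spectrum ℂ f, 0 ≤ z.re
  re_le_one : ∀ z ∈ spectrum ℂ f, z.re ≤ 1

theorem zero_mem_spectrum_sub_smul_one {a : A} {r : ℝ} (h : (r : ℂ) ∈ spectrum ℂ a) :
    (0 : ℂ) ∈ spectrum ℂ (a - r • (1 : A)) := by
  rw [spectrum.zero_mem_iff, ← IsUnit.neg_iff, neg_sub]
  have : r • (1 : A) = algebraMap ℂ A r := by
    rw [Algebra.algebraMap_eq_smul_one, Complex.coe_smul]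
  rw [this]
  exact h

theorem zero_mem_spectrum_smul {a : A} (h : (0 : ℂ) ∈ spectrum ℂ a) (r : ℝ) :
    (0 : ℂ) ∈ spectrum ℂ (r • a) := by
  rw [spectrum.zero_mem_iff] at h ⊢
  intro hu
  apply h
  rcases eq_or_ne r 0 with rfl | hr
  · rw [zero_smul] at hu
    exact absurd hu not_isUnit_zero
  · have : a = r⁻¹ • r • a := by rw [inv_smul_smul₀ hr]
    rw [this]
    exact (Units.mk0 r⁻¹ (inv_ne_zero hr) • hu.unit).isUnit

theorem IsSplitting.zero_mem_one_sub {f : A} (hf : IsSplitting f) :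
    (0 : ℂ) ∈ spectrum ℂ (1 - f) := by
  have := zero_mem_spectrum_sub_smul_one (a := f) (r := 1) (by simpa using hf.one_mem)
  rw [one_smul] at this
  simpa [neg_one_smul] using zero_mem_spectrum_smul this (-1)

theorem exists_isSplitting {h : A} (hh : IsSelfAdjoint h) {x y : spectrum ℂ h}
    (hxy : x ≠ y) : ∃ f : A, IsSplitting f := by
  wlog hlt : spectrumRe h x < spectrumRe h y generalizing x y
  · refine this hxy.symm (lt_of_le_of_ne (not_lt.1 hlt) fun he => hxy ?_)
    refine Subtype.ext (Complex.ext he.symm ?_)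
    rw [hh.im_eq_zero_of_mem_spectrum x.2, hh.im_eq_zero_of_mem_spectrum y.2]
  obtain ⟨a, ha⟩ : ∃ a, a = spectrumRe h x := ⟨_, rfl⟩
  obtain ⟨b, hb⟩ : ∃ b, b = spectrumRe h y := ⟨_, rfl⟩
  rw [← ha, ← hb] at hlt
  obtain ⟨p, hp⟩ : ∃ p : C(spectrum ℂ h, ℝ),
      ∀ z, p z = max 0 (min 1 ((spectrumRe h z - a) / (b - a))) :=
    ⟨⟨fun z => max 0 (min 1 ((spectrumRe h z - a) / (b - a))), by fun_prop⟩, fun _ => rfl⟩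
  have hn := hh.isStarNormal
  have hs : spectrum ℂ (cfcHom hn (cplx p 0)) = Set.range (cplx p 0) := cfcHom_map_spectrum hn _
  have hap : ∀ z, cplx p 0 z = p z := fun z => by simp [cplx_apply]
  refine ⟨cfcHom hn (cplx p 0), isSelfAdjoint_cfcHom_cplx hn p, ?_, ?_, ?_, ?_⟩
  · rw [hs]
    exact ⟨x, by rw [hap, hp, ← ha]; simp⟩
  · rw [hs]
    exact ⟨y, by rw [hap, hp, ← hb, div_self (sub_pos.2 hlt).ne']; simp⟩
  · rw [hs]
    rintro _ ⟨z, rfl⟩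
    rw [hap, Complex.ofReal_re, hp]
    exact le_max_left _ _
  · rw [hs]
    rintro _ ⟨z, rfl⟩
    rw [hap, Complex.ofReal_re, hp]
    exact max_le zero_le_one (min_le_left _ _)

theorem map_one_eq_add {f : A} (hτ : IsSphereIso τ) (hf : IsSelfAdjoint f)
    (h0 : (0 : ℂ) ∈ spectrum ℂ f) (h1 : ∀ z ∈ spectrum ℂ f, 0 ≤ z.re)
    (h2 : ∀ z ∈ spectrum ℂ f, z.re ≤ 2) : τ 1 = τ f + τ (1 - f) := by
  have := (isFaceAdditive_cfcHom hτ hf.isStarNormal).map_one_eq (n := spectrumRe f) (x := ⟨0, h0⟩)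
    (fun y => h1 y y.2) (fun y => h2 y y.2) Complex.zero_re
  rwa [cfcHom_cplx_sub, cfcHom_cplx_one, cfcHom_cplx_spectrumRe hf, add_comm] at this

theorem spectrum_re_smul {h : A} (hh : IsSelfAdjoint h) {r : ℝ} {z : ℂ}
    (hz : z ∈ spectrum ℂ (1 - r • h)) : ∃ x : spectrum ℂ h, z.re = 1 - r * (x : ℂ).re := by
  have hn := hh.isStarNormal
  have : 1 - r • h = cfcHom hn (cplx (1 - r • spectrumRe h) 0) := by
    rw [cfcHom_cplx_sub, cfcHom_cplx_one, cfcHom_cplx_smul, cfcHom_cplx_spectrumRe hh]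
  rw [this, cfcHom_map_spectrum hn] at hz
  obtain ⟨x, rfl⟩ := hz
  exact ⟨x, by simp [cplx_apply, spectrumRe]⟩

/-- A self-adjoint element is a sum of three singular ones, compatibly with `τ`. -/
theorem exists_map_eq_add {f : A} (hf : IsSplitting f) {h : A} (hh : IsSelfAdjoint h) :
    ∃ r : ℝ, (0 : ℂ) ∈ spectrum ℂ (h - r • (1 : A)) ∧ ∀ τ : A → Y, IsSphereIso τ →
      τ h = r • τ f + r • τ (1 - f) + τ (h - r • (1 : A)) := by
  obtain ⟨⟨z, hz, hzn⟩, hmax⟩ := IsometricContinuousFunctionalCalculus.isGreatest_norm_spectrum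
    (𝕜 := ℂ) h hh.isStarNormal
  have hzr : z = z.re := Complex.ext rfl (hh.im_eq_zero_of_mem_spectrum hz)
  obtain ⟨r, hr⟩ : ∃ r, r = z.re := ⟨_, rfl⟩
  rw [← hr] at hzr
  rw [hzr] at hz hzn
  simp only [Complex.norm_real, Real.norm_eq_abs] at hzn
  have h0 := zero_mem_spectrum_sub_smul_one hz
  refine ⟨r, h0, fun τ hτ => ?_⟩
  rcases eq_or_ne r 0 with rfl | hr0
  · simp
  have hsa : IsSelfAdjoint (1 - r⁻¹ • h) :=
    (IsSelfAdjoint.one A).sub ((IsSelfAdjoint.all _).smul hh)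
  have hb : ∀ x : spectrum ℂ h, |r⁻¹ * (x : ℂ).re| ≤ 1 := fun x => by
    rw [abs_mul, abs_inv, hzn]
    have := abs_spectrumRe_le x
    exact inv_mul_le_one_of_le₀ this (norm_nonneg _)
  have hm : (1 : A) - r⁻¹ • h = -r⁻¹ • (h - r • (1 : A)) := by
    rw [smul_sub, smul_smul, neg_mul, inv_mul_cancel₀ hr0]; module
  have e1 := map_one_eq_add hτ hsa (by rw [hm]; exact zero_mem_spectrum_smul h0 _)
    (fun z hz => by
      obtain ⟨x, hx⟩ := spectrum_re_smul hh hz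
      rw [hx]; linarith [(abs_le.1 (hb x)).2])
    (fun z hz => by
      obtain ⟨x, hx⟩ := spectrum_re_smul hh hz
      rw [hx]; linarith [(abs_le.1 (hb x)).1])
  have e2 := map_one_eq_add hτ hf.isSelfAdjoint hf.zero_mem hf.re_nonneg
    fun z hz => (hf.re_le_one z hz).trans one_le_two
  rw [sub_sub_cancel, hm, map_real_smul_of_isSelfAdjoint hτ
    (hh.sub ((IsSelfAdjoint.all _).smul (IsSelfAdjoint.one A))),
    map_real_smul_of_isSelfAdjoint hτ hh, e2] at e1
  rw [← smul_add, e1, smul_add, smul_smul, smul_smul, mul_neg, mul_inv_cancel₀ hr0]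
  module

theorem IsSphereIso.I_smul (hτ : IsSphereIso τ) : IsSphereIso fun x => τ (Complex.I • x) :=
  hτ.smul_left Complex.norm_I

theorem HasTangent.add_isSelfAdjoint (hτ : IsSphereIso τ) {f : A} (hf : IsSplitting f) {H : A}
    {s : Y} (hQ : HasTangent τ H s) {h : A} (hh : IsSelfAdjoint h) :
    HasTangent τ (H + h) (s + τ (Complex.I • h)) := by
  obtain ⟨r, hr, H1⟩ := exists_map_eq_add (Y := Y) hf hh
  have hs : ∀ {x : A}, IsSelfAdjoint x → IsSelfAdjoint (r • x) := fun hx =>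
    (IsSelfAdjoint.all _).smul hx
  have h1 := IsSelfAdjoint.one A
  have hQ' := ((hQ.add hτ (hs hf.isSelfAdjoint) (zero_mem_spectrum_smul hf.zero_mem r)).add hτ
    (hs (h1.sub hf.isSelfAdjoint)) (zero_mem_spectrum_smul hf.zero_mem_one_sub r)).add hτ
    (hh.sub (hs h1)) hr
  have e := H1 _ hτ.I_smul
  rw [e]
  rw [map_I_real_smul_of_isSelfAdjoint hτ hf.isSelfAdjoint,
    map_I_real_smul_of_isSelfAdjoint hτ (h1.sub hf.isSelfAdjoint)] at hQ'
  convert hQ' using 1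
  · module
  · abel

theorem map_I_smul_add (hτ : IsSphereIso τ) {f : A} (hf : IsSplitting f) {h k : A}
    (hh : IsSelfAdjoint h) (hk : IsSelfAdjoint k) :
    τ (Complex.I • (h + k)) = τ (Complex.I • h) + τ (Complex.I • k) := by
  have hQ := (((hasTangent_zero τ).add_isSelfAdjoint hτ hf hh).add_isSelfAdjoint hτ hf
    hk).add_isSelfAdjoint hτ hf (hh.add hk).neg
  rw [zero_add, add_neg_cancel, ← neg_one_smul ℝ (h + k),
    map_I_real_smul_of_isSelfAdjoint hτ (hh.add hk), zero_add] at hQ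
  have := hQ.eq_zero hτ
  rw [neg_one_smul, ← sub_eq_add_neg, sub_eq_zero] at this
  exact this.symm

theorem map_add_of_isSelfAdjoint (hτ : IsSphereIso τ) {f : A} (hf : IsSplitting f) {h k : A}
    (hh : IsSelfAdjoint h) (hk : IsSelfAdjoint k) : τ (h + k) = τ h + τ k := by
  have := map_I_smul_add (hτ.smul_left (z := -Complex.I) (by simp)) hf hh hk
  simpa [smul_smul] using this

theorem map_smul_of_isSelfAdjoint (hτ : IsSphereIso τ) {f : A} (hf : IsSplitting f) {k : A}
    (hk : IsSelfAdjoint k) {α β : ℝ} (hαβ : α ^ 2 + β ^ 2 = 1) :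
    τ ((α + β * Complex.I : ℂ) • k) = α • τ k + β • τ (Complex.I • k) := by
  have sing : ∀ {k : A}, IsSelfAdjoint k → (0 : ℂ) ∈ spectrum ℂ k →
      τ ((α + β * Complex.I : ℂ) • k) = α • τ k + β • τ (Complex.I • k) := by
    intro k hk h0
    have hn := hk.isStarNormal
    have := (isFaceAdditive_cfcHom hτ hn).map_cplx_smul (fun p q => by
      simp only [cfcHom_cplx_add]
      exact map_add_of_isSelfAdjoint hτ hf (isSelfAdjoint_cfcHom_cplx hn p)
        (isSelfAdjoint_cfcHom_cplx hn q)) (spectrumRe k) (x := ⟨0, h0⟩) Complex.zero_re hαβ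
    rw [cfcHom_cplx, cfcHom_cplx_smul, cfcHom_cplx_smul, cfcHom_cplx_zero_left,
      cfcHom_cplx_spectrumRe hk] at this
    rw [← this]
    congr 1
    rw [add_smul, mul_comm, mul_smul, Complex.coe_smul, Complex.coe_smul]
  have hz : ‖(α + β * Complex.I : ℂ)‖ = 1 := by
    rw [← pow_eq_one_iff_of_nonneg (norm_nonneg _) two_ne_zero, Complex.sq_norm,
      Complex.normSq_add_mul_I, hαβ]
  obtain ⟨r, hr, H⟩ := exists_map_eq_add (Y := Y) hf hk
  have h1 := IsSelfAdjoint.one A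
  have e1 := H _ hτ
  have e2 := H _ hτ.I_smul
  have e3 := H _ (hτ.smul_left hz)
  rw [e1, e2, e3, sing hf.isSelfAdjoint hf.zero_mem, sing (h1.sub hf.isSelfAdjoint)
    hf.zero_mem_one_sub, sing (hk.sub ((IsSelfAdjoint.all _).smul h1)) hr]
  module

end Splitting

section RealLinear

open ComplexStarModule

variable {A : Type*} [CStarAlgebra A] [PartialOrder A] [StarOrderedRing A] [Nontrivial A]
variable {Y : Type*} [NormedAddCommGroup Y] [NormedSpace ℝ Y] {τ : A → Y}

/-- The candidate for the real linear extension of `τ`. -/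
noncomputable def reSum (τ : A → Y) (x : A) : Y := τ (ℜ x : A) + τ (Complex.I • (ℑ x : A))

theorem reSum_eq (τ : A → Y) {a b : A} (ha : IsSelfAdjoint a) (hb : IsSelfAdjoint b) :
    reSum τ (a + Complex.I • b) = τ a + τ (Complex.I • b) := by
  rw [reSum]
  simp [map_add, realPart_I_smul, imaginaryPart_I_smul, ha.imaginaryPart, hb.imaginaryPart,
    ha.coe_realPart, hb.coe_realPart]

theorem reSum_add (hτ : IsSphereIso τ) {f : A} (hf : IsSplitting f) (x y : A) :
    reSum τ (x + y) = reSum τ x + reSum τ y := by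
  simp only [reSum, map_add, AddMemClass.coe_add]
  rw [map_add_of_isSelfAdjoint hτ hf (ℜ x).2 (ℜ y).2, map_I_smul_add hτ hf (ℑ x).2 (ℑ y).2]
  abel

theorem reSum_smul (hτ : IsSphereIso τ) (r : ℝ) (x : A) : reSum τ (r • x) = r • reSum τ x := by
  simp only [reSum, map_smul, selfAdjoint.val_smul]
  rw [map_real_smul_of_isSelfAdjoint hτ (ℜ x).2, map_I_real_smul_of_isSelfAdjoint hτ (ℑ x).2,
    smul_add]

theorem norm_reSum_le (hτ : IsSphereIso τ) (x : A) : ‖reSum τ x‖ ≤ 2 * ‖x‖ := by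
  have h1 : ‖τ (ℜ x : A)‖ ≤ ‖x‖ := by rw [hτ.norm_map]; exact realPart.norm_le x
  have h2 : ‖τ (Complex.I • (ℑ x : A))‖ ≤ ‖x‖ := by
    rw [hτ.norm_map, norm_smul, Complex.norm_I, one_mul]; exact imaginaryPart.norm_le x
  exact (norm_add_le_of_le h1 h2).trans_eq (by ring)

theorem map_eq_reSum_of_mem_unitary (hτ : IsSphereIso τ) {f : A} (hf : IsSplitting f) {v : A}
    (hv : v ∈ unitary A) : τ v = reSum τ v := by
  obtain ⟨z, hz⟩ := spectrum.nonempty v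
  have hz1 : ‖z‖ = 1 := by simpa using Unitary.spectrum_subset_circle (𝕜 := ℂ) ⟨v, hv⟩ hz
  have hz0 : z ≠ 0 := by rintro rfl; rw [norm_zero] at hz1; exact zero_ne_one hz1
  have hzi : ‖z⁻¹‖ = 1 := by rw [norm_inv, hz1, inv_one]
  obtain ⟨w, hw⟩ : ∃ w, w = z⁻¹ • v := ⟨_, rfl⟩
  have hwu : w ∈ unitary A := by
    rw [hw, Algebra.smul_def]
    exact mul_mem (algebraMap_mem_unitary hzi) hv
  have h1 : (1 : ℂ) ∈ spectrum ℂ w := by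
    have := (spectrum.smul_mem_smul_iff (r := Units.mk0 z⁻¹ (inv_ne_zero hz0))).2 hz
    rw [Units.smul_def, Units.smul_def, Units.val_mk0, smul_eq_mul, inv_mul_cancel₀ hz0] at this
    rwa [hw]
  have hn : IsStarNormal w := ⟨by
    rw [commute_iff_eq, Unitary.star_mul_self_of_mem hwu, Unitary.mul_star_self_of_mem hwu]⟩
  obtain ⟨c, hc⟩ : ∃ c, c = cfcHom hn (cplx (spectrumRe w) 0) := ⟨_, rfl⟩
  obtain ⟨s, hs⟩ : ∃ s, s = cfcHom hn (cplx (spectrumIm w) 0) := ⟨_, rfl⟩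
  have hcs : IsSelfAdjoint c := hc ▸ isSelfAdjoint_cfcHom_cplx hn _
  have hss : IsSelfAdjoint s := hs ▸ isSelfAdjoint_cfcHom_cplx hn _
  have hwcs : w = c + Complex.I • s := by
    rw [hc, hs, ← cfcHom_cplx, cfcHom_cplx_spectrum]
  have e := (isFaceAdditive_cfcHom (hτ.smul_left hz1) hn).map_cplx_of_unimodular
    (c := spectrumRe w) (k := spectrumIm w) (fun x => by
      have : ‖(x : ℂ)‖ = 1 := by simpa using Unitary.spectrum_subset_circle (𝕜 := ℂ) ⟨w, hwu⟩ x.2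
      have h2 := Complex.sq_norm x
      rw [this, Complex.normSq_apply] at h2
      simp only [spectrumRe, spectrumIm, ContinuousMap.coe_mk]
      linarith) (x := ⟨1, h1⟩) Complex.one_re
  rw [cfcHom_cplx_spectrum, cfcHom_cplx_zero_left, ← hc, ← hs, hw, smul_inv_smul₀ hz0,
    smul_smul] at e
  have hzab : (z.re + z.im * Complex.I : ℂ) = z := Complex.re_add_im z
  have hab : z.re ^ 2 + z.im ^ 2 = 1 := by
    have := Complex.sq_norm z
    rw [hz1, Complex.normSq_apply] at this
    linarith
  have hzI : z * Complex.I = ((-z.im : ℝ) + z.re * Complex.I : ℂ) := by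
    conv_lhs => rw [← hzab]
    push_cast
    linear_combination (z.im : ℂ) * Complex.I_sq
  have hv' : v = (z.re • c + (-z.im) • s) + Complex.I • (z.im • c + z.re • s) := by
    have : v = z • w := by rw [hw, smul_inv_smul₀ hz0]
    have hzc : z • c = (z.re + z.im * Complex.I : ℂ) • c := by rw [hzab]
    rw [this, hwcs, smul_add, smul_smul, hzI, hzc]
    simp only [← Complex.coe_smul]
    module
  have sm : ∀ (r : ℝ) {x : A}, IsSelfAdjoint x → IsSelfAdjoint (r • x) := fun r x hx =>
    (IsSelfAdjoint.all r).smul hx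
  have e1 := map_smul_of_isSelfAdjoint hτ hf hcs hab
  have e2 := map_smul_of_isSelfAdjoint hτ hf hss (α := -z.im) (β := z.re) (by linarith)
  rw [hzab] at e1
  rw [← hzI] at e2
  rw [e, e1, e2, hv', reSum_eq _ ((sm _ hcs).add (sm _ hss)) ((sm _ hcs).add (sm _ hss)),
    map_add_of_isSelfAdjoint hτ hf (sm _ hcs) (sm _ hss),
    map_I_smul_add hτ hf (sm _ hcs) (sm _ hss), map_real_smul_of_isSelfAdjoint hτ hcs,
    map_real_smul_of_isSelfAdjoint hτ hss, map_I_real_smul_of_isSelfAdjoint hτ hcs,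
    map_I_real_smul_of_isSelfAdjoint hτ hss]
  module

theorem exists_unitary_add_star {h : A} (hh : IsSelfAdjoint h) (h1 : ‖h‖ ≤ 1) :
    ∃ U ∈ unitary A, U + star U = (2 : ℝ) • h := by
  obtain ⟨U, hU, h2, h3, -, -⟩ := exists_smul_unitary_decomp (K := 1) hh h1 (Commute.one_left _)
  refine ⟨U, ⟨?_, ?_⟩, hU⟩
  · rw [h2, one_pow, one_smul]
  · rw [h3, one_pow, one_smul]

theorem map_unitary_mul_eq_reSum (hτ : IsSphereIso τ) {f : A} (hf : IsSplitting f) {u h : A}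
    (hu : u ∈ unitary A) (hh : IsSelfAdjoint h) : τ (u * h) = reSum τ (u * h) := by
  rcases eq_or_ne h 0 with rfl | h0
  · rw [mul_zero, hτ.map_zero, ← zero_smul ℝ (0 : A), reSum_smul hτ, zero_smul]
  have hpos : 0 < ‖h‖ := norm_pos_iff.2 h0
  obtain ⟨k, hk⟩ : ∃ k, k = ‖h‖⁻¹ • h := ⟨_, rfl⟩
  have hks : IsSelfAdjoint k := hk ▸ (IsSelfAdjoint.all _).smul hh
  have hk1 : ‖k‖ = 1 := by
    rw [hk, norm_smul, norm_inv, norm_norm, inv_mul_cancel₀ hpos.ne']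
  obtain ⟨U, hU, hUk⟩ := exists_unitary_add_star hks hk1.le
  have hU' : star U ∈ unitary A := Unitary.star_mem hU
  have hn : IsStarNormal (U + star U) := by
    rw [hUk]
    exact ((IsSelfAdjoint.all (2 : ℝ)).smul hks).isStarNormal
  have e := map_add_of_isStarNormal (hτ.mul_left hu) hn (by
    rw [norm_eq_one_of_mem_unitary hU, norm_eq_one_of_mem_unitary hU', hUk, norm_smul, hk1]
    norm_num)
  rw [map_eq_reSum_of_mem_unitary hτ hf (mul_mem hu hU),
    map_eq_reSum_of_mem_unitary hτ hf (mul_mem hu hU'), ← reSum_add hτ hf, ← mul_add, hUk,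
    mul_smul_comm, hτ.map_smul _ _ zero_le_two, reSum_smul hτ] at e
  have e' := smul_right_injective Y (two_ne_zero (α := ℝ)) e
  have hhk : h = ‖h‖ • k := by rw [hk, smul_inv_smul₀ hpos.ne']
  rw [hhk, mul_smul_comm, hτ.map_smul _ _ (norm_nonneg _), reSum_smul hτ, e']

theorem exists_unitary_mul_of_isUnit {a : A} (ha : IsUnit a) :
    ∃ u ∈ unitary A, ∃ h : A, IsSelfAdjoint h ∧ ‖h‖ = ‖a‖ ∧ a = u * h := by
  have habs := CFC.abs_mul_abs a
  have hsa : IsSelfAdjoint (CFC.abs a) := IsSelfAdjoint.of_nonneg (CFC.abs_nonneg a)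
  have hu : IsUnit (CFC.abs a) := by
    have : IsUnit (CFC.abs a * CFC.abs a) := by rw [habs]; exact ha.star.mul ha
    exact ((Commute.refl _).isUnit_mul_iff.1 this).1
  obtain ⟨b, hb⟩ := hu
  have hbs : star (↑b⁻¹ : A) = ↑b⁻¹ := by
    have : star b = b := Units.ext (by rw [Units.coe_star, hb, hsa.star_eq])
    rw [← Units.coe_star, star_inv, this]
  have h1 : star (a * ↑b⁻¹) * (a * ↑b⁻¹) = 1 := by
    rw [star_mul, hbs, mul_assoc, ← mul_assoc (star a), ← habs, ← hb, mul_assoc, Units.mul_inv,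
      mul_one, Units.inv_mul]
  refine ⟨a * ↑b⁻¹, ⟨h1, ?_⟩, CFC.abs a, hsa, CFC.norm_abs, ?_⟩
  · obtain ⟨c, hc⟩ := ha.mul b⁻¹.isUnit
    rw [← hc] at h1 ⊢
    have : star (c : A) = ↑c⁻¹ := by rw [← mul_one (star (c : A)), ← c.mul_inv, ← mul_assoc, h1, one_mul]
    rw [this, Units.mul_inv]
  · rw [← hb, Units.inv_mul_cancel_right]

theorem map_isUnit_eq_reSum (hτ : IsSphereIso τ) {f : A} (hf : IsSplitting f) {a : A}
    (ha : IsUnit a) : τ a = reSum τ a := by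
  obtain ⟨u, hu, h, hh, -, rfl⟩ := exists_unitary_mul_of_isUnit ha
  exact map_unitary_mul_eq_reSum hτ hf hu hh

end RealLinear

section Extension

variable {A : Type*} [CStarAlgebra A] [PartialOrder A] [StarOrderedRing A] [Nontrivial A]
variable {Y : Type*} [NormedAddCommGroup Y] [NormedSpace ℝ Y] {τ : A → Y}

theorem exists_add_eq_unitary_add {y u : A} (hy : ‖y‖ < 1) (hu : u ∈ unitary A) :
    ∃ v ∈ unitary A, ∃ w ∈ unitary A, y + u = v + w := by
  have hun := norm_eq_one_of_mem_unitary hu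
  have ha : IsUnit (y + u) := by
    have h1 : y + u = u * (1 - -(star u * y)) := by
      rw [mul_sub, mul_neg, ← mul_assoc, Unitary.mul_star_self_of_mem hu]; noncomm_ring
    rw [h1]
    refine IsUnit.mul ⟨⟨u, star u, Unitary.mul_star_self_of_mem hu,
      Unitary.star_mul_self_of_mem hu⟩, rfl⟩ (isUnit_one_sub_of_norm_lt_one ?_)
    rw [norm_neg]
    refine (norm_mul_le _ _).trans_lt ?_
    rwa [norm_star, hun, one_mul]
  obtain ⟨g, hg, h, hh, hn, e⟩ := exists_unitary_mul_of_isUnit ha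
  obtain ⟨U, hU, hUh⟩ := exists_unitary_add_star (h := (2⁻¹ : ℝ) • h)
    ((IsSelfAdjoint.all _).smul hh) (by
      rw [norm_smul, hn]
      have := norm_add_le y u
      norm_num
      linarith)
  refine ⟨g * U, mul_mem hg hU, g * star U, mul_mem hg (Unitary.star_mem hU), ?_⟩
  rw [← mul_add, hUh, smul_inv_smul₀ two_ne_zero, e]

/-- The unit ball is determined by the unitaries: a form of the Russo–Dye theorem. -/
theorem exists_unitary_norm_add {x : A} (hx : ‖x‖ = 1) {δ : ℝ} (hδ : 0 < δ) :
    ∃ u ∈ unitary A, 2 - δ < ‖x + u‖ := by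
  obtain ⟨φ, hφ, hφx⟩ := exists_support_functional x
  rw [hx] at hφx
  have hne : (φ '' (unitary A : Set A)).Nonempty := ⟨φ 1, 1, one_mem _, rfl⟩
  have hbd : BddAbove (φ '' (unitary A : Set A)) := ⟨1, by
    rintro _ ⟨u, hu, rfl⟩
    exact (apply_le_norm_of_norm_le_one hφ u).trans (norm_eq_one_of_mem_unitary hu).le⟩
  obtain ⟨M, hM⟩ : ∃ M, M = sSup (φ '' (unitary A : Set A)) := ⟨_, rfl⟩
  have hle : ∀ u ∈ unitary A, φ u ≤ M := fun u hu => hM ▸ le_csSup hbd ⟨u, hu, rfl⟩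
  have hy : ∀ y : A, ‖y‖ < 1 → φ y ≤ M := fun y hy => by
    have : M ≤ 2 * M - φ y := by
      conv_lhs => rw [hM]
      refine csSup_le hne ?_
      rintro _ ⟨u, hu, rfl⟩
      obtain ⟨v, hv, w, hw, e⟩ := exists_add_eq_unitary_add hy hu
      have := congrArg φ e
      rw [map_add, map_add] at this
      linarith [hle v hv, hle w hw]
    linarith
  have hM1 : 1 ≤ M := by
    by_contra! hlt
    obtain ⟨r, hr, hr1⟩ := exists_between (max_lt hlt one_pos)
    rw [max_lt_iff] at hr
    have := hy (r • x) (by rwa [norm_smul, hx, mul_one, Real.norm_of_nonneg hr.2.le])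
    rw [map_smul, hφx, smul_eq_mul, mul_one] at this
    linarith
  obtain ⟨_, ⟨u, hu, rfl⟩, hlt⟩ := exists_lt_of_lt_csSup hne
    (show M - δ < sSup (φ '' (unitary A : Set A)) by rw [← hM]; linarith)
  refine ⟨u, hu, ?_⟩
  have := apply_le_norm_of_norm_le_one hφ (x + u)
  rw [map_add] at this
  linarith

theorem exists_mem_spectrum_lt {z : A} (hz : ‖z‖ ≤ 1) {δ : ℝ} (hδ : 0 < δ)
    (h : 2 - δ < ‖1 + z‖) :
    ∃ d ∈ spectrum ℝ (1 - (2⁻¹ : ℝ) • (z + star z)), d < 2 * δ := by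
  by_contra! H
  obtain ⟨D, hD⟩ : ∃ D, D = 1 - (2⁻¹ : ℝ) • (z + star z) := ⟨_, rfl⟩
  rw [← hD] at H
  have hDsa : IsSelfAdjoint D := by
    rw [hD, IsSelfAdjoint, star_sub, star_one, star_smul, star_trivial, star_add, star_star,
      add_comm]
  have h1 : algebraMap ℝ A (2 * δ) ≤ D := algebraMap_le_of_le_spectrum H
  have h2 : star (1 + z) * (1 + z) ≤ (4 - 4 * δ) • (1 : A) := by
    have e : star (1 + z) * (1 + z) = star z * z + 1 + (2 : ℝ) • (1 - D) := by
      rw [hD, sub_sub_cancel, smul_inv_smul₀ two_ne_zero, star_add, star_one]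
      noncomm_ring
    have e2 : (4 - 4 * δ) • (1 : A) = 1 + 1 + (2 : ℝ) • (1 - algebraMap ℝ A (2 * δ)) := by
      rw [Algebra.algebraMap_eq_smul_one]
      module
    rw [e, e2]
    have e3 := norm_le_one_iff_star_mul_self_le.1 hz
    gcongr
  have h3 : 0 ≤ 2 - 2 * δ := by
    by_contra! hneg
    have h4 : (0 : A) ≤ (4 - 4 * δ) • (1 : A) := (star_mul_self_nonneg _).trans h2
    have h5 : (0 : A) ≤ (4 * δ - 4) • (1 : A) := smul_nonneg (by linarith) zero_le_one
    have h6 : (4 - 4 * δ) • (1 : A) = 0 := le_antisymm (by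
      rw [← neg_nonneg, ← neg_smul, neg_sub]; exact h5) h4
    rcases smul_eq_zero.1 h6 with h7 | h7
    · linarith
    · exact one_ne_zero h7
  have h4 := CStarAlgebra.norm_le_norm_of_nonneg_of_le (star_mul_self_nonneg _) h2
  rw [CStarRing.norm_star_mul_self, norm_smul, norm_one, mul_one,
    Real.norm_of_nonneg (by linarith)] at h4
  rcases le_total δ 2 with h5 | h5
  · nlinarith
  · linarith

theorem exists_aligned_near {z : A} (hz : ‖z‖ ≤ 1) {η : ℝ} (hη : 0 < η)
    (h : 2 - η ^ 2 < ‖1 + z‖) : ∃ z' : A, ‖z'‖ ≤ 1 ∧ ‖1 + z'‖ = 2 ∧ ‖z' - z‖ ≤ 8 * η := by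
  obtain ⟨d, hd, hdη⟩ := exists_mem_spectrum_lt hz (by positivity) h
  have hD0 : 0 ≤ 1 - (2⁻¹ : ℝ) • (z + star z) := one_sub_re_nonneg hz
  have hbase : ∀ a : A, ‖a‖ ≤ 1 → 1 - (2⁻¹ : ℝ) • (a + star a) = 1 - (2⁻¹ : ℝ) • (z + star z) →
      1 - (2⁻¹ : ℝ) • (a + star a) ≤ (2 : ℝ) • (1 - (2⁻¹ : ℝ) • (z + star z)) := fun a ha e => by
    rw [e, two_smul]
    exact le_add_of_nonneg_right hD0
  have hb1 := hbase z hz rfl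
  have hb2 := hbase (star z) (by rwa [norm_star]) (by rw [star_star, add_comm])
  obtain ⟨D, hD⟩ : ∃ D, D = 1 - (2⁻¹ : ℝ) • (z + star z) := ⟨_, rfl⟩
  rw [← hD] at hd hD0 hb1 hb2
  have hDsa : IsSelfAdjoint D := IsSelfAdjoint.of_nonneg hD0
  obtain ⟨p, hp⟩ : ∃ p : ℝ → ℝ, ∀ u, p u = max 0 (min 1 (u / (2 * η ^ 2) - 1)) :=
    ⟨_, fun _ => rfl⟩
  have hpc : Continuous p := by
    rw [show p = _ from funext hp]; fun_prop
  have hp0 : ∀ u, 0 ≤ p u := fun u => by rw [hp]; exact le_max_left _ _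
  have hp1 : ∀ u, p u ≤ 1 := fun u => by rw [hp]; exact max_le zero_le_one (min_le_left _ _)
  have hpη : 0 < 2 * η ^ 2 := by positivity
  have hpz : ∀ u, u ≤ 2 * η ^ 2 → p u = 0 := fun u hu => by
    rw [hp, max_eq_left]
    refine (min_le_right _ _).trans ?_
    rw [sub_nonpos, div_le_one hpη]
    exact hu
  have hpo : ∀ u, 4 * η ^ 2 ≤ u → p u = 1 := fun u hu => by
    rw [hp, min_eq_left, max_eq_right zero_le_one]
    rw [le_sub_iff_add_le, le_div_iff₀ hpη]
    linarith
  obtain ⟨q, hq⟩ : ∃ q : ℝ → ℝ, ∀ u, q u = √(1 - p u ^ 2) := ⟨_, fun _ => rfl⟩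
  have hqc : Continuous q := by
    rw [show q = _ from funext hq]; fun_prop
  have hq2 : ∀ u, p u * p u + q u * q u = 1 := fun u => by
    rw [hq, Real.mul_self_sqrt (by nlinarith [hp0 u, hp1 u])]; ring
  obtain ⟨P, hP⟩ : ∃ P, P = cfc p D := ⟨_, rfl⟩
  obtain ⟨Q, hQ⟩ : ∃ Q, Q = cfc q D := ⟨_, rfl⟩
  have hPs : IsSelfAdjoint P := hP ▸ cfc_isSelfAdjoint p D
  have hQs : IsSelfAdjoint Q := hQ ▸ cfc_isSelfAdjoint q D
  have hPQ : Commute P Q := by rw [hP, hQ]; exact cfc_commute_cfc p q D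
  have hsum : P * P + Q * Q = 1 := by
    rw [hP, hQ, ← cfc_mul p p D, ← cfc_mul q q D, ← cfc_add D (fun u => p u * p u)
      (fun u => q u * q u), cfc_congr (fun u _ => hq2 u), cfc_const_one ℝ D]
  have hP1 : 1 - P = cfc (fun u => 1 - p u) D := by
    rw [cfc_sub (fun _ => 1) p D, cfc_const_one ℝ D, hP]
  have hcut : ∀ a : A, ‖a‖ ≤ 1 → 1 - (2⁻¹ : ℝ) • (a + star a) ≤ (2 : ℝ) • D →
      ‖(1 - a) * (1 - P)‖ ≤ 4 * η := fun a ha hb => by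
    rw [hP1]
    refine norm_one_sub_mul_cfc_le ha hD0 hb (by fun_prop) (fun u => by linarith [hp1 u])
      (fun u => by linarith [hp0 u]) hη.le fun u hu => ?_
    by_contra! hlt
    exact hu (by rw [hpo u hlt.le, sub_self])
  have hPn : ‖P‖ ≤ 1 := by
    rw [hP]
    exact norm_cfc_le zero_le_one fun u _ => by
      rw [Real.norm_of_nonneg (hp0 u)]; exact hp1 u
  have hz'1 : ‖P * z * P + Q * 1 * Q‖ ≤ 1 :=
    norm_glue_le_one hPs hQs hPQ hsum hz norm_one.le
  have hz'e : P * z * P + Q * 1 * Q = 1 - P * (1 - z) * P := by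
    rw [mul_one, eq_sub_iff_add_eq, mul_sub, sub_mul, mul_one, ← hsum]; abel
  rw [hz'e] at hz'1
  refine ⟨1 - P * (1 - z) * P, hz'1, ?_, ?_⟩
  · refine le_antisymm ((norm_add_le _ _).trans (by rw [norm_one]; linarith)) ?_
    obtain ⟨e, he⟩ : ∃ e : ℝ → ℝ, ∀ u, e u = max 0 (2 * η ^ 2 - u) := ⟨_, fun _ => rfl⟩
    have hec : Continuous e := by
      rw [show e = _ from funext he]; fun_prop
    have hPe : P * cfc e D = 0 := by
      rw [hP, ← cfc_mul p e D, cfc_congr (g := fun _ => (0 : ℝ)) fun u _ => ?_, cfc_const_zero ℝ D]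
      rcases le_total u (2 * η ^ 2) with hu | hu
      · simp only [hpz u hu, zero_mul]
      · simp only [he]
        rw [max_eq_left (sub_nonpos.2 hu), mul_zero]
    have hpos : 0 < ‖cfc e D‖ := by
      have h1 := norm_apply_le_norm_cfc e D hd
      have h2 : 0 < e d := by rw [he]; exact lt_max_of_lt_right (by linarith)
      exact (norm_pos_iff.2 h2.ne').trans_le h1
    have hfix : (1 + (1 - P * (1 - z) * P)) * cfc e D = (2 : ℝ) • cfc e D := by
      rw [add_mul, sub_mul, mul_assoc _ P, hPe, mul_zero, one_mul, sub_zero, two_smul]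
    have := norm_mul_le (1 + (1 - P * (1 - z) * P)) (cfc e D)
    rw [hfix, norm_smul, Real.norm_of_nonneg zero_le_two] at this
    exact le_of_mul_le_mul_right this hpos
  · have e : 1 - P * (1 - z) * P - z = star ((1 - star z) * (1 - P))
        + P * ((1 - z) * (1 - P)) := by
      simp only [star_mul, star_sub, star_one, star_star, hPs.star_eq]; noncomm_ring
    rw [e]
    have h1 := hcut z hz (hD ▸ hb1)
    have h2 := hcut (star z) (by rwa [norm_star]) hb2
    rw [← norm_star] at h2
    have h3 := (norm_mul_le P ((1 - z) * (1 - P))).trans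
      (mul_le_mul hPn h1 (norm_nonneg _) zero_le_one)
    refine (norm_add_le _ _).trans ?_
    linarith

theorem map_eq_reSum_of_aligned (hτ : IsSphereIso τ) {f : A} (hf : IsSplitting f) {u z : A}
    (hu : u ∈ unitary A) (hz : ‖z‖ ≤ 1) (h : ‖1 + z‖ = 2) : τ (u * z) = reSum τ (u * z) := by
  have hz1 : ‖z‖ = 1 := le_antisymm hz (by
    have := norm_add_le 1 z
    rw [h, norm_one] at this
    linarith)
  have h2 : ‖(2 : ℝ) • (1 : A)‖ = 2 := by rw [norm_smul, norm_one]; norm_num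
  have key := map_add_of_norm_add (hτ.mul_left hu) (a := (2 : ℝ) • 1) (b := z) (by
    refine le_antisymm (norm_add₃_le.trans (by rw [norm_one])) ?_
    rw [h2, hz1]
    have e : (3 : ℝ) • (1 + z) = (1 + (2 : ℝ) • 1 + z) + (2 : ℝ) • z := by module
    have e1 := norm_add_le (1 + (2 : ℝ) • 1 + z) ((2 : ℝ) • z)
    rw [← e, norm_smul, h, norm_smul, hz1] at e1
    norm_num at e1
    linarith) norm_one
  have hunit : IsUnit (u * ((2 : ℝ) • 1 + z)) := by
    refine IsUnit.mul ⟨⟨u, star u, Unitary.mul_star_self_of_mem hu,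
      Unitary.star_mul_self_of_mem hu⟩, rfl⟩ ?_
    have e : (2 : ℝ) • (1 : A) + z = (2 : ℝ) • (1 - (-(2⁻¹ : ℝ)) • z) := by module
    rw [e]
    have := isUnit_one_sub_of_norm_lt_one (x := (-(2⁻¹ : ℝ)) • z) (by
      rw [norm_smul, hz1]; norm_num)
    exact (Units.mk0 (2 : ℝ) two_ne_zero • this.unit).isUnit
  have h2u : u * (2 : ℝ) • (1 : A) = (2 : ℝ) • u := by rw [mul_smul_comm, mul_one]
  rw [map_isUnit_eq_reSum hτ hf hunit, mul_add, reSum_add hτ hf, h2u, reSum_smul hτ,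
    hτ.map_smul _ _ zero_le_two, map_eq_reSum_of_mem_unitary hτ hf hu] at key
  exact (add_left_cancel key).symm

theorem map_eq_reSum (hτ : IsSphereIso τ) {f : A} (hf : IsSplitting f) {x : A} (hx : ‖x‖ = 1) :
    τ x = reSum τ x := by
  have hsub : ∀ x y, reSum τ (x - y) = reSum τ x - reSum τ y := fun x y => by
    rw [sub_eq_add_neg, ← neg_one_smul ℝ y, reSum_add hτ hf, reSum_smul hτ]; module
  have key : ∀ η : ℝ, 0 < η → ‖τ x - reSum τ x‖ ≤ 40 * η := fun η hη => by
    obtain ⟨u, hu, hxu⟩ := exists_unitary_norm_add hx (show 0 < η ^ 2 by positivity)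
    have hun := norm_eq_one_of_mem_unitary hu
    have hu' : star u ∈ unitary A := Unitary.star_mem hu
    have hn : ∀ y : A, ‖u * y‖ = ‖y‖ := fun y =>
      CStarRing.norm_coe_unitary_mul ⟨u, hu⟩ y
    have hux : u * (star u * x) = x := by
      rw [← mul_assoc, Unitary.mul_star_self_of_mem hu, one_mul]
    obtain ⟨z, hz1, hz2, hz3⟩ := exists_aligned_near (z := star u * x)
      (by rw [← hn, hux, hx]) hη (by
        rwa [← hn, mul_add, hux, mul_one, add_comm])
    have hd : ‖u * z - x‖ ≤ 8 * η := by
      rw [← hux, ← mul_sub, hn]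
      exact hz3
    have e1 := hτ.norm_sub_le (u * z) x
    have e2 := norm_reSum_le hτ (u * z - x)
    rw [hsub, ← map_eq_reSum_of_aligned hτ hf hu hz1 hz2] at e2
    have e3 := norm_sub_le (τ (u * z) - reSum τ x) (τ (u * z) - τ x)
    rw [sub_sub_sub_cancel_left] at e3
    linarith
  have : ‖τ x - reSum τ x‖ ≤ 0 := le_of_forall_pos_le_add fun ε hε => by
    have := key (ε / 40) (by positivity)
    linarith
  exact sub_eq_zero.1 (norm_le_zero_iff.1 this)

end Extension

theorem Icc_subset_of_midpoint_mem {S : Set ℝ} (hS : IsClosed S) {α β : ℝ} (hα : α ∈ S)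
    (hβ : β ∈ S) (hmid : ∀ s ∈ S, ∀ t ∈ S, s < t → t - s ≤ β - α → (s + t) / 2 ∈ S) :
    Set.Icc α β ⊆ S := by
  intro t ht
  by_contra htS
  have hl : IsCompact (S ∩ Set.Icc α t) := isCompact_Icc.inter_left hS
  have hr : IsCompact (S ∩ Set.Icc t β) := isCompact_Icc.inter_left hS
  obtain ⟨s₀, hs₀, hs₀max⟩ := hl.exists_isGreatest ⟨α, hα, le_rfl, ht.1⟩
  obtain ⟨t₀, ht₀, ht₀min⟩ := hr.exists_isLeast ⟨β, hβ, ht.2, le_rfl⟩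
  have h1 : s₀ < t := lt_of_le_of_ne hs₀.2.2 fun h => htS (h ▸ hs₀.1)
  have h2 : t < t₀ := lt_of_le_of_ne ht₀.2.1 fun h => htS (h ▸ ht₀.1)
  have hm := hmid s₀ hs₀.1 t₀ ht₀.1 (h1.trans h2) (by linarith [hs₀.2.1, ht₀.2.2])
  rcases le_total ((s₀ + t₀) / 2) t with h | h
  · have := hs₀max ⟨hm, by linarith [hs₀.2.1], h⟩
    linarith
  · have := ht₀min ⟨hm, h, by linarith [ht₀.2.2]⟩
    linarith

section Plane

open Complex

variable {Y : Type*} [NormedAddCommGroup Y] [NormedSpace ℝ Y] {G : ℂ → Y}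

namespace IsSphereIso

theorem map_real_smul_of_odd (hG : IsSphereIso G) (hodd : ∀ z, G (-z) = -G z) (r : ℝ) (z : ℂ) :
    G (r • z) = r • G z := by
  rcases le_total 0 r with hr | hr
  · exact hG.map_smul r z hr
  · have := hG.map_smul (-r) z (neg_nonneg.2 hr)
    rwa [neg_smul, neg_smul, hodd, neg_inj] at this

theorem norm_add_of_odd (hG : IsSphereIso G) (hodd : ∀ z, G (-z) = -G z) {a b : ℂ}
    (hab : ‖a‖ = ‖b‖) : ‖G a + G b‖ = ‖a + b‖ := by
  have := hG.norm_sub (x := a) (y := -b) (by rw [hab, norm_neg])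
  rwa [hodd, sub_neg_eq_add, sub_neg_eq_add] at this

theorem sq_norm_eq (z : ℂ) : ‖z‖ ^ 2 = z.re ^ 2 + z.im ^ 2 := by
  rw [Complex.sq_norm, Complex.normSq_apply]; ring

theorem eq_re_smul_add_im_smul (hG : IsSphereIso G) (hodd : ∀ z, G (-z) = -G z)
    {p q : Y →L[ℝ] ℝ} (hp : ∀ z, ‖z‖ = 1 → |p (G z)| ≤ |z.re|)
    (hq : ∀ z, ‖z‖ = 1 → |q (G z)| ≤ |z.im|) (hp1 : p (G 1) = 1) (hqI : q (G I) = 1) (z : ℂ) :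
    G z = z.re • G 1 + z.im • G I := by
  have hq1 : q (G 1) = 0 := by simpa using hq 1 norm_one
  have hpI : p (G I) = 0 := by simpa using hp I norm_I
  have hN : ∀ y, p y ^ 2 + q y ^ 2 ≤ ‖y‖ ^ 2 := fun y => by
    obtain ⟨w, rfl⟩ := hG.surjective y
    rw [hG.norm_map]
    rcases eq_or_ne w 0 with rfl | hw
    · simp [hG.map_zero]
    have hw' : ‖w‖ ≠ 0 := norm_ne_zero_iff.2 hw
    have hwn : ‖‖w‖⁻¹ • w‖ = 1 := by
      rw [norm_smul, norm_inv, norm_norm, inv_mul_cancel₀ hw']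
    have h1 := sq_le_sq.2 (hp _ hwn)
    have h2 := sq_le_sq.2 (hq _ hwn)
    have h3 := sq_norm_eq (‖w‖⁻¹ • w)
    have h4 : G w = ‖w‖ • G (‖w‖⁻¹ • w) := by
      rw [← hG.map_smul _ _ (norm_nonneg w), smul_inv_smul₀ hw']
    rw [hwn] at h3
    rw [h4, _root_.map_smul, _root_.map_smul, smul_eq_mul, smul_eq_mul, mul_pow, mul_pow, ← mul_add]
    exact mul_le_of_le_one_right (sq_nonneg _) (by linarith)
  obtain ⟨V, hV⟩ : ∃ V : Set ℂ, ∀ w, w ∈ V ↔ p (G w) = w.re ∧ q (G w) = w.im :=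
    ⟨{w | p (G w) = w.re ∧ q (G w) = w.im}, fun _ => Iff.rfl⟩
  have hmem : ∀ w, ‖w‖ ^ 2 ≤ p (G w) ^ 2 + q (G w) ^ 2 → w ∈ V := fun w hw => by
    rcases eq_or_ne w 0 with rfl | hw0
    · simp [hV, hG.map_zero]
    have hr : 0 < ‖w‖ := norm_pos_iff.2 hw0
    have hb : ∀ c : ℂ, ‖c‖ = 1 → p (G c) = c.re → q (G c) = c.im →
        c.re * p (G w) + c.im * q (G w) = c.re * w.re + c.im * w.im := fun c hc e1 e2 => by
      have hcw : ‖‖w‖ • c‖ = ‖w‖ := by rw [norm_smul, norm_norm, hc, mul_one]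
      have h1 := hN (G (‖w‖ • c) + G w)
      have h2 := hN (G (‖w‖ • c) - G w)
      rw [hG.norm_add_of_odd hodd hcw, hG.map_smul _ _ hr.le, map_add, map_add,
        _root_.map_smul, _root_.map_smul, e1, e2, sq_norm_eq] at h1
      rw [hG.norm_sub hcw, hG.map_smul _ _ hr.le, map_sub, map_sub,
        _root_.map_smul, _root_.map_smul, e1, e2, sq_norm_eq] at h2
      simp only [smul_eq_mul, add_re, add_im, sub_re, sub_im, smul_re, smul_im] at h1 h2
      rw [sq_norm_eq] at hw
      have h3 := hN (G w)
      rw [hG.norm_map, sq_norm_eq] at h3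
      refine le_antisymm ?_ ?_ <;> refine le_of_mul_le_mul_left ?_ hr <;> linarith
    have h1 := hb 1 norm_one (by simpa using hp1) (by simpa using hq1)
    have h2 := hb I norm_I (by simpa using hpI) (by simpa using hqI)
    rw [hV]
    exact ⟨by simpa using h1, by simpa using h2⟩
  have hadd : ∀ a ∈ V, ∀ b ∈ V, ‖a‖ = ‖b‖ → a + b ∈ V := fun a ha b hb hab => by
    obtain ⟨w, hw⟩ := hG.surjective (G a + G b)
    have hwn : ‖w‖ = ‖a + b‖ := by rw [← hG.norm_map, hw, hG.norm_add_of_odd hodd hab]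
    have hd := hN (G a - G b)
    rw [hG.norm_sub hab, map_sub, map_sub] at hd
    rw [hV] at ha hb
    have hwV := (hV w).1 (hmem w (by
      rw [hwn, hw, map_add, map_add, ha.1, ha.2, hb.1, hb.2, sq_norm_eq, add_re, add_im]))
    have : w = a + b := by
      rw [hw, map_add, map_add, ha.1, ha.2, hb.1, hb.2] at hwV
      exact Complex.ext hwV.1.symm hwV.2.symm
    rw [← this, hV, hw, map_add, map_add, ha.1, ha.2, hb.1, hb.2, this]
    exact ⟨rfl, rfl⟩
  have hsmul : ∀ (r : ℝ), ∀ a ∈ V, r • a ∈ V := fun r a ha => by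
    rw [hV] at ha ⊢
    rw [hG.map_real_smul_of_odd hodd, _root_.map_smul, _root_.map_smul, ha.1, ha.2, smul_re,
      smul_im]
    exact ⟨rfl, rfl⟩
  have hclosed : IsClosed {t : ℝ | exp (t * I) ∈ V} := by
    have hVc : IsClosed V := by
      have hc := hG.continuous
      rw [show V = {w | p (G w) = w.re} ∩ {w | q (G w) = w.im} from Set.ext hV]
      exact (isClosed_eq (by fun_prop) (by fun_prop)).inter
        (isClosed_eq (by fun_prop) (by fun_prop))
    exact hVc.preimage (f := fun t : ℝ => exp (t * I)) (by fun_prop)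
  have hmid : ∀ s ∈ {t : ℝ | exp (t * I) ∈ V}, ∀ t ∈ {t : ℝ | exp (t * I) ∈ V}, s < t →
      t - s ≤ Real.pi / 2 → (s + t) / 2 ∈ {t : ℝ | exp (t * I) ∈ V} := fun s hs t ht hst hle => by
    have h1 := hadd _ hs _ ht (by rw [norm_exp_ofReal_mul_I, norm_exp_ofReal_mul_I])
    have hcos : 0 < Real.cos ((t - s) / 2) :=
      Real.cos_pos_of_mem_Ioo ⟨by linarith, by linarith⟩
    have e : exp (s * I) + exp (t * I)
        = (2 * Real.cos ((t - s) / 2)) • exp (((s + t) / 2 : ℝ) * I) := by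
      rw [real_smul]
      push_cast
      rw [Complex.cos, mul_div_cancel₀ _ two_ne_zero, add_mul, ← exp_add, ← exp_add, add_comm]
      congr 2 <;> ring
    rw [e] at h1
    have h2 := hsmul (2 * Real.cos ((t - s) / 2))⁻¹ _ h1
    rwa [inv_smul_smul₀ (by positivity)] at h2
  have h0 : (0 : ℝ) ∈ {t : ℝ | exp (t * I) ∈ V} := by
    simp [hV, hp1, hq1]
  have h2 : Real.pi / 2 ∈ {t : ℝ | exp (t * I) ∈ V} := by
    simp [hV, hpI, hqI, exp_pi_div_two_mul_I]
  have h3 : Real.pi ∈ {t : ℝ | exp (t * I) ∈ V} := by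
    simp [hV, hp1, hq1, hodd]
  have hI1 := Icc_subset_of_midpoint_mem hclosed h0 h2 (by simpa only [sub_zero] using hmid)
  have hI2 := Icc_subset_of_midpoint_mem hclosed h2 h3 (by simpa only [sub_half] using hmid)
  have hupper : ∀ w : ℂ, 0 ≤ w.im → w ∈ V := fun w hw => by
    have h4 : exp (w.arg * I) ∈ V := by
      have h5 := arg_nonneg_iff.2 hw
      rcases le_total w.arg (Real.pi / 2) with h | h
      · exact hI1 ⟨h5, h⟩
      · exact hI2 ⟨h, arg_le_pi w⟩
    have := hsmul ‖w‖ _ h4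
    rwa [real_smul, norm_mul_exp_arg_mul_I] at this
  have hall : ∀ w, w ∈ V := fun w => by
    rcases le_total 0 w.im with h | h
    · exact hupper w h
    · simpa using hsmul (-1) _ (hupper (-w) (by simpa using h))
  obtain ⟨w, hw⟩ := hG.surjective (G z - z.re • G 1 - z.im • G I)
  have hw1 := (hV w).1 (hall w)
  have hz1 := (hV z).1 (hall z)
  simp only [hw, map_sub, _root_.map_smul, hz1.1, hz1.2, hp1, hq1, hpI, hqI, smul_eq_mul] at hw1
  have hw0 : w = 0 := Complex.ext (by simpa using hw1.1.symm) (by simpa using hw1.2.symm)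
  rw [hw0, hG.map_zero] at hw
  rw [← sub_eq_zero, hw]
  abel

theorem exists_extremal_direction (hG : IsSphereIso G) (hodd : ∀ z, G (-z) = -G z) :
    ∃ (u : ℂ) (p q : Y →L[ℝ] ℝ), ‖u‖ = 1 ∧ (∀ z, ‖z‖ = 1 → |p (G (u * z))| ≤ |z.re|) ∧
      (∀ z, ‖z‖ = 1 → |q (G (u * z))| ≤ |z.im|) ∧ p (G u) = 1 ∧ q (G (u * I)) = 1 := by
  obtain ⟨f, -, hf⟩ := exists_support_functional (G 1)
  rw [hG.norm_map, norm_one] at hf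
  have hy : G I - f (G I) • G 1 ≠ 0 := fun h => by
    rw [← hG.map_real_smul_of_odd hodd, sub_eq_zero] at h
    have := congrArg Complex.im (hG.injective h)
    simp at this
  obtain ⟨g, -, hg⟩ := exists_support_functional (G I - f (G I) • G 1)
  obtain ⟨ω, hω⟩ : ∃ ω : Y → Y →L[ℝ] ℝ, ∀ x, ω x = f x • g - g x • f := ⟨_, fun _ => rfl⟩
  have hωa : ∀ x y, ω x y = f x * g y - g x * f y := fun x y => by rw [hω]; simp
  have hω0 : 0 < |ω (G 1) (G I)| := by
    rw [hωa, hf, one_mul, abs_pos, mul_comm, ← smul_eq_mul, ← _root_.map_smul, ← map_sub, hg]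
    exact norm_ne_zero_iff.2 hy
  have hcont : Continuous fun z : ℂ × ℂ => |ω (G z.1) (G z.2)| := by
    have hc := hG.continuous
    simp only [hωa]
    fun_prop
  obtain ⟨⟨u, v⟩, huv, hmax⟩ := ((isCompact_sphere (0 : ℂ) 1).prod
    (isCompact_sphere (0 : ℂ) 1)).exists_isMaxOn ⟨(1, I), by simp⟩ hcont.continuousOn
  simp only [Set.mem_prod, mem_sphere_zero_iff_norm] at huv
  obtain ⟨M, hM⟩ : ∃ M, M = |ω (G u) (G v)| := ⟨_, rfl⟩
  have hM1 : ∀ a b, ‖a‖ = 1 → ‖b‖ = 1 → |ω (G a) (G b)| ≤ M := fun a b ha hb => by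
    rw [hM]
    exact hmax (a := (a, b)) (by simp [ha, hb])
  have hM0 : 0 < M := hω0.trans_le (hM1 1 I norm_one norm_I)
  have hM2 : ∀ a b, |ω (G a) (G b)| ≤ M * (‖a‖ * ‖b‖) := fun a b => by
    rcases eq_or_ne a 0 with rfl | ha
    · simp [hωa, hG.map_zero]
    rcases eq_or_ne b 0 with rfl | hb
    · simp [hωa, hG.map_zero]
    have ha' : ‖a‖ ≠ 0 := norm_ne_zero_iff.2 ha
    have hb' : ‖b‖ ≠ 0 := norm_ne_zero_iff.2 hb
    have h1 := hM1 (‖a‖⁻¹ • a) (‖b‖⁻¹ • b)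
      (by rw [norm_smul, norm_inv, norm_norm, inv_mul_cancel₀ ha'])
      (by rw [norm_smul, norm_inv, norm_norm, inv_mul_cancel₀ hb'])
    have ea : G a = ‖a‖ • G (‖a‖⁻¹ • a) := by
      rw [← hG.map_smul _ _ (norm_nonneg a), smul_inv_smul₀ ha']
    have eb : G b = ‖b‖ • G (‖b‖⁻¹ • b) := by
      rw [← hG.map_smul _ _ (norm_nonneg b), smul_inv_smul₀ hb']
    have e : ω (G a) (G b) = (‖a‖ * ‖b‖) * ω (G (‖a‖⁻¹ • a)) (G (‖b‖⁻¹ • b)) := by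
      rw [hωa, hωa, ea, eb]
      simp only [_root_.map_smul, smul_eq_mul]
      ring
    rw [e, abs_mul, abs_of_nonneg (by positivity), mul_comm]
    gcongr
  have hM3 : ∀ a b, ‖a‖ = 1 → ‖b‖ = 1 →
      |ω (G a) (G b)| ≤ M * |a.re * b.im - a.im * b.re| := fun a b ha hb => by
    obtain ⟨w, hw⟩ := hG.surjective (G a + G b)
    obtain ⟨w', hw'⟩ := hG.surjective (G a - G b)
    have h1 := hM2 w w'
    rw [← hG.norm_map w, ← hG.norm_map w', hw, hw', hG.norm_add_of_odd hodd (ha.trans hb.symm),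
      hG.norm_sub (ha.trans hb.symm)] at h1
    have e1 : ω (G a + G b) (G a - G b) = -2 * ω (G a) (G b) := by
      simp only [hωa, map_add, map_sub]; ring
    have e2 : ‖a + b‖ * ‖a - b‖ = 2 * |a.re * b.im - a.im * b.re| := by
      have ha2 := sq_norm_eq a
      have hb2 := sq_norm_eq b
      rw [ha] at ha2
      rw [hb] at hb2
      refine (sq_eq_sq₀ (by positivity) (by positivity)).1 ?_
      rw [mul_pow, mul_pow, sq_abs, sq_norm_eq, sq_norm_eq, add_re, add_im, sub_re, sub_im]
      have ha3 : a.re ^ 2 = 1 - a.im ^ 2 := by linarith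
      have hb3 : b.re ^ 2 = 1 - b.im ^ 2 := by linarith
      grind
    rw [e1, e2, abs_mul, abs_neg, abs_two] at h1
    linarith
  have hd : 1 ≤ |u.re * v.im - u.im * v.re| := by
    have := hM3 u v huv.1 huv.2
    rw [← hM] at this
    exact le_of_mul_le_mul_left (by linarith) hM0
  have hv : |ω (G u) (G (u * I))| = M := by
    have hu2 := sq_norm_eq u
    have hv2 := sq_norm_eq v
    rw [huv.1] at hu2
    rw [huv.2] at hv2
    rcases le_total 0 (u.re * v.im - u.im * v.re) with h | h
    · rw [abs_of_nonneg h] at hd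
      have : v = u * I := Complex.ext
        (by rw [mul_I_re]; nlinarith [sq_nonneg (v.re + u.im), sq_nonneg (v.im - u.re)])
        (by rw [mul_I_im]; nlinarith [sq_nonneg (v.re + u.im), sq_nonneg (v.im - u.re)])
      rw [← this, hM]
    · rw [abs_of_nonpos h] at hd
      have : v = -(u * I) := Complex.ext
        (by rw [neg_re, mul_I_re]; nlinarith [sq_nonneg (v.re - u.im), sq_nonneg (v.im + u.re)])
        (by rw [neg_im, mul_I_im]; nlinarith [sq_nonneg (v.re - u.im), sq_nonneg (v.im + u.re)])
      rw [hM, this, hodd, map_neg, abs_neg]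
  obtain ⟨c, hc⟩ : ∃ c, c = ω (G u) (G (u * I)) := ⟨_, rfl⟩
  rw [← hc] at hv
  have hc0 : c ≠ 0 := fun h => by rw [h, abs_zero] at hv; exact hM0.ne hv
  have hanti : ∀ x y, ω x y = -ω y x := fun x y => by rw [hωa, hωa]; ring
  have hu2 := sq_norm_eq u
  rw [huv.1] at hu2
  have hmul : ∀ z : ℂ, ‖z‖ = 1 → ‖u * z‖ = 1 := fun z hz => by rw [norm_mul, huv.1, hz, one_mul]
  refine ⟨u, -c⁻¹ • ω (G (u * I)), c⁻¹ • ω (G u), huv.1, fun z hz => ?_, fun z hz => ?_, ?_, ?_⟩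
  · have h1 := hM3 (u * I) (u * z) (hmul I norm_I) (hmul z hz)
    have e : (u * I).re * (u * z).im - (u * I).im * (u * z).re = -z.re := by
      simp only [mul_re, mul_im, I_re, I_im]
      linear_combination z.re * hu2
    rw [e, abs_neg, ← hv] at h1
    rw [smul_apply, smul_eq_mul, abs_mul, abs_neg, abs_inv,
      inv_mul_le_iff₀ (abs_pos.2 hc0)]
    exact h1
  · have h1 := hM3 u (u * z) huv.1 (hmul z hz)
    have e : u.re * (u * z).im - u.im * (u * z).re = z.im := by
      simp only [mul_re, mul_im]
      linear_combination -z.im * hu2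
    rw [e, ← hv] at h1
    rw [smul_apply, smul_eq_mul, abs_mul, abs_inv,
      inv_mul_le_iff₀ (abs_pos.2 hc0)]
    exact h1
  · rw [smul_apply, hanti, ← hc, smul_eq_mul, neg_mul_neg,
      inv_mul_cancel₀ hc0]
  · rw [smul_apply, ← hc, smul_eq_mul, inv_mul_cancel₀ hc0]

theorem map_add_of_odd (hG : IsSphereIso G) (hodd : ∀ z, G (-z) = -G z) (a b : ℂ) :
    G (a + b) = G a + G b := by
  obtain ⟨u, p, q, hu, hp, hq, hpu, hqu⟩ := hG.exists_extremal_direction hodd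
  have hn : ∀ z : ℂ, ‖u * z‖ = ‖z‖ := fun z => by rw [norm_mul, hu, one_mul]
  have hu0 : u ≠ 0 := norm_ne_zero_iff.1 (by rw [hu]; exact one_ne_zero)
  have hH : IsSphereIso fun z => G (u * z) :=
    { norm_map_unit := fun z hz => by rw [hG.norm_map, hn, hz]
      norm_sub_unit := fun z w hz hw => by
        rw [hG.norm_sub (by rw [hn, hn, hz, hw]), ← mul_sub, hn]
      exists_unit := fun y hy => by
        obtain ⟨z, hz, rfl⟩ := hG.exists_unit y hy
        refine ⟨u⁻¹ * z, ?_, by rw [mul_inv_cancel_left₀ hu0]⟩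
        rw [← hn, mul_inv_cancel_left₀ hu0, hz]
      map_smul := fun r z hr => by rw [mul_smul_comm, hG.map_smul _ _ hr] }
  have key := hH.eq_re_smul_add_im_smul (fun z => by rw [mul_neg, hodd]) hp hq
    (by rw [mul_one, hpu]) hqu
  have e : ∀ z, G z = (u⁻¹ * z).re • G (u * 1) + (u⁻¹ * z).im • G (u * I) := fun z => by
    rw [← key, mul_inv_cancel_left₀ hu0]
  rw [e, e a, e b, mul_add, add_re, add_im]
  module

end IsSphereIso

end Plane

section HomogeneousExtension

variable {X Y : Type*} [NormedAddCommGroup X] [NormedSpace ℝ X]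
    [NormedAddCommGroup Y] [NormedSpace ℝ Y]

theorem norm_inv_norm_smul {x : X} (hx : x ≠ 0) : ‖‖x‖⁻¹ • x‖ = 1 := by
  rw [norm_smul, norm_inv, norm_norm, inv_mul_cancel₀ (norm_ne_zero_iff.2 hx)]

theorem exists_isSphereIso {T : X → Y}
    (hT : ∀ x ∈ Metric.sphere (0 : X) 1, ∀ y ∈ Metric.sphere (0 : X) 1,
      dist (T x) (T y) = dist x y)
    (hS : T '' Metric.sphere (0 : X) 1 = Metric.sphere (0 : Y) 1) :
    ∃ τ : X → Y, IsSphereIso τ ∧ ∀ x, ‖x‖ = 1 → τ x = T x := by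
  simp only [mem_sphere_zero_iff_norm, dist_eq_norm] at hT
  have hτ : ∀ x : X, ‖x‖ = 1 → ‖x‖ • T (‖x‖⁻¹ • x) = T x := fun x hx => by
    rw [hx, inv_one, one_smul, one_smul]
  refine ⟨fun x => ‖x‖ • T (‖x‖⁻¹ • x), ⟨fun x hx => ?_, fun x y hx hy => ?_, fun y hy => ?_,
    fun r x hr => ?_⟩, hτ⟩
  · rw [hτ x hx, ← mem_sphere_zero_iff_norm, ← hS]
    exact ⟨x, mem_sphere_zero_iff_norm.2 hx, rfl⟩
  · rw [hτ x hx, hτ y hy, hT x hx y hy]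
  · rw [← mem_sphere_zero_iff_norm, ← hS] at hy
    obtain ⟨x, hx, rfl⟩ := hy
    rw [mem_sphere_zero_iff_norm] at hx
    exact ⟨x, hx, hτ x hx⟩
  · rcases hr.eq_or_lt with rfl | hr'
    · simp
    · rw [norm_smul, Real.norm_of_nonneg hr, mul_smul, mul_inv, mul_comm r⁻¹, mul_smul,
        inv_smul_smul₀ hr'.ne']

theorem IsSphereIso.exists_linearIsometry {τ : X → Y} (hτ : IsSphereIso τ)
    (hadd : ∀ x y, τ (x + y) = τ x + τ y) (hsmul : ∀ (r : ℝ) (x), τ (r • x) = r • τ x) :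
    ∃ g : X →ₗᵢ[ℝ] Y, Function.Surjective g ∧ ∀ x, g x = τ x :=
  ⟨⟨⟨⟨τ, hadd⟩, hsmul⟩, hτ.norm_map⟩, hτ.surjective, fun _ => rfl⟩

end HomogeneousExtension

section Dichotomy

variable {A : Type*} [CStarAlgebra A] [PartialOrder A] [StarOrderedRing A] [Nontrivial A]
variable {Y : Type*} [NormedAddCommGroup Y] [NormedSpace ℝ Y] {τ : A → Y}

open ComplexStarModule

theorem exists_eq_smul_one_of_forall_not_isSplitting (h : ∀ f : A, ¬IsSplitting f) (x : A) :
    ∃ z : ℂ, x = z • 1 := by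
  have hsa : ∀ y : A, IsSelfAdjoint y → ∃ z : ℂ, y = z • 1 := fun y hy => by
    obtain ⟨c, hc⟩ := spectrum.nonempty y
    refine ⟨c, ?_⟩
    rw [← Algebra.algebraMap_eq_smul_one]
    refine CFC.eq_algebraMap_of_spectrum_subset_singleton (R := ℂ) (p := IsStarNormal) y c ?_
      hy.isStarNormal
    intro d hd
    by_contra hne
    obtain ⟨f, hf⟩ := exists_isSplitting hy (x := ⟨d, hd⟩) (y := ⟨c, hc⟩)
      fun e => hne (congrArg Subtype.val e)
    exact h f hf
  obtain ⟨a, ha⟩ := hsa (ℜ x) (ℜ x).2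
  obtain ⟨b, hb⟩ := hsa (ℑ x) (ℑ x).2
  refine ⟨a + Complex.I * b, ?_⟩
  rw [← realPart_add_I_smul_imaginaryPart x, ha, hb, add_smul, mul_smul]

theorem IsSphereIso.exists_linearIsometry_of_isSplitting (hτ : IsSphereIso τ) {f : A}
    (hf : IsSplitting f) : ∃ g : A →ₗᵢ[ℝ] Y, Function.Surjective g ∧ ∀ x, g x = τ x := by
  have key : ∀ x, τ x = reSum τ x := fun x => by
    rcases eq_or_ne x 0 with rfl | hx
    · have := reSum_smul hτ 0 (0 : A)
      rw [zero_smul, zero_smul] at this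
      rw [hτ.map_zero, this]
    · have := map_eq_reSum hτ hf (norm_inv_norm_smul hx)
      rwa [reSum_smul hτ, hτ.map_smul _ _ (by positivity),
        smul_right_inj (inv_ne_zero (norm_ne_zero_iff.2 hx))] at this
  exact hτ.exists_linearIsometry (fun x y => by rw [key, key x, key y, reSum_add hτ hf])
    fun r x => by rw [key, key x, reSum_smul hτ]

theorem IsSphereIso.exists_linearIsometry_of_eq_smul_one (hτ : IsSphereIso τ)
    (h : ∀ x : A, ∃ z : ℂ, x = z • 1) :
    ∃ g : A →ₗᵢ[ℝ] Y, Function.Surjective g ∧ ∀ x, g x = τ x := by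
  have hn : ∀ z : ℂ, ‖z • (1 : A)‖ = ‖z‖ := fun z => by rw [norm_smul, norm_one, mul_one]
  have hG : IsSphereIso fun z : ℂ => τ (z • 1) :=
    { norm_map_unit := fun z hz => by rw [hτ.norm_map, hn, hz]
      norm_sub_unit := fun z w hz hw => by
        rw [hτ.norm_sub (by rw [hn, hn, hz, hw]), ← sub_smul, hn]
      exists_unit := fun y hy => by
        obtain ⟨x, hx, rfl⟩ := hτ.exists_unit y hy
        obtain ⟨z, rfl⟩ := h x
        exact ⟨z, by rw [← hn, hx], rfl⟩
      map_smul := fun r z hr => by rw [← hτ.map_smul _ _ hr, smul_assoc] }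
  have hodd : ∀ z : ℂ, τ (-z • 1) = -τ (z • 1) := fun z => by
    rcases eq_or_ne z 0 with rfl | hz
    · simp [hτ.map_zero]
    have h1 := map_neg_of_mem_unitary hτ (algebraMap_mem_unitary (A := A) (norm_inv_norm_smul hz))
    have e : z • (1 : A) = ‖z‖ • algebraMap ℂ A (‖z‖⁻¹ • z) := by
      rw [Algebra.algebraMap_eq_smul_one, smul_assoc, smul_inv_smul₀ (norm_ne_zero_iff.2 hz)]
    rw [neg_smul, e, ← smul_neg, hτ.map_smul _ _ (norm_nonneg z), hτ.map_smul _ _ (norm_nonneg z),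
      h1, smul_neg]
  refine hτ.exists_linearIsometry (fun x y => ?_) fun r x => ?_
  · obtain ⟨a, rfl⟩ := h x
    obtain ⟨b, rfl⟩ := h y
    rw [← add_smul]
    exact hG.map_add_of_odd hodd a b
  · obtain ⟨a, rfl⟩ := h x
    rw [← smul_assoc]
    exact hG.map_real_smul_of_odd hodd r a

end Dichotomy

theorem IsSphereIso.exists_linearIsometry_of_cstarAlgebra {A Y : Type*} [CStarAlgebra A]
    [NormedAddCommGroup Y] [NormedSpace ℝ Y] {τ : A → Y} (hτ : IsSphereIso τ) :
    ∃ g : A →ₗᵢ[ℝ] Y, Function.Surjective g ∧ ∀ x, g x = τ x := by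
  rcases subsingleton_or_nontrivial A with hA | hA
  · exact hτ.exists_linearIsometry
      (fun x y => by
        rw [Subsingleton.elim x 0, Subsingleton.elim y 0, add_zero, hτ.map_zero, add_zero])
      fun r x => by rw [Subsingleton.elim x 0, smul_zero, hτ.map_zero, smul_zero]
  · let _ := CStarAlgebra.spectralOrder A
    have := CStarAlgebra.spectralOrderedRing A
    by_cases h : ∃ f : A, IsSplitting f
    · obtain ⟨f, hf⟩ := h
      exact hτ.exists_linearIsometry_of_isSplitting hf
    · exact hτ.exists_linearIsometry_of_eq_smul_one
        (exists_eq_smul_one_of_forall_not_isSplitting (not_exists.1 h))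

/-- Every unital complex C*-algebra, regarded as a real Banach space,
has the Mazur–Ulam property. -/
theorem unital_cstarAlgebra_hasMazurUlamProperty (A : Type*) [CStarAlgebra A] :
    HasMazurUlamProperty A := by
  intro Y _ _ T hT hS
  obtain ⟨τ, hτ, h⟩ := exists_isSphereIso hT hS
  obtain ⟨g, hg, hgτ⟩ := hτ.exists_linearIsometry_of_cstarAlgebra
  exact ⟨g, hg, fun x hx => by rw [hgτ, h x (mem_sphere_zero_iff_norm.1 hx)]⟩
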